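/- Let G be the simple graph on six vertices v1,...,v6 whose edges are the path edges v1v2, v2v3, v3v4, v4v5, v5v6 together with the chords v2v4, v3v5 and v4v6 (the graph G^6_98). Then the crossing numbers of the Cartesian products G □ C_3 and G □ C_4 are 9 and 12 respectively. -/

import Mathlib

open SimpleGraph

/-- A drawing of a simple graph in the plane: vertices are mapped to distinct
points, and each edge is mapped to a simple arc (parametrised by `[0,1]`)
joining the images of its endpoints and avoiding the images of all vertices
in its interior. -/
structure Drawing {V : Type*} (G : SimpleGraph V) where
  vertexMap : V → ℝ × ℝ
  vertexMap_injective : Function.Injective vertexMap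
  arc : G.edgeSet → ℝ → ℝ × ℝ
  arc_continuousOn : ∀ e, ContinuousOn (arc e) (Set.Icc 0 1)
  arc_injOn : ∀ e, Set.InjOn (arc e) (Set.Icc 0 1)
  arc_endpoints : ∀ e : G.edgeSet, ∃ u v : V,
    (e : Sym2 V) = s(u, v) ∧ arc e 0 = vertexMap u ∧ arc e 1 = vertexMap v
  arc_avoids_vertices : ∀ e : G.edgeSet, ∀ t ∈ Set.Ioo (0 : ℝ) 1, ∀ w : V,
    arc e t ≠ vertexMap w

/-- The crossings of a drawing: an unordered pair of distinct edges together
with a point of the plane where the two corresponding arcs intersect away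
from their endpoints. -/
def Drawing.crossings {V : Type*} {G : SimpleGraph V} (D : Drawing G) :
    Set (Sym2 G.edgeSet × (ℝ × ℝ)) :=
  { x | ∃ e f : G.edgeSet, e ≠ f ∧ x.1 = s(e, f) ∧
      (∃ s ∈ Set.Ioo (0 : ℝ) 1, D.arc e s = x.2) ∧
      (∃ t ∈ Set.Ioo (0 : ℝ) 1, D.arc f t = x.2) }

/-- The crossing number of a simple graph: the minimum number of crossings
over all drawings of the graph in the plane. -/
noncomputable def crossingNumber {V : Type*} (G : SimpleGraph V) : ℕ :=
  sInf { n : ℕ | ∃ D : Drawing G, D.crossings.Finite ∧ D.crossings.ncard = n }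

/-- The graph `G⁶₉₈`: the path `v1 v2 v3 v4 v5 v6` together with the chords `v2v4`, `v3v5` and `v4v6`. -/
def G6_98 : SimpleGraph (Fin 6) :=
  SimpleGraph.fromEdgeSet {s(0, 1), s(1, 2), s(2, 3), s(3, 4), s(4, 5), s(1, 3), s(2, 4), s(3, 5)}

open Real in
theorem exists_angle_lift {A : Type*} [TopologicalSpace A] [SimplyConnectedSpace A]
    [LocallyPathConnectedSpace A] {F : A → ℂ} (hF : Continuous F) (h0 : ∀ a, F a ≠ 0)
    (a₀ : A) (θ₀ : ℝ) (h : (θ₀ : Real.Angle) = (F a₀).arg) :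
    ∃! θ : C(A, ℝ), θ a₀ = θ₀ ∧ ∀ a, (θ a : Real.Angle) = (F a).arg := by
  have hc : Continuous fun a => ((F a).arg : Real.Angle) :=
    continuous_iff_continuousAt.2 fun a =>
      (Complex.continuousAt_arg_coe_angle (h0 a)).comp hF.continuousAt
  have := (AddCircle.isCoveringMap_coe (2 * π)).existsUnique_continuousMap_lifts
    ⟨_, hc⟩ a₀ θ₀ h
  refine (existsUnique_congr fun θ => and_congr_right fun _ => ?_).mp this
  exact funext_iff

theorem angle_lift_sub_eq {F : ℝ → ℂ} (hF : Continuous F) (h0 : ∀ t, F t ≠ 0) {θ₁ θ₂ : C(ℝ, ℝ)}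
    (h₁ : ∀ t, (θ₁ t : Real.Angle) = (F t).arg) (h₂ : ∀ t, (θ₂ t : Real.Angle) = (F t).arg) :
    θ₁ 1 - θ₁ 0 = θ₂ 1 - θ₂ 0 := by
  have key : θ₁ = θ₂ + .const ℝ (θ₁ 0 - θ₂ 0) := by
    refine (exists_angle_lift hF h0 0 (θ₁ 0) (h₁ 0)).unique ⟨rfl, h₁⟩ ⟨by simp, fun t => ?_⟩
    simp [h₁, h₂]
  have := congrArg (· 1) key
  simp at this
  linarith

theorem exists_angle_variation {F : ℝ → ℂ} (hF : Continuous F) (h0 : ∀ t, F t ≠ 0) {α β : ℝ}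
    (hα : (α : Real.Angle) = (F 0).arg) (hβ : (β : Real.Angle) = (F 1).arg) :
    ∃ k : ℤ, ∀ θ : C(ℝ, ℝ), (∀ t, (θ t : Real.Angle) = (F t).arg) →
      θ 1 - θ 0 = β - α + 2 * Real.pi * k := by
  obtain ⟨θ, ⟨hθ0, hθ⟩, -⟩ := exists_angle_lift hF h0 0 α hα
  obtain ⟨k, hk⟩ := Real.Angle.angle_eq_iff_two_pi_dvd_sub.1 ((hθ 1).trans hβ.symm)
  refine ⟨k, fun θ' hθ' => ?_⟩
  rw [angle_lift_sub_eq hF h0 hθ' hθ, hθ0]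
  linarith

theorem exists_switching {ι : Type*} [LinearOrder ι] (p : ι → ℂ) (E : ι → ι → Prop)
    (γ : ι → ι → ℝ → ℂ) {S : Set ι} (hp : S.InjOn p) (hS : ∀ a b, E a b → a ∈ S ∧ b ∈ S)
    (hc : ∀ a b, E a b → Continuous (γ a b)) (h0 : ∀ a b, E a b → γ a b 0 = p a)
    (h1 : ∀ a b, E a b → γ a b 1 = p b)
    (hv : ∀ a b, E a b → ∀ w ∈ S, w ≠ a → w ≠ b → ∀ t, γ a b t ≠ p w) :
    ∃ s : ι → ι → ι → ZMod 2, ∀ a b c d, E a b → E c d → a ≠ c → a ≠ d → b ≠ c → b ≠ d →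
      (∀ u v, γ a b u ≠ γ c d v) →
      s a b c + s a b d + s c d a + s c d b + ((if b < c then 1 else 0) + (if d < b then 1 else 0)
        + (if c < a then 1 else 0) + (if a < d then 1 else 0)) = 0 := by
  -- `A w u` lifts the direction from `w` to `u`
  obtain ⟨A, hA, hA'⟩ : ∃ A : ι → ι → ℝ,
      (∀ w ∈ S, ∀ u ∈ S, w ≠ u → (A w u : Real.Angle) = (p u - p w).arg) ∧
      ∀ u w, u ≠ w → A w u - A u w = Real.pi * (2 * (if u < w then 1 else 0) - 1) := by
    refine ⟨fun w u => if w < u then (p u - p w).arg else (p w - p u).arg + Real.pi, ?_, ?_⟩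
    · intro w hw u hu h
      dsimp only
      split_ifs with h'
      · rfl
      · rw [← neg_sub (p w) (p u), Complex.arg_neg_coe_angle (sub_ne_zero.2 (hp.ne hw hu h))]
        simp
    · intro u w h
      rcases lt_or_gt_of_ne h with h | h
      · simp [h, h.not_gt]; ring
      · simp [h, h.not_gt]
  have hk : ∀ a b w, ∃ k : ℤ, E a b → w ∈ S → w ≠ a → w ≠ b → ∀ θ : C(ℝ, ℝ),
      (∀ t, (θ t : Real.Angle) = (γ a b t - p w).arg) →
      θ 1 - θ 0 = A w b - A w a + 2 * Real.pi * k := by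
    intro a b w
    by_cases h : E a b ∧ w ∈ S ∧ w ≠ a ∧ w ≠ b
    · obtain ⟨h, hw, ha, hb⟩ := h
      obtain ⟨k, hk⟩ := exists_angle_variation (F := fun t => γ a b t - p w)
        ((hc a b h).sub continuous_const) (fun t => sub_ne_zero.2 (hv a b h w hw ha hb t))
        (α := A w a) (β := A w b) (by rw [hA _ hw _ (hS _ _ h).1 ha, h0 a b h]) (by rw [hA _ hw _ (hS _ _ h).2 hb, h1 a b h])
      exact ⟨k, fun _ _ _ _ => hk⟩
    · exact ⟨0, fun h1 h2 h3 h4 => absurd ⟨h1, h2, h3, h4⟩ h⟩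
  choose k hk using hk
  refine ⟨fun a b w => k a b w, fun a b c d hab hcd hac had hbc hbd hdisj => ?_⟩
  have hF : Continuous fun x : ℝ × ℝ => γ a b x.1 - γ c d x.2 :=
    ((hc a b hab).comp continuous_fst).sub ((hc c d hcd).comp continuous_snd)
  obtain ⟨Θ, ⟨-, hΘ⟩, -⟩ := exists_angle_lift hF (fun x => sub_ne_zero.2 (hdisj _ _)) (0, 0)
    ((γ a b 0 - γ c d 0).arg) rfl
  have neg_arg : ∀ z w : ℂ, z ≠ w → ((z - w).arg : Real.Angle) = ((w - z).arg : Real.Angle) + Real.pi :=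
    fun z w h => by rw [← neg_sub w z, Complex.arg_neg_coe_angle (sub_ne_zero.2 h.symm)]
  have e1 := hk a b c hab (hS _ _ hcd).1 hac.symm hbc.symm (Θ.comp ⟨fun t => (t, 0), by fun_prop⟩)
    (fun t => by simpa [h0 c d hcd] using hΘ (t, 0))
  have e2 := hk a b d hab (hS _ _ hcd).2 had.symm hbd.symm (Θ.comp ⟨fun t => (t, 1), by fun_prop⟩)
    (fun t => by simpa [h1 c d hcd] using hΘ (t, 1))
  have e3 := hk c d a hcd (hS _ _ hab).1 hac had (Θ.comp ⟨fun t => (0, t), by fun_prop⟩ - .const ℝ Real.pi)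
    (fun t => by
      have := hΘ (0, t)
      rw [h0 a b hab, neg_arg _ _ (hv c d hcd a (hS _ _ hab).1 hac had t).symm] at this
      simp [this])
  have e4 := hk c d b hcd (hS _ _ hab).2 hbc hbd (Θ.comp ⟨fun t => (1, t), by fun_prop⟩ - .const ℝ Real.pi)
    (fun t => by
      have := hΘ (1, t)
      rw [h1 a b hab, neg_arg _ _ (hv c d hcd b (hS _ _ hab).2 hbc hbd t).symm] at this
      simp [this])
  simp only [ContinuousMap.comp_apply, ContinuousMap.coe_mk, ContinuousMap.sub_apply,
    ContinuousMap.const_apply] at e1 e2 e3 e4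
  have f1 := hA' b c hbc
  have f2 := hA' d b hbd.symm
  have f3 := hA' c a hac.symm
  have f4 := hA' a d had
  have key : ((k a b c - k a b d + k c d b - k c d a + ((if b < c then 1 else 0)
      + (if d < b then 1 else 0) + (if c < a then 1 else 0) + (if a < d then 1 else 0)) - 2 : ℤ) : ℝ)
      * (2 * Real.pi) = 0 := by
    push_cast
    linarith
  have key' := (mul_eq_zero.1 key).resolve_right (by positivity)
  have key2 : ((_ : ℤ) : ZMod 2) = 0 := congrArg (Int.cast : ℤ → ZMod 2) (Int.cast_eq_zero.1 key') |>.trans Int.cast_zero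
  push_cast at key2
  have two : (2 : ZMod 2) = 0 := rfl
  rw [two, sub_zero] at key2
  simp only [CharTwo.sub_eq_add] at key2
  linear_combination key2

theorem Drawing.exists_path {V : Type*} {G : SimpleGraph V} (D : Drawing G) {u v : V}
    (h : G.Adj u v) :
    ∃ γ : ℝ → ℂ, Continuous γ ∧ γ 0 = Complex.equivRealProd.symm (D.vertexMap u) ∧
      γ 1 = Complex.equivRealProd.symm (D.vertexMap v) ∧
      ∀ t, γ t = Complex.equivRealProd.symm (D.vertexMap u) ∨
        γ t = Complex.equivRealProd.symm (D.vertexMap v) ∨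
        ∃ τ ∈ Set.Ioo (0 : ℝ) 1, γ t = Complex.equivRealProd.symm (D.arc ⟨s(u, v), h⟩ τ) := by
  set e : G.edgeSet := ⟨s(u, v), h⟩
  obtain ⟨c, hc, k0, k1, key⟩ : ∃ c : ℝ → ℝ × ℝ, Continuous c ∧ c 0 = D.arc e 0 ∧
      c 1 = D.arc e 1 ∧ ∀ t, ∃ τ ∈ Set.Icc (0 : ℝ) 1, c t = D.arc e τ :=
    ⟨fun t => D.arc e (Set.projIcc 0 1 zero_le_one t),
      (continuousOn_iff_continuous_domRestrict.1 (D.arc_continuousOn e)).Icc_extend' (h := zero_le_one),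
      by simp [Set.projIcc_left], by simp [Set.projIcc_right],
      fun t => ⟨_, (Set.projIcc 0 1 zero_le_one t).2, rfl⟩⟩
  have hcC : Continuous (Complex.equivRealProd.symm : ℝ × ℝ → ℂ) :=
    Complex.equivRealProdCLM.symm.continuous
  obtain ⟨u', v', he, h0, h1⟩ := D.arc_endpoints e
  have cases : ∀ τ ∈ Set.Icc (0 : ℝ) 1, D.arc e τ = D.vertexMap u' ∨ D.arc e τ = D.vertexMap v' ∨
      τ ∈ Set.Ioo (0 : ℝ) 1 := fun τ hτ => by
    rcases Set.eq_endpoints_or_mem_Ioo_of_mem_Icc hτ with rfl | rfl | hτ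
    · exact .inl h0
    · exact .inr (.inl h1)
    · exact .inr (.inr hτ)
  rcases Sym2.eq_iff.1 he with ⟨rfl, rfl⟩ | ⟨rfl, rfl⟩
  · refine ⟨_, hcC.comp hc, by rw [Function.comp_apply, k0, h0], by rw [Function.comp_apply, k1, h1],
      fun t => ?_⟩
    obtain ⟨τ, hτ, ht⟩ := key t
    simp only [Function.comp_apply, ht]
    rcases cases τ hτ with h | h | h
    · simp [h]
    · simp [h]
    · exact .inr (.inr ⟨τ, h, rfl⟩)
  · refine ⟨fun t => Complex.equivRealProd.symm (c (1 - t)), hcC.comp (hc.comp (by fun_prop)),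
      by simp only [sub_zero, k1, h1], by simp only [sub_self, k0, h0], fun t => ?_⟩
    obtain ⟨τ, hτ, ht⟩ := key (1 - t)
    simp only [ht]
    rcases cases τ hτ with h | h | h
    · simp [h]
    · simp [h]
    · exact .inr (.inr ⟨τ, h, rfl⟩)

/-- The mod-two van Kampen obstruction: up to a switching, the parity of crossings of two
independent edges is the one for vertices in convex position. -/
theorem Drawing.exists_switching {ι V : Type*} [LinearOrder ι] {G : SimpleGraph V} (D : Drawing G)
    {S : Set ι} {f : ι → V} (hf : S.InjOn f) :
    ∃ s : ι → ι → ι → ZMod 2, ∀ a ∈ S, ∀ b ∈ S, ∀ c ∈ S, ∀ d ∈ S, G.Adj (f a) (f b) →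
      G.Adj (f c) (f d) → a ≠ c → a ≠ d → b ≠ c → b ≠ d →
      s a b c + s a b d + s c d a + s c d b + ((if b < c then 1 else 0) + (if d < b then 1 else 0)
        + (if c < a then 1 else 0) + (if a < d then 1 else 0)) ≠ 0 →
      ∃ x ∈ D.crossings, x.1.map Subtype.val = s(s(f a, f b), s(f c, f d)) := by
  have hγ : ∀ a b, ∃ γ : ℝ → ℂ, ∀ h : G.Adj (f a) (f b), Continuous γ ∧
      γ 0 = Complex.equivRealProd.symm (D.vertexMap (f a)) ∧
      γ 1 = Complex.equivRealProd.symm (D.vertexMap (f b)) ∧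
      ∀ t, γ t = Complex.equivRealProd.symm (D.vertexMap (f a)) ∨
        γ t = Complex.equivRealProd.symm (D.vertexMap (f b)) ∨
        ∃ τ ∈ Set.Ioo (0 : ℝ) 1, γ t = Complex.equivRealProd.symm (D.arc ⟨s(f a, f b), h⟩ τ) := by
    intro a b
    by_cases h : G.Adj (f a) (f b)
    · obtain ⟨γ, hγ⟩ := D.exists_path h
      exact ⟨γ, fun _ => hγ⟩
    · exact ⟨0, fun h' => absurd h' h⟩
  choose γ hγ using hγ
  have hne : ∀ {a b}, a ∈ S → b ∈ S → a ≠ b → Complex.equivRealProd.symm (D.vertexMap (f a)) ≠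
      Complex.equivRealProd.symm (D.vertexMap (f b)) := fun ha hb hab =>
    Complex.equivRealProd.symm.injective.ne (D.vertexMap_injective.ne (hf.ne ha hb hab))
  obtain ⟨s, hs⟩ := _root_.exists_switching (fun a => Complex.equivRealProd.symm (D.vertexMap (f a)))
    (fun a b => a ∈ S ∧ b ∈ S ∧ G.Adj (f a) (f b)) γ (S := S)
    (fun a ha b hb h => by_contra fun hab => hne ha hb hab h) (fun a b h => ⟨h.1, h.2.1⟩)
    (fun a b h => (hγ a b h.2.2).1) (fun a b h => (hγ a b h.2.2).2.1)
    (fun a b h => (hγ a b h.2.2).2.2.1) (fun a b ⟨ha, hb, h⟩ w hw hwa hwb t => by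
      rcases (hγ a b h).2.2.2 t with h' | h' | ⟨τ, hτ, h'⟩ <;> rw [h']
      · exact hne ha hw hwa.symm
      · exact hne hb hw hwb.symm
      · exact Complex.equivRealProd.symm.injective.ne (D.arc_avoids_vertices _ τ hτ _))
  refine ⟨s, fun a ha b hb c hc d hd hab hcd hac had hbc hbd hpar => ?_⟩
  have := mt (hs a b c d ⟨ha, hb, hab⟩ ⟨hc, hd, hcd⟩ hac had hbc hbd) hpar
  push Not at this
  obtain ⟨t, t', h⟩ := this
  have avoid : ∀ {a b} (h : G.Adj (f a) (f b)) {τ} (_ : τ ∈ Set.Ioo (0 : ℝ) 1) (w : ι),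
      Complex.equivRealProd.symm (D.arc ⟨s(f a, f b), h⟩ τ) ≠
        Complex.equivRealProd.symm (D.vertexMap (f w)) := fun _ _ hτ _ =>
    Complex.equivRealProd.symm.injective.ne (D.arc_avoids_vertices _ _ hτ _)
  rcases (hγ a b hab).2.2.2 t with h1 | h1 | ⟨τ, hτ, h1⟩ <;>
    rcases (hγ c d hcd).2.2.2 t' with h2 | h2 | ⟨τ', hτ', h2⟩ <;> rw [h1, h2] at h
  · exact absurd h (hne ha hc hac)
  · exact absurd h (hne ha hd had)
  · exact absurd h.symm (avoid hcd hτ' a)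
  · exact absurd h (hne hb hc hbc)
  · exact absurd h (hne hb hd hbd)
  · exact absurd h.symm (avoid hcd hτ' b)
  · exact absurd h (avoid hab hτ c)
  · exact absurd h (avoid hab hτ d)
  · refine ⟨(s(⟨s(f a, f b), hab⟩, ⟨s(f c, f d), hcd⟩), D.arc ⟨s(f a, f b), hab⟩ τ),
      ⟨_, _, fun he => ?_, rfl, ⟨τ, hτ, rfl⟩, ⟨τ', hτ', (Complex.equivRealProd.symm.injective h).symm⟩⟩,
      rfl⟩
    rcases Sym2.eq_iff.1 (congrArg Subtype.val he) with h' | h'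
    · exact hac (hf ha hc h'.1)
    · exact had (hf ha hd h'.1)

/-- Parity of the number of entries of `O` that are bits of the mask `c`. -/
def oddOn (c : ℕ) : List ℕ → Bool
  | [] => false
  | p :: O => (c.testBit p) ^^ oddOn c O

/-- Refutation trees: branch on whether a bit belongs to the unknown set, and close a branch by
naming parity checks from a pool. -/
inductive Refutation
  | split (p : ℕ) (one zero : Refutation)
  | close (checks : List ℕ)

/-- `packing O D N B R cs`: the checks `cs` have odd intersection with `O`, and outside `D` they
cover no bit of `N`, every bit of `B` at most twice, and every other bit at most once; there are
more than `R` of them, unless one of them is already contained in `D`. -/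
def packing (pool O : List ℕ) (D : ℕ) : (N B R : ℕ) → List ℕ → Bool
  | _, _, _, [] => false
  | N, B, R, i :: cs =>
    let c := pool.getD i 0
    let f := c ^^^ (c &&& D)
    oddOn c O && (f &&& N == 0) && (f == 0 || R == 0 ||
      packing pool O D (N ||| (f ^^^ (f &&& B))) (B ^^^ (B &&& f)) (R - 1) cs)

/-- Checks that the tree refutes the existence of a set of weight at most `W` satisfying all parity
checks, containing the bits `O` and no further bit of `D`; bits of `H` weigh two, the
others one, and `wt` is the weight of `O`. -/
def Refutation.check (pool : List ℕ) (H W : ℕ) : Refutation → List ℕ → ℕ → ℕ → Bool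
  | .split p l r, O, D, wt =>
    !(D.testBit p) && l.check pool H W (p :: O) (D ||| 2 ^ p) (wt + (1 + (H.testBit p).toNat)) &&
      r.check pool H W O (D ||| 2 ^ p) wt
  | .close cs, O, D, wt =>
    Nat.blt W wt || packing pool O (if W == wt + 1 then D ||| H else D) 0 H (W - wt) cs

theorem sum_testBit_eq_oddOn (c : ℕ) (O : List ℕ) (hO : O.Nodup) :
    ∑ p ∈ O.toFinset, ((c.testBit p).toNat : ZMod 2) = (oddOn c O).toNat := by
  induction O with
  | nil => simp [oddOn]
  | cons p O ih =>
    rw [List.nodup_cons] at hO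
    rw [List.toFinset_cons, Finset.sum_insert (by simpa using hO.1), ih hO.2, oddOn]
    cases c.testBit p <;> cases oddOn c O <;> simp
    rfl

theorem packing_sound {pool O : List ℕ} {D : ℕ} {U : Finset ℕ} (hU : ∀ u ∈ U, D.testBit u = false)
    (hpool : ∀ i, oddOn (pool.getD i 0) O = true → ∃ u ∈ U, (pool.getD i 0).testBit u = true)
    (cs : List ℕ) (N B R : ℕ) (h : packing pool O D N B R cs = true) :
    R < ∑ u ∈ U, ((!N.testBit u).toNat + (B.testBit u).toNat) := by
  induction cs generalizing N B R with
  | nil => simp [packing] at h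
  | cons i cs ih =>
    simp only [packing, Bool.and_eq_true, Bool.or_eq_true, beq_iff_eq] at h
    obtain ⟨⟨h1, h2⟩, h3⟩ := h
    obtain ⟨u, hu, huc⟩ := hpool i h1
    generalize pool.getD i 0 = c at *
    have hN : ∀ v, (c.testBit v && !D.testBit v && N.testBit v) = false := fun v => by
      have := congrArg (Nat.testBit · v) h2
      simp only [Nat.testBit_and, Nat.testBit_xor, Nat.zero_testBit] at this
      revert this
      cases c.testBit v <;> cases D.testBit v <;> cases N.testBit v <;> simp
    have hlt : ∑ u ∈ U, ((!(N ||| ((c ^^^ (c &&& D)) ^^^ ((c ^^^ (c &&& D)) &&& B))).testBit u).toNat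
        + ((B ^^^ (B &&& (c ^^^ (c &&& D)))).testBit u).toNat) <
        ∑ u ∈ U, ((!N.testBit u).toNat + (B.testBit u).toNat) := by
      have H : ∀ v ∈ U, ((!(N ||| ((c ^^^ (c &&& D)) ^^^ ((c ^^^ (c &&& D)) &&& B))).testBit v).toNat
          + ((B ^^^ (B &&& (c ^^^ (c &&& D)))).testBit v).toNat) + (c.testBit v).toNat =
          ((!N.testBit v).toNat + (B.testBit v).toNat) := fun v hv => by
        have := hN v
        revert this
        simp only [Nat.testBit_and, Nat.testBit_xor, Nat.testBit_or, hU v hv]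
        cases c.testBit v <;> cases B.testBit v <;> cases N.testBit v <;> simp
      refine Finset.sum_lt_sum (fun v hv => (H v hv) ▸ Nat.le_add_right _ _) ⟨u, hu, ?_⟩
      rw [← H u hu, huc]
      exact Nat.lt_succ_self _
    rcases h3 with (h3 | h3) | h3
    · have := congrArg (Nat.testBit · u) h3
      simp [huc, hU u hu] at this
    · omega
    · have := ih _ _ _ h3
      omega

theorem Refutation.check_sound {pool : List ℕ} {H W : ℕ} {X : Finset ℕ}
    (hX : ∀ i, ∑ p ∈ X, (((pool.getD i 0).testBit p).toNat : ZMod 2) = 0)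
    (T : Refutation) (O : List ℕ) (D wt : ℕ) (h : T.check pool H W O D wt = true)
    (hO : O.Nodup) (hD : ∀ p, D.testBit p = true → (p ∈ X ↔ p ∈ O))
    (hOD : ∀ p ∈ O, D.testBit p = true) (hwt : wt = ∑ p ∈ O.toFinset, (1 + (H.testBit p).toNat)) :
    W < ∑ p ∈ X, (1 + (H.testBit p).toNat) := by
  induction T generalizing O D wt with
  | split p l r hl hr =>
    simp only [check, Bool.and_eq_true, Bool.not_eq_true'] at h
    obtain ⟨⟨h1, h2⟩, h3⟩ := h
    have hpO : p ∉ O := fun hp => by simp [hOD p hp] at h1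
    have hbit : ∀ q, (D ||| 2 ^ p).testBit q = true ↔ D.testBit q = true ∨ p = q := fun q => by
      simp [Nat.testBit_two_pow]
    by_cases hp : p ∈ X
    · refine hl _ _ _ h2 (List.nodup_cons.2 ⟨hpO, hO⟩) (fun q hq => ?_) (fun q hq => ?_) ?_
      · rcases (hbit q).1 hq with hq | rfl
        · have := hD q hq
          have : q ≠ p := fun h => by simp [h, h1] at hq
          simp [*]
        · simp [hp]
      · rcases List.mem_cons.1 hq with rfl | hq
        · simp
        · simp [hOD q hq]
      · rw [List.toFinset_cons, Finset.sum_insert (by simpa using hpO), hwt, add_comm]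
    · refine hr _ _ _ h3 hO (fun q hq => ?_) (fun q hq => (hbit q).2 (.inl (hOD q hq))) hwt
      rcases (hbit q).1 hq with hq | rfl
      · exact hD q hq
      · simp [hp, hpO]
  | close cs =>
    have hsub : O.toFinset ⊆ X := fun p hp => by
      rw [List.mem_toFinset] at hp
      exact (hD p (hOD p hp)).2 hp
    have hsplit := Finset.sum_sdiff hsub (f := fun p => 1 + (H.testBit p).toNat)
    have hU : ∀ u ∈ X \ O.toFinset, D.testBit u = false := fun u hu => by
      simp only [Finset.mem_sdiff, List.mem_toFinset] at hu
      by_contra hc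
      exact hu.2 ((hD u (by simpa using hc)).1 hu.1)
    simp only [check, Bool.or_eq_true, Nat.blt_eq] at h
    rcases h with h | h
    · omega
    by_contra hlt
    refine hlt ?_
    have := packing_sound (U := X \ O.toFinset) (fun u hu => ?_) (fun i hi => ?_) cs 0 H _ h
    · simp only [Nat.zero_testBit, Bool.not_false, Bool.toNat_true] at this
      omega
    · split_ifs with hW
      · rw [Nat.testBit_or, hU u hu, Bool.false_or]
        by_contra hc
        have := Finset.single_le_sum (f := fun p => 1 + (H.testBit p).toNat)
          (fun _ _ => Nat.zero_le _) hu
        have e : H.testBit u = true := by simpa using hc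
        simp only [e, Bool.toNat_true] at this
        simp only [beq_iff_eq] at hW
        omega
      · exact hU u hu
    · by_contra! hc
      have h1 := hX i
      rw [← Finset.sum_sdiff hsub, sum_testBit_eq_oddOn _ _ hO, hi, Finset.sum_eq_zero] at h1
      · simp at h1
      · intro u hu
        rw [Bool.eq_false_of_not_eq_true (hc u hu), Bool.toNat_false, Nat.cast_zero]

/-- The mask with bits `l`. -/
def maskOf (l : List ℕ) : ℕ := l.foldr (fun p s => Nat.xor (2 ^ p) s) 0

/-- The bitwise sum modulo two of the values of `G` on `l`. -/
def xorOver (G : ℕ → ℕ) (l : List ℕ) : ℕ := l.foldr (fun p s => Nat.xor (G p) s) 0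

theorem sum_testBit_maskOf {G : ℕ → ℕ} {φ : ℕ → ZMod 2} (h0 : φ 0 = 0)
    (hφ : ∀ a b, φ (a ^^^ b) = φ a + φ b) {X : Finset ℕ} (hX : ∀ p, p ∈ X ↔ φ (G p) = 1)
    (l : List ℕ) :
    ∑ p ∈ X, (((maskOf l).testBit p).toNat : ZMod 2) = φ (xorOver G l) := by
  have xor_toNat : ∀ b c : Bool, (((b ^^ c).toNat : ℕ) : ZMod 2) = b.toNat + c.toNat := by decide
  have zero_or_one : ∀ z : ZMod 2, z = 0 ∨ z = 1 := by decide
  induction l with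
  | nil => simp [maskOf, xorOver, h0]
  | cons q l ih =>
    have e1 : maskOf (q :: l) = 2 ^ q ^^^ maskOf l := rfl
    have e2 : xorOver G (q :: l) = G q ^^^ xorOver G l := rfl
    rw [e1, e2, hφ, ← ih]
    simp only [Nat.testBit_xor, xor_toNat, Finset.sum_add_distrib, Nat.testBit_two_pow]
    congr 1
    have : ∀ p, (((decide (q = p)).toNat : ℕ) : ZMod 2) = if q = p then 1 else 0 := fun p => by
      by_cases h : q = p <;> simp [h]
    simp only [this, Finset.sum_ite_eq]
    have hq := hX q
    rcases zero_or_one (φ (G q)) with h | h <;> rw [h] at hq ⊢ <;> simp [hq]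

/-- The conclusion of a successful run of the checker. -/
theorem lt_sum_of_check {G : ℕ → ℕ} {pool : List (List ℕ)} {H W : ℕ}
    (hpool : pool.all (fun l => xorOver G l == 0) = true) {T : Refutation}
    (hT : T.check (pool.map maskOf) H W [0] 1 (1 + (H.testBit 0).toNat) = true)
    {φ : ℕ → ZMod 2} (h0 : φ 0 = 0) (hφ : ∀ a b, φ (a ^^^ b) = φ a + φ b) (h1 : φ (G 0) = 1)
    {X : Finset ℕ} (hX : ∀ p, p ∈ X ↔ φ (G p) = 1) :
    W < ∑ p ∈ X, (1 + (H.testBit p).toNat) := by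
  refine T.check_sound (fun i => ?_) [0] 1 _ hT (by simp) (fun p hp => ?_) (by simp) (by simp)
  · rw [List.getD_eq_getElem?_getD, List.getElem?_map]
    rcases lt_or_ge i pool.length with hi | hi
    · have := List.all_eq_true.1 hpool _ (List.getElem_mem hi)
      rw [beq_iff_eq] at this
      simp [hi, sum_testBit_maskOf h0 hφ hX, this, h0]
    · simp [hi]
  · have : p = 0 := by simpa [Nat.testBit_one_eq_true_iff_self_eq_zero] using hp
    subst this
    simpa [hX] using h1

/-- The edges of the product of the square of a path on four vertices with a cycle on `m`
vertices; vertex `a` lies in row `a / m` and in column `a % m`. -/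
def templateEdge (m i : ℕ) : ℕ × ℕ :=
  if i < 4 * m then (i, m * (i / m) + (i + 1) % m)
  else if i < 7 * m then (i - 4 * m, i - 3 * m) else (i - 7 * m, i - 5 * m)

/-- Whether `p` encodes the pair of the edges `p / (9 * m)` and `p % (9 * m)`, and these are
independent. -/
def isPair (m p : ℕ) : Bool :=
  let e := templateEdge m (p / (9 * m))
  let f := templateEdge m (p % (9 * m))
  (p / (9 * m)).blt (p % (9 * m)) && e.1 != f.1 && e.1 != f.2 && e.2 != f.1 && e.2 != f.2

/-- The bit standing for the value of a switching at `a b c`. -/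
def switchBit (n a b c : ℕ) : ℕ := 2 ^ (1 + ((a * n + b) * n + c))

/-- The parity of the number of crossings of the edges `e` and `f`, as a sum of bits. -/
def pairParity (n : ℕ) (e f : ℕ × ℕ) : ℕ :=
  (e.2.blt f.1 ^^ (f.2.blt e.2 ^^ (f.1.blt e.1 ^^ e.1.blt f.2))).toNat ^^^
    (switchBit n e.1 e.2 f.1 ^^^ (switchBit n e.1 e.2 f.2 ^^^
    (switchBit n f.1 f.2 e.1 ^^^ switchBit n f.1 f.2 e.2)))

/-- The parity of the number of crossings of the pair encoded by `p`; the code `0` stands for the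
constant one. -/
def codeParity (m p : ℕ) : ℕ :=
  if p = 0 then 1
  else if isPair m p then
    pairParity (4 * m) (templateEdge m (p / (9 * m))) (templateEdge m (p % (9 * m)))
  else 0

/-- Whether `p` encodes a pair of independent edges one of which meets the first row. -/
def isHeavy (m p : ℕ) : Bool := isPair m p &&
  ((templateEdge m (p / (9 * m))).1.blt m || (templateEdge m (p % (9 * m))).1.blt m)

/-- The mask of the heavy pairs. -/
def heavyMask (m : ℕ) : ℕ := maskOf ((List.range (81 * m * m)).filter (isHeavy m))

theorem testBit_maskOf (l : List ℕ) (hl : l.Nodup) (p : ℕ) :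
    (maskOf l).testBit p = decide (p ∈ l) := by
  induction l with
  | nil => simp [maskOf]
  | cons q l ih =>
    rw [List.nodup_cons] at hl
    have e : maskOf (q :: l) = 2 ^ q ^^^ maskOf l := rfl
    rw [e, Nat.testBit_xor, ih hl.2, Nat.testBit_two_pow]
    by_cases h : q = p
    · subst h
      simp [hl.1]
    · simp [h, Ne.symm h]

/-- The parity of the number of crossings of the edges `e` and `f` in terms of a switching. -/
def crossParity (s : ℕ → ℕ → ℕ → ZMod 2) (e f : ℕ × ℕ) : ZMod 2 :=
  s e.1 e.2 f.1 + s e.1 e.2 f.2 + s f.1 f.2 e.1 + s f.1 f.2 e.2 +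
    ((if e.2 < f.1 then 1 else 0) + (if f.2 < e.2 then 1 else 0) +
      (if f.1 < e.1 then 1 else 0) + (if e.1 < f.2 then 1 else 0))

theorem templateEdge_lt {m i : ℕ} (hi : i < 9 * m) :
    (templateEdge m i).1 < 4 * m ∧ (templateEdge m i).2 < 4 * m := by
  unfold templateEdge
  split_ifs with h h
  · refine ⟨h, ?_⟩
    have h1 : i / m < 4 := Nat.div_lt_of_lt_mul (by rwa [mul_comm])
    have h2 : (i + 1) % m < m := Nat.mod_lt _ (by omega)
    have h3 : m * (i / m) ≤ m * 3 := Nat.mul_le_mul_left _ (by omega)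
    dsimp only
    omega
  · dsimp only
    omega
  · dsimp only
    omega

theorem isPair_iff {m p : ℕ} : isPair m p = true ↔ p / (9 * m) < p % (9 * m) ∧
    (templateEdge m (p / (9 * m))).1 ≠ (templateEdge m (p % (9 * m))).1 ∧
    (templateEdge m (p / (9 * m))).1 ≠ (templateEdge m (p % (9 * m))).2 ∧
    (templateEdge m (p / (9 * m))).2 ≠ (templateEdge m (p % (9 * m))).1 ∧
    (templateEdge m (p / (9 * m))).2 ≠ (templateEdge m (p % (9 * m))).2 := by
  simp [isPair, and_assoc]

theorem lt_one_add_sum_of_check {m W : ℕ} (hm : 0 < m) {pool : List (List ℕ)} {T : Refutation}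
    (hpool : pool.all (fun l => xorOver (codeParity m) l == 0) = true)
    (hT : T.check (pool.map maskOf) (heavyMask m) W [0] 1 (1 + ((heavyMask m).testBit 0).toNat) = true)
    (s : ℕ → ℕ → ℕ → ZMod 2) :
    W < 1 + ∑ p ∈ Finset.range (81 * m * m) with isPair m p ∧
      crossParity s (templateEdge m (p / (9 * m))) (templateEdge m (p % (9 * m))) = 1,
      (1 + (isHeavy m p).toNat) := by
  have hlt : ∀ {p}, isPair m p = true → p / (9 * m) < 9 * m ∧ p % (9 * m) < 9 * m := fun h => by
    have := (isPair_iff.1 h).1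
    have h2 := Nat.mod_lt ‹ℕ› (show 0 < 9 * m by omega)
    exact ⟨this.trans h2, h2⟩
  have hrange : ∀ {p}, isPair m p = true → p < 81 * m * m := fun {p} h => by
    have := Nat.lt_mul_of_div_lt (hlt h).1 (by omega)
    linarith
  have h00 : isPair m 0 = false := by simp [isPair]
  let n := 4 * m
  let σ : ℕ → ZMod 2 := fun i => if i = 0 then 1 else
    s ((i - 1) / n / n) ((i - 1) / n % n) ((i - 1) % n)
  let φ : ℕ → ZMod 2 := fun N => ∑ i ∈ Finset.range (1 + n * n * n), (N.testBit i).toNat * σ i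
  have xor_toNat : ∀ b c : Bool, (((b ^^ c).toNat : ℕ) : ZMod 2) = b.toNat + c.toNat := by decide
  have h0 : φ 0 = 0 := by simp [φ]
  have hφ : ∀ a b, φ (a ^^^ b) = φ a + φ b := fun a b => by
    simp only [φ, Nat.testBit_xor, xor_toNat, add_mul, Finset.sum_add_distrib]
  have hpow : ∀ i < 1 + n * n * n, φ (2 ^ i) = σ i := fun i hi => by
    simp only [φ, Nat.testBit_two_pow]
    rw [Finset.sum_eq_single i]
    · simp
    · intro j _ hj
      simp [hj.symm]
    · simp [hi]
  have hone : φ 1 = 1 := hpow 0 (by omega)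
  have hbit : ∀ b : Bool, φ b.toNat = b.toNat := fun b => by
    cases b
    · simpa using h0
    · simpa using hone
  have hswitch : ∀ {a b c}, a < n → b < n → c < n → φ (switchBit n a b c) = s a b c := by
    intro a b c ha hb hc
    have h1 : (a * n + b) < n * n := by nlinarith
    rw [switchBit, hpow _ (by nlinarith)]
    have hn : 0 < n := by omega
    simp only [σ, Nat.add_sub_cancel_left]
    rw [if_neg (by omega)]
    have e1 : ((a * n + b) * n + c) / n = a * n + b := by
      rw [mul_comm, Nat.mul_add_div hn, Nat.div_eq_of_lt hc, add_zero]
    have e2 : ((a * n + b) * n + c) % n = c := by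
      rw [Nat.mul_add_mod_self_right, Nat.mod_eq_of_lt hc]
    have e3 : (a * n + b) / n = a := by
      rw [mul_comm, Nat.mul_add_div hn, Nat.div_eq_of_lt hb, add_zero]
    have e4 : (a * n + b) % n = b := by
      rw [Nat.mul_add_mod_self_right, Nat.mod_eq_of_lt hb]
    rw [e1, e2, e3, e4]
  have hcode : ∀ p, isPair m p = true → φ (codeParity m p) =
      crossParity s (templateEdge m (p / (9 * m))) (templateEdge m (p % (9 * m))) := by
    intro p hp
    have hp0 : p ≠ 0 := by
      rintro rfl
      simp [h00] at hp
    obtain ⟨h1, h2⟩ := templateEdge_lt (hlt hp).1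
    obtain ⟨h3, h4⟩ := templateEdge_lt (hlt hp).2
    rw [codeParity, if_neg hp0, if_pos hp, pairParity, hφ, hφ, hφ, hφ, hbit,
      hswitch h1 h2 h3, hswitch h1 h2 h4, hswitch h3 h4 h1, hswitch h3 h4 h2, crossParity]
    have blt : ∀ a b : ℕ, a.blt b = decide (a < b) := fun a b => by
      rw [Bool.eq_iff_iff]; simp
    have toNat : ∀ P [Decidable P], (((decide P).toNat : ℕ) : ZMod 2) = if P then 1 else 0 := by
      intro P _
      by_cases h : P <;> simp [h]
    simp only [xor_toNat, blt, toNat]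
    ring
  have := lt_sum_of_check hpool hT (φ := φ) h0 hφ (by simpa [codeParity] using hone)
    (X := insert 0 (Finset.range (81 * m * m) |>.filter fun p => isPair m p ∧
      crossParity s (templateEdge m (p / (9 * m))) (templateEdge m (p % (9 * m))) = 1)) (fun p => by
      rw [Finset.mem_insert, Finset.mem_filter, Finset.mem_range]
      by_cases hp0 : p = 0
      · subst hp0
        simpa [codeParity] using hone
      by_cases hp : isPair m p = true
      · rw [hcode p hp]
        simp [hp0, hp, hrange hp]
      · simp [hp0, hp, codeParity, h0])
  rw [Finset.sum_insert (by simp [h00])] at this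
  have hH : ∀ p, (heavyMask m).testBit p = (isHeavy m p) := fun p => by
    rw [heavyMask, testBit_maskOf _ (List.nodup_range.filter _), Bool.eq_iff_iff]
    simp only [List.mem_filter, List.mem_range, decide_eq_true_eq, and_iff_right_iff_imp]
    intro h
    simp only [isHeavy, Bool.and_eq_true] at h
    exact hrange h.1
  simp only [hH] at this
  simpa [isHeavy, h00] using this

/-- The placement of the template in the product, along a map `ρ` of rows. -/
def place (ρ : ℕ → Fin 6) (m : ℕ) [NeZero m] (a : ℕ) : Fin 6 × Fin m := (ρ (a / m), Fin.ofNat m a)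

/-- The edge of the product on which the template edge `i` is placed. -/
def placeEdge (ρ : ℕ → Fin 6) (m : ℕ) [NeZero m] (i : ℕ) : Sym2 (Fin 6 × Fin m) :=
  s(place ρ m (templateEdge m i).1, place ρ m (templateEdge m i).2)

theorem place_injOn {ρ : ℕ → Fin 6} (hρ : (Set.Iio 4).InjOn ρ) (m : ℕ) [NeZero m] :
    (Set.Iio (4 * m)).InjOn (place ρ m) := fun a ha b hb h => by
  rw [Set.mem_Iio] at ha hb
  have h1 : a / m = b / m := hρ (Nat.div_lt_of_lt_mul (by rwa [mul_comm]))
    (Nat.div_lt_of_lt_mul (by rwa [mul_comm])) (congrArg Prod.fst h)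
  have h2 : a % m = b % m := congrArg (fun x => x.2.val) h
  rw [← Nat.div_add_mod a m, ← Nat.div_add_mod b m, h1, h2]

/-- A placed template yields a set of crossing pairs of edges and its subset of heavy pairs. -/
theorem exists_crossing_pairs {m W : ℕ} [NeZero m] {G : SimpleGraph (Fin 6 × Fin m)}
    (D : Drawing G) {pool : List (List ℕ)} {T : Refutation}
    (hpool : pool.all (fun l => xorOver (codeParity m) l == 0) = true)
    (hT : T.check (pool.map maskOf) (heavyMask m) W [0] 1 (1 + ((heavyMask m).testBit 0).toNat) = true)
    {ρ : ℕ → Fin 6} (hρ : (Set.Iio 4).InjOn ρ)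
    (hadj : ∀ i < 9 * m, placeEdge ρ m i ∈ G.edgeSet)
    (hinj : (Set.Iio (9 * m)).InjOn (placeEdge ρ m)) :
    ∃ A B : Finset (Sym2 (Sym2 (Fin 6 × Fin m))), W ≤ A.card + B.card ∧ B ⊆ A ∧
      (∀ z ∈ A, ∃ x ∈ D.crossings, x.1.map Subtype.val = z) ∧
      (∀ z ∈ A, ∀ e ∈ z, ∃ i < 9 * m, e = placeEdge ρ m i) ∧
      (∀ z ∈ B, ∃ i < 9 * m, (templateEdge m i).1 < m ∧ placeEdge ρ m i ∈ z) := by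
  have hm : 0 < m := NeZero.pos m
  have hlt : ∀ {p}, isPair m p = true → p / (9 * m) < 9 * m ∧ p % (9 * m) < 9 * m := fun h => by
    have := (isPair_iff.1 h).1
    have h2 := Nat.mod_lt ‹ℕ› (show 0 < 9 * m by omega)
    exact ⟨this.trans h2, h2⟩
  obtain ⟨s, hs⟩ := D.exists_switching (place_injOn hρ m)
  have hW := lt_one_add_sum_of_check hm hpool hT s
  set X := (Finset.range (81 * m * m)).filter fun p => isPair m p ∧
      crossParity s (templateEdge m (p / (9 * m))) (templateEdge m (p % (9 * m))) = 1 with hX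
  have hXp : ∀ {p}, p ∈ X → isPair m p = true := fun hp => (Finset.mem_filter.1 hp).2.1
  let z : ℕ → Sym2 (Sym2 (Fin 6 × Fin m)) := fun p =>
    s(placeEdge ρ m (p / (9 * m)), placeEdge ρ m (p % (9 * m)))
  have hz : (X : Set ℕ).InjOn z := fun p hp q hq h => by
    have hp := hXp hp
    have hq := hXp hq
    have h1 := (isPair_iff.1 hp).1
    have h2 := (isPair_iff.1 hq).1
    rw [← Nat.div_add_mod p (9 * m), ← Nat.div_add_mod q (9 * m)]
    rcases Sym2.eq_iff.1 h with ⟨h3, h4⟩ | ⟨h3, h4⟩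
    · rw [hinj (hlt hp).1 (hlt hq).1 h3, hinj (hlt hp).2 (hlt hq).2 h4]
    · have := hinj (hlt hp).1 (hlt hq).2 h3
      have := hinj (hlt hp).2 (hlt hq).1 h4
      omega
  refine ⟨X.image z, (X.filter fun p => isHeavy m p = true).image z, ?_,
    Finset.image_subset_image (Finset.filter_subset _ _), ?_, ?_, ?_⟩
  · rw [Finset.card_image_of_injOn hz,
      Finset.card_image_of_injOn (hz.mono (Finset.coe_subset.2 (Finset.filter_subset _ _)))]
    have toNat : ∀ b : Bool, b.toNat = if b = true then 1 else 0 := by decide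
    simp only [toNat, Finset.sum_add_distrib, Finset.sum_boole, Finset.sum_const, smul_eq_mul,
      mul_one, Nat.cast_id] at hW
    omega
  · intro w hw
    obtain ⟨p, hp, rfl⟩ := Finset.mem_image.1 hw
    have hpp := isPair_iff.1 (hXp hp)
    obtain ⟨l1, l2⟩ := hlt (hXp hp)
    exact hs _ (templateEdge_lt l1).1 _ (templateEdge_lt l1).2 _ (templateEdge_lt l2).1 _
      (templateEdge_lt l2).2 (hadj _ l1) (hadj _ l2) hpp.2.1 hpp.2.2.1 hpp.2.2.2.1 hpp.2.2.2.2
      (by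
        have := (Finset.mem_filter.1 hp).2.2
        rw [crossParity] at this
        rw [this]
        exact one_ne_zero)
  · intro w hw e he
    obtain ⟨p, hp, rfl⟩ := Finset.mem_image.1 hw
    obtain ⟨l1, l2⟩ := hlt (hXp hp)
    rcases Sym2.mem_iff.1 he with rfl | rfl
    · exact ⟨_, l1, rfl⟩
    · exact ⟨_, l2, rfl⟩
  · intro w hw
    obtain ⟨p, hp, rfl⟩ := Finset.mem_image.1 hw
    obtain ⟨hp, hh⟩ := Finset.mem_filter.1 hp
    obtain ⟨l1, l2⟩ := hlt (hXp hp)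
    simp only [isHeavy, Bool.and_eq_true, Bool.or_eq_true, Nat.blt_eq] at hh
    rcases hh.2 with h | h
    · exact ⟨_, l1, h, Sym2.mem_mk_left _ _⟩
    · exact ⟨_, l2, h, Sym2.mem_mk_right _ _⟩

/-- Two placed templates which meet outside their heavy edges. -/
theorem le_ncard_crossings {m W : ℕ} [NeZero m] {G : SimpleGraph (Fin 6 × Fin m)}
    (D : Drawing G) (hD : D.crossings.Finite) {pool : List (List ℕ)} {T : Refutation}
    (hpool : pool.all (fun l => xorOver (codeParity m) l == 0) = true)
    (hT : T.check (pool.map maskOf) (heavyMask m) W [0] 1 (1 + ((heavyMask m).testBit 0).toNat) = true)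
    {ρ₁ ρ₂ : ℕ → Fin 6} (hρ₁ : (Set.Iio 4).InjOn ρ₁) (hρ₂ : (Set.Iio 4).InjOn ρ₂)
    (hadj₁ : ∀ i < 9 * m, placeEdge ρ₁ m i ∈ G.edgeSet)
    (hadj₂ : ∀ i < 9 * m, placeEdge ρ₂ m i ∈ G.edgeSet)
    (hinj₁ : (Set.Iio (9 * m)).InjOn (placeEdge ρ₁ m))
    (hinj₂ : (Set.Iio (9 * m)).InjOn (placeEdge ρ₂ m))
    (h₁₂ : ∀ i < 9 * m, ∀ j < 9 * m, (templateEdge m i).1 < m → placeEdge ρ₁ m i ≠ placeEdge ρ₂ m j)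
    (h₂₁ : ∀ i < 9 * m, ∀ j < 9 * m, (templateEdge m i).1 < m → placeEdge ρ₂ m i ≠ placeEdge ρ₁ m j) :
    W ≤ D.crossings.ncard := by
  obtain ⟨A₁, B₁, hW₁, hB₁, hx₁, hA₁, hh₁⟩ := exists_crossing_pairs D hpool hT hρ₁ hadj₁ hinj₁
  obtain ⟨A₂, B₂, hW₂, hB₂, hx₂, hA₂, hh₂⟩ := exists_crossing_pairs D hpool hT hρ₂ hadj₂ hinj₂
  have key : ∀ C : Finset (Sym2 (Sym2 (Fin 6 × Fin m))),
      (∀ z ∈ C, ∃ x ∈ D.crossings, x.1.map Subtype.val = z) → C.card ≤ D.crossings.ncard := by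
    intro C hC
    rw [← Set.ncard_coe_finset]
    exact (Set.ncard_le_ncard (fun z hz => hC z hz) (hD.image fun x => x.1.map Subtype.val)).trans
      (Set.ncard_image_le hD)
  have d₁ : Disjoint A₁ B₂ := Finset.disjoint_left.2 fun z hz hz' => by
    obtain ⟨i, hi, him, hiz⟩ := hh₂ z hz'
    obtain ⟨j, hj, e⟩ := hA₁ z hz _ hiz
    exact h₂₁ i hi j hj him e
  have d₂ : Disjoint A₂ B₁ := Finset.disjoint_left.2 fun z hz hz' => by
    obtain ⟨i, hi, him, hiz⟩ := hh₁ z hz'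
    obtain ⟨j, hj, e⟩ := hA₂ z hz _ hiz
    exact h₁₂ i hi j hj him e
  have k₁ := key (A₁ ∪ B₂) fun z hz => (Finset.mem_union.1 hz).elim (hx₁ z) fun h => hx₂ z (hB₂ h)
  have k₂ := key (A₂ ∪ B₁) fun z hz => (Finset.mem_union.1 hz).elim (hx₂ z) fun h => hx₁ z (hB₁ h)
  rw [Finset.card_union_of_disjoint d₁] at k₁
  rw [Finset.card_union_of_disjoint d₂] at k₂
  omega

instance : DecidableRel G6_98.Adj := fun a b =>
  decidable_of_iff ((s(a, b) = s(0, 1) ∨ s(a, b) = s(1, 2) ∨ s(a, b) = s(2, 3) ∨ s(a, b) = s(3, 4) ∨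
    s(a, b) = s(4, 5) ∨ s(a, b) = s(1, 3) ∨ s(a, b) = s(2, 4) ∨ s(a, b) = s(3, 5)) ∧ a ≠ b)
    (by simp [G6_98])

/-- The four first rows. -/
def firstRows (r : ℕ) : Fin 6 := Fin.ofNat 6 (r + 1)

/-- The four last rows, in reverse order. -/
def lastRows (r : ℕ) : Fin 6 := Fin.ofNat 6 (5 - r)

instance (m : ℕ) : DecidableRel (G6_98 □ cycleGraph m).Adj := fun _ _ =>
  decidable_of_iff _ boxProd_adj.symm

/-- Twice the signed area of the triangle `a b c`. -/
def orient {R : Type*} [CommRing R] (a b c : R × R) : R :=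
  (b.1 - a.1) * (c.2 - a.2) - (b.2 - a.2) * (c.1 - a.1)

/-- Whether each of the segments `p` and `q` has its endpoints strictly on different sides of the
other. -/
def Crosses {V : Type*} (P : V → ℤ × ℤ) (p q : V × V) : Prop :=
  orient (P p.1) (P p.2) (P q.1) * orient (P p.1) (P p.2) (P q.2) < 0 ∧
    orient (P q.1) (P q.2) (P p.1) * orient (P q.1) (P q.2) (P p.2) < 0

instance {V : Type*} (P : V → ℤ × ℤ) (p q : V × V) : Decidable (Crosses P p q) :=
  inferInstanceAs (Decidable (_ ∧ _))

/-- The point of the plane with the given integral coordinates. -/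
def planePoint (a : ℤ × ℤ) : ℝ × ℝ := (a.1, a.2)

/-- The point dividing the segment `a b` in the ratio `t : 1 - t`. -/
def segmentPoint (a b : ℤ × ℤ) (t : ℝ) : ℝ × ℝ :=
  ((1 - t) * a.1 + t * b.1, (1 - t) * a.2 + t * b.2)

theorem orient_planePoint (a b c : ℤ × ℤ) :
    orient (planePoint a) (planePoint b) (planePoint c) = (orient a b c : ℤ) := by
  simp [orient, planePoint]

theorem orient_segmentPoint (a b : ℝ × ℝ) (c d : ℤ × ℤ) (t : ℝ) :
    orient a b (segmentPoint c d t) =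
      (1 - t) * orient a b (planePoint c) + t * orient a b (planePoint d) := by
  simp only [orient, planePoint, segmentPoint]
  ring

theorem orient_segmentPoint_self (a b : ℤ × ℤ) (t : ℝ) :
    orient (planePoint a) (planePoint b) (segmentPoint a b t) = 0 := by
  simp only [orient, planePoint, segmentPoint]
  ring

theorem mul_neg_of_combination_eq_zero {x y : ℤ} {t : ℝ} (ht : t ∈ Set.Ioo (0 : ℝ) 1)
    (h : (1 - t) * x + t * y = 0) (hxy : x ≠ 0 ∨ y ≠ 0) : x * y < 0 := by
  obtain ⟨h0, h1⟩ := ht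
  have hx : x ≠ 0 := by
    rintro rfl
    simp [h0.ne'] at h
    simp [h] at hxy
  have : (t * (x * y : ℝ)) = - ((1 - t) * x ^ 2) := by linear_combination x * h
  have h2 : (0 : ℝ) < (1 - t) * x ^ 2 := by
    have : (x : ℝ) ≠ 0 := by exact_mod_cast hx
    have : 0 < 1 - t := by linarith
    positivity
  have h3 : (x * y : ℝ) < 0 := by
    by_contra! h4
    nlinarith [mul_nonneg h0.le h4]
  exact_mod_cast h3

theorem segmentPoint_injective {a b : ℤ × ℤ} (h : a ≠ b) :
    Function.Injective (segmentPoint a b) := by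
  intro s t hst
  by_contra hne
  obtain ⟨h1, h2⟩ := Prod.ext_iff.1 hst
  simp only [segmentPoint] at h1 h2
  have hne : s - t ≠ 0 := sub_ne_zero.2 hne
  refine h (Prod.ext ?_ ?_)
  · have : (s - t) * (b.1 - a.1 : ℝ) = 0 := by linear_combination h1
    have := (mul_eq_zero.1 this).resolve_left hne
    exact_mod_cast (sub_eq_zero.1 this).symm
  · have : (s - t) * (b.2 - a.2 : ℝ) = 0 := by linear_combination h2
    have := (mul_eq_zero.1 this).resolve_left hne
    exact_mod_cast (sub_eq_zero.1 this).symm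

/-- A straight-line drawing of a graph with vertices in general position. -/
theorem exists_drawing_of_straight_lines {V : Type*} [DecidableEq V] {G : SimpleGraph V}
    {P : V → ℤ × ℤ} (hP : Function.Injective P) {E : List (V × V)}
    (hE : ∀ a b, G.Adj a b → ∃ p ∈ E, s(a, b) = s(p.1, p.2))
    (hgen : ∀ p ∈ E, ∀ w, w ≠ p.1 → w ≠ p.2 → orient (P p.1) (P p.2) (P w) ≠ 0)
    {n : ℕ} (hn : (((E.product E).filter fun x => Crosses P x.1 x.2).map
      fun x => s(s(x.1.1, x.1.2), s(x.2.1, x.2.2))).toFinset.card ≤ n) :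
    ∃ D : Drawing G, D.crossings.Finite ∧ D.crossings.ncard ≤ n := by
  have hE' : ∀ e : G.edgeSet, ∃ p ∈ E, (e : Sym2 V) = s(p.1, p.2) := by
    rintro ⟨⟨a, b⟩, h⟩
    exact hE a b h
  choose p hpE hp using hE'
  have hne : ∀ e, (p e).1 ≠ (p e).2 := fun e => G.ne_of_adj (G.mem_edgeSet.1 (hp e ▸ e.2))
  have hseg0 : ∀ a b, segmentPoint a b 0 = planePoint a := by simp [segmentPoint, planePoint]
  have hseg1 : ∀ a b, segmentPoint a b 1 = planePoint b := by simp [segmentPoint, planePoint]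
  have hinj : Function.Injective fun v => planePoint (P v) := fun v w h => hP <| by
    simpa [planePoint, Prod.ext_iff] using h
  have harc : ∀ e, Function.Injective (segmentPoint (P (p e).1) (P (p e).2)) :=
    fun e => segmentPoint_injective (hP.ne (hne e))
  let D : Drawing G :=
    { vertexMap := fun v => planePoint (P v)
      vertexMap_injective := hinj
      arc := fun e => segmentPoint (P (p e).1) (P (p e).2)
      arc_continuousOn := fun e => by unfold segmentPoint; fun_prop
      arc_injOn := fun e => (harc e).injOn
      arc_endpoints := fun e => ⟨_, _, hp e, hseg0 _ _, hseg1 _ _⟩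
      arc_avoids_vertices := fun e t ht w h => by
        by_cases h1 : w = (p e).1
        · rw [h1, ← hseg0 _ (P (p e).2)] at h
          exact ht.1.ne' (harc e h)
        by_cases h2 : w = (p e).2
        · rw [h2, ← hseg1 (P (p e).1)] at h
          exact ht.2.ne (harc e h)
        have h3 := orient_segmentPoint_self (P (p e).1) (P (p e).2) t
        rw [h, orient_planePoint] at h3
        exact hgen _ (hpE e) w h1 h2 (by exact_mod_cast h3) }
  have hcross : ∀ e f : G.edgeSet, e ≠ f → ∀ s t, t ∈ Set.Ioo (0 : ℝ) 1 →
      D.arc e s = D.arc f t →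
      (1 - t) * (orient (P (p e).1) (P (p e).2) (P (p f).1) : ℤ) +
        t * (orient (P (p e).1) (P (p e).2) (P (p f).2) : ℤ) = 0 ∧
      orient (P (p e).1) (P (p e).2) (P (p f).1) * orient (P (p e).1) (P (p e).2) (P (p f).2) < 0 := by
    intro e f hef s t ht h
    have h1 := orient_segmentPoint_self (P (p e).1) (P (p e).2) s
    rw [show segmentPoint _ _ s = segmentPoint _ _ t from h, orient_segmentPoint,
      orient_planePoint, orient_planePoint] at h1
    refine ⟨h1, mul_neg_of_combination_eq_zero ht h1 ?_⟩
    by_contra! hz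
    have key : ∀ w, orient (P (p e).1) (P (p e).2) (P w) = 0 → w = (p e).1 ∨ w = (p e).2 := by
      intro w hw
      by_contra! hw'
      exact hgen _ (hpE e) w hw'.1 hw'.2 hw
    apply hef
    rw [Subtype.ext_iff, hp e, hp f, Sym2.eq_iff]
    have := hne f
    rcases key _ hz.1 with h3 | h3 <;> rcases key _ hz.2 with h4 | h4
    · exact absurd (h3.trans h4.symm) this
    · exact .inl ⟨h3.symm, h4.symm⟩
    · exact .inr ⟨h4.symm, h3.symm⟩
    · exact absurd (h3.trans h4.symm) this
  have hunique : ∀ e f : G.edgeSet, e ≠ f → ∀ t t', t ∈ Set.Ioo (0 : ℝ) 1 →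
      t' ∈ Set.Ioo (0 : ℝ) 1 → (∃ s, D.arc e s = D.arc f t) → (∃ s, D.arc e s = D.arc f t') →
      t = t' := by
    rintro e f hef t t' ht ht' ⟨s, hs⟩ ⟨s', hs'⟩
    obtain ⟨h1, h2⟩ := hcross e f hef s t ht hs
    obtain ⟨h3, -⟩ := hcross e f hef s' t' ht' hs'
    set x := orient (P (p e).1) (P (p e).2) (P (p f).1)
    set y := orient (P (p e).1) (P (p e).2) (P (p f).2)
    have h4 : (y - x : ℝ) ≠ 0 := by
      have : y - x ≠ 0 := fun h =>
      absurd (sub_eq_zero.1 h ▸ h2) (not_lt.2 (mul_self_nonneg x))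
      exact_mod_cast this
    refine mul_right_cancel₀ h4 ?_
    linear_combination h1 - h3
  let L := (((E.product E).filter fun x => Crosses P x.1 x.2).map
    fun x => s(s(x.1.1, x.1.2), s(x.2.1, x.2.2))).toFinset
  let φ : Sym2 G.edgeSet × (ℝ × ℝ) → Sym2 (Sym2 V) := fun x => x.1.map Subtype.val
  have hφL : ∀ x ∈ D.crossings, φ x ∈ (L : Set (Sym2 (Sym2 V))) := by
    rintro ⟨x, z⟩ ⟨e, f, hef, rfl, ⟨s, hs, rfl⟩, t, ht, h⟩
    simp only [L, φ, List.coe_toFinset, List.mem_map, List.mem_filter, Set.mem_ofPred_eq,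
      decide_eq_true_eq]
    refine ⟨(p e, p f), ⟨List.mem_product.2 ⟨hpE e, hpE f⟩, (hcross e f hef s t ht h.symm).2,
      (hcross f e hef.symm t s hs h).2⟩, ?_⟩
    simp [← hp]
  have hφ : D.crossings.InjOn φ := by
    rintro ⟨x, z⟩ ⟨e, f, hef, rfl, ⟨s, hs, hs'⟩, t, ht, ht'⟩ ⟨y, w⟩
      ⟨e', f', -, rfl, ⟨s', hs₁, hs₁'⟩, t', ht₁, ht₁'⟩ h
    have h' : s(e, f) = s(e', f') := Sym2.map.injective Subtype.val_injective h
    dsimp only at hs' ht' hs₁' ht₁'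
    refine Prod.ext h' ?_
    dsimp only
    rcases Sym2.eq_iff.1 h' with ⟨rfl, rfl⟩ | ⟨rfl, rfl⟩
    · rw [← ht', ← ht₁', hunique e f hef t t' ht ht₁ ⟨s, hs'.trans ht'.symm⟩
        ⟨s', hs₁'.trans ht₁'.symm⟩]
    · rw [← ht', ← hs₁', hunique e f hef t s' ht hs₁ ⟨s, hs'.trans ht'.symm⟩
        ⟨t', ht₁'.trans hs₁'.symm⟩]
  refine ⟨D, Set.Finite.of_injOn hφL hφ L.finite_toSet, le_trans ?_ hn⟩
  rw [← Set.ncard_coe_finset]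
  exact Set.ncard_le_ncard_of_injOn φ hφL hφ L.finite_toSet

/-- The edges of `G⁶₉₈ □ C_m`. -/
def productEdges (m : ℕ) [NeZero m] : List ((Fin 6 × Fin m) × Fin 6 × Fin m) :=
  (List.finRange m).flatMap fun j =>
    ([(0, 1), (1, 2), (2, 3), (3, 4), (4, 5), (1, 3), (2, 4), (3, 5)].map
      fun r => ((r.1, j), (r.2, j))) ++ (List.finRange 6).map fun r => ((r, j), (r, j + 1))

/-- Nested copies of the cycle, with the symmetry `σ` moving each column to the next one. -/
def nestedCycles {m : ℕ} (base : Fin 6 → ℤ × ℤ) (σ : ℤ × ℤ → ℤ × ℤ) (v : Fin 6 × Fin m) : ℤ × ℤ :=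
  σ^[v.2] (base v.1)

theorem exists_drawing_three : ∃ D : Drawing (G6_98 □ cycleGraph 3),
    D.crossings.Finite ∧ D.crossings.ncard ≤ 9 :=
  exists_drawing_of_straight_lines (E := productEdges 3)
    (P := nestedCycles ![(1, 0), (4, 2), (6, 3), (9, -2), (12, -4), (13, -6)]
      fun a => (-a.2, a.1 - a.2)) (by decide +kernel) (by decide +kernel)
    (by decide +kernel) (by decide +kernel)

theorem exists_drawing_four : ∃ D : Drawing (G6_98 □ cycleGraph 4),
    D.crossings.Finite ∧ D.crossings.ncard ≤ 12 :=
  exists_drawing_of_straight_lines (E := productEdges 4)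
    (P := nestedCycles ![(1, -1), (3, 0), (4, -4), (7, 6), (14, 2), (18, 0)]
      fun a => (-a.2, a.1)) (by decide +kernel) (by decide +kernel)
    (by decide +kernel) (by decide +kernel)

set_option maxRecDepth 100000 in
/-- Sets of pairs of template edges, for cycles on three vertices, whose crossing parities add up to
zero whatever the drawing; the code `0` stands for the constant one. -/
def checksThree : List (List ℕ) := [
  [14, 17, 23, 95, 98, 104, 338, 341, 347, 365, 368, 374],
  [67, 70, 76, 148, 151, 157, 337, 340, 346, 365, 394, 400],
  [39, 42, 48, 120, 123, 129, 337, 338, 366, 372, 393, 399],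
  [0, 5, 8, 14, 15, 23, 39, 42, 48, 57, 60, 67, 69, 76, 89, 102, 104, 141, 156, 157, 174, 176, 228,
  229, 346, 347, 372, 374, 399, 400],
  [57, 63, 78, 79, 89, 102, 104, 225, 240, 241, 264, 266, 591, 592, 645, 646],
  [6, 7, 8, 87, 88, 89, 174, 175, 201, 202, 228, 229],
  [60, 61, 62, 141, 142, 143, 174, 176, 201, 203, 228, 230],
  [87, 90, 99, 100, 114, 117, 126, 127, 141, 144, 153, 154],
  [3, 4, 5, 87, 102, 103, 114, 129, 130, 141, 156, 157],
  [5, 11, 24, 26, 141, 156, 157, 173, 186, 188, 318, 319, 591, 593, 618, 620],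
  [338, 341, 347, 393, 399, 422, 428, 480, 590],
  [33, 34, 35, 114, 115, 116, 175, 176, 202, 203, 229, 230],
  [95, 98, 104, 176, 179, 185, 393, 394, 422, 428, 449, 455],
  [60, 63, 72, 73, 141, 144, 153, 154, 174, 176, 255, 257, 342, 343, 396, 397],
  [57, 58, 59, 89, 102, 104, 116, 129, 131, 143, 156, 158],
  [95, 98, 104, 257, 260, 266, 402, 403, 483, 484, 645, 646],
  [120, 123, 129, 201, 204, 210, 340, 341, 421, 422, 453, 480],
  [3, 6, 15, 16, 30, 33, 42, 43, 57, 60, 69, 70],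
  [4, 10, 25, 26, 114, 129, 130, 172, 187, 188, 291, 292, 592, 593, 619, 620],
  [0, 35, 38, 45, 47, 61, 64, 73, 74, 176, 182, 185, 188, 200, 203, 207, 210, 215, 226, 230, 235,
  238, 242, 291, 293, 319, 320, 508, 509, 534, 536, 561, 562],
  [148, 151, 157, 229, 232, 238, 366, 368, 421, 427, 449, 481],
  [98, 101, 107, 179, 182, 188, 422, 425, 431, 449, 452, 458],
  [0, 5, 8, 15, 17, 58, 59, 60, 69, 70, 95, 98, 104, 116, 120, 123, 131, 141, 143, 148, 151, 158,
  174, 176, 228, 229, 340, 341, 366, 368, 393, 394],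
  [3, 4, 5, 30, 31, 32, 57, 58, 59],
  [32, 38, 51, 53, 142, 157, 158, 200, 213, 215, 319, 320, 618, 620, 645, 647],
  [8, 11, 18, 20, 89, 92, 99, 101, 228, 229, 309, 310, 342, 344, 369, 371],
  [0, 5, 8, 15, 17, 57, 60, 69, 70, 89, 95, 98, 102, 120, 123, 129, 141, 148, 151, 156, 174, 176,
  228, 229, 340, 341, 366, 368, 393, 394],
  [365, 368, 374, 394, 400, 449, 455, 481, 617],
  [87, 88, 89, 171, 186, 187, 198, 213, 214, 225, 240, 241],
  [17, 20, 26, 98, 101, 107, 341, 344, 350, 368, 371, 377],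
  [120, 123, 129, 282, 285, 291, 349, 350, 430, 431, 592, 593],
  [393, 396, 402, 422, 428, 477, 483, 509, 645],
  [123, 126, 132, 204, 207, 213, 421, 422, 450, 456, 477, 483],
  [39, 42, 48, 120, 123, 129, 338, 340, 346, 393, 399, 421, 427, 453, 589],
  [0, 3, 4, 8, 15, 17, 57, 60, 69, 70, 87, 89, 95, 98, 103, 114, 120, 123, 130, 148, 151, 157, 174,
  176, 228, 229, 340, 341, 366, 368, 393, 394],
  [0, 4, 7, 17, 19, 25, 117, 126, 127, 129, 130, 198, 202, 207, 210, 214, 229, 235, 238, 241, 256,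
  260, 265, 369, 370, 477, 478, 480, 481, 508, 534, 592, 619],
  [14, 17, 23, 176, 179, 185, 399, 400, 480, 481, 590, 617],
  [0, 7, 10, 19, 20, 33, 36, 45, 46, 172, 175, 182, 185, 187, 198, 202, 207, 210, 214, 229, 235,
  238, 241, 265, 266, 291, 292, 508, 509, 534, 536, 561, 562],
  [148, 151, 157, 310, 313, 319, 375, 377, 456, 458, 618, 620],
  [58, 64, 70, 73, 80, 116, 129, 131, 226, 232, 235, 242, 291, 293, 453, 455, 534, 536, 593, 647],
  [0, 89, 92, 98, 99, 107, 123, 126, 132, 141, 144, 151, 153, 160, 173, 186, 188, 225, 240, 241,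
  258, 260, 312, 313, 430, 431, 456, 458, 483, 484],
  [340, 343, 349, 421, 424, 430, 453, 534, 592],
  [337, 340, 346, 366, 372, 421, 427, 453, 589],
  [67, 70, 76, 229, 232, 238, 372, 374, 453, 455, 589, 617],
  [120, 126, 129, 132, 201, 207, 210, 213, 340, 341, 450, 453, 456, 477, 480, 483],
  [42, 45, 51, 123, 126, 132, 366, 369, 375, 393, 396, 402],
  [5, 8, 15, 17, 32, 35, 42, 44, 59, 62, 69, 71],
  [6, 9, 18, 19, 87, 90, 99, 100, 174, 175, 255, 256, 342, 343, 369, 370],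
  [5, 11, 17, 20, 24, 141, 156, 157, 173, 179, 182, 186, 318, 319, 480, 481, 561, 562, 591, 618],
  [30, 31, 32, 88, 103, 104, 115, 130, 131, 142, 157, 158],
  [0, 89, 92, 99, 101, 141, 144, 153, 154, 173, 186, 188, 225, 240, 241, 258, 263, 269, 285, 288,
  294, 312, 316, 322, 511, 512, 537, 539, 564, 565],
  [0, 116, 119, 126, 128, 142, 145, 154, 155, 200, 213, 215, 226, 241, 242, 260, 263, 269, 287, 288,
  294, 314, 316, 322, 511, 512, 537, 539, 564, 565],
  [123, 126, 132, 285, 288, 294, 430, 431, 511, 512, 673, 674],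
  [366, 369, 375, 421, 427, 450, 456, 508, 618],
  [422, 425, 431, 477, 483, 506, 512, 564, 674],
  [341, 344, 350, 422, 425, 431, 480, 561, 593],
  [95, 101, 104, 107, 176, 182, 185, 188, 393, 394, 425, 428, 431, 452, 455, 458],
  [16, 19, 25, 43, 46, 52, 70, 73, 79],
  [15, 18, 24, 42, 45, 51, 69, 72, 78],
  [30, 36, 42, 45, 52, 88, 103, 104, 198, 204, 207, 214, 265, 266, 427, 428, 508, 509, 619, 646],
  [0, 5, 8, 15, 17, 58, 59, 60, 69, 70, 87, 88, 89, 95, 98, 104, 114, 115, 120, 123, 131, 142, 148,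
  151, 158, 174, 176, 228, 229, 340, 341, 366, 368, 393, 394],
  [0, 3, 4, 8, 15, 17, 57, 60, 69, 70, 88, 95, 98, 103, 115, 116, 120, 123, 130, 141, 142, 143, 148,
  151, 157, 174, 176, 228, 229, 340, 341, 366, 368, 393, 394],
  [141, 142, 143, 173, 186, 188, 200, 213, 215, 227, 240, 242],
  [3, 9, 24, 25, 87, 102, 103, 171, 186, 187, 264, 265, 591, 592, 618, 619],
  [0, 32, 38, 51, 53, 58, 64, 79, 80, 95, 101, 104, 107, 119, 120, 128, 131, 132, 145, 148, 155,
  158, 160, 282, 284, 310, 311, 349, 350, 375, 377, 402, 403],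
  [59, 65, 78, 80, 143, 156, 158, 227, 240, 242, 318, 320, 591, 593, 645, 647],
  [57, 58, 59, 87, 88, 102, 104, 114, 115, 129, 131, 141, 142, 156, 158],
  [61, 64, 70, 74, 79, 142, 145, 151, 155, 160, 201, 203, 282, 284, 340, 344, 349, 394, 398, 403],
  [87, 88, 89, 114, 115, 116, 141, 142, 143],
  [89, 92, 99, 101, 116, 119, 126, 128, 143, 146, 153, 155],
  [0, 4, 10, 25, 26, 30, 36, 51, 52, 91, 95, 100, 103, 107, 117, 120, 127, 130, 132, 148, 154, 157,
  160, 256, 257, 282, 283, 349, 350, 375, 377, 402, 403],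
  [229, 232, 238, 310, 313, 319, 369, 371, 450, 452, 508, 562],
  [151, 154, 160, 313, 316, 322, 456, 458, 537, 539, 673, 701],
  [0, 7, 10, 16, 20, 25, 33, 36, 43, 45, 52, 172, 175, 182, 185, 187, 198, 202, 207, 210, 214, 256,
  259, 266, 283, 286, 291, 369, 371, 450, 452, 453, 455, 509, 561, 592, 646],
  [6, 7, 8, 30, 36, 51, 52, 87, 89, 103, 104, 174, 175, 198, 201, 202, 213, 214, 228, 229, 265, 266,
  618, 619, 645, 646],
  [0, 4, 10, 16, 19, 26, 30, 33, 42, 43, 91, 95, 100, 103, 107, 114, 120, 123, 130, 148, 151, 157,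
  175, 176, 282, 283, 340, 343, 350, 366, 370, 377, 393, 394],
  [33, 36, 42, 46, 51, 114, 117, 123, 127, 132, 175, 176, 256, 257, 366, 370, 375, 393, 397, 402],
  [0, 32, 35, 39, 44, 48, 57, 59, 60, 62, 70, 71, 89, 95, 98, 102, 141, 148, 151, 156, 174, 176,
  228, 229, 337, 338, 340, 341, 368, 372, 394, 399],
  [4, 10, 17, 20, 25, 114, 129, 130, 172, 179, 182, 187, 291, 292, 480, 481, 561, 562, 592, 619],
  [201, 204, 210, 255, 258, 264, 309, 312, 318, 343, 344, 424, 425, 534, 561],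
  [15, 18, 24, 69, 72, 78, 204, 207, 213, 427, 428, 508, 509, 618, 645],
  [70, 73, 79, 232, 235, 241, 453, 455, 534, 536, 592, 646],
  [16, 19, 25, 43, 46, 52, 151, 154, 160, 340, 343, 349, 394, 397, 403],
  [151, 154, 160, 232, 235, 241, 421, 424, 430, 449, 478, 484],
  [368, 371, 377, 449, 452, 458, 481, 562, 620],
  [70, 73, 79, 151, 154, 160, 340, 343, 349, 394, 397, 403],
  [120, 123, 129, 282, 285, 291, 340, 343, 350, 421, 424, 431, 453, 534, 593],
  [0, 89, 92, 98, 99, 107, 141, 144, 151, 153, 160, 173, 186, 188, 225, 240, 241, 258, 260, 285,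
  288, 294, 312, 313, 456, 458, 483, 484, 511, 512, 673, 674],
  [0, 4, 7, 16, 17, 30, 36, 43, 46, 51, 88, 95, 98, 103, 117, 120, 127, 130, 132, 148, 151, 157,
  201, 202, 256, 257, 340, 341, 368, 370, 375, 394, 397, 402],
  [30, 31, 32, 91, 100, 101, 103, 104, 118, 127, 128, 130, 131, 145, 154, 155, 157, 158],
  [0, 4, 7, 14, 16, 23, 30, 33, 39, 43, 48, 67, 70, 76, 88, 103, 104, 114, 129, 130, 175, 176, 201,
  202, 346, 347, 372, 374, 399, 400],
  [33, 36, 45, 46, 114, 117, 126, 127, 175, 176, 256, 257, 369, 370, 396, 397],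
  [0, 98, 101, 107, 116, 119, 123, 128, 132, 141, 143, 145, 151, 155, 160, 173, 186, 188, 226, 227,
  240, 241, 285, 287, 313, 314, 430, 431, 456, 458, 483, 484],
  [30, 31, 32, 57, 58, 59, 87, 102, 103, 114, 129, 130, 141, 156, 157],
  [0, 58, 61, 70, 74, 80, 95, 101, 104, 107, 119, 120, 128, 131, 132, 200, 201, 203, 213, 215, 311,
  313, 320, 340, 344, 350, 394, 398, 402, 456, 458, 645, 647],
  [7, 10, 17, 19, 26, 88, 91, 98, 100, 107, 201, 202, 282, 283, 341, 343, 350, 368, 370, 377],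
  [0, 58, 61, 70, 74, 80, 119, 126, 128, 129, 131, 176, 182, 185, 188, 200, 203, 207, 210, 215, 311,
  313, 320, 396, 398, 450, 452, 453, 455, 509, 561, 593, 647],
  [0, 35, 38, 44, 45, 53, 61, 64, 71, 73, 80, 200, 203, 207, 210, 215, 226, 230, 235, 238, 242, 284,
  287, 291, 311, 314, 319, 396, 397, 477, 478, 480, 481, 508, 534, 593, 620],
  [0, 32, 35, 42, 44, 58, 64, 71, 74, 79, 95, 98, 104, 116, 120, 123, 131, 145, 148, 155, 158, 160,
  229, 230, 282, 284, 341, 344, 349, 366, 368, 393, 398, 403],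
  [0, 7, 10, 16, 20, 25, 30, 33, 42, 43, 88, 103, 104, 172, 175, 182, 185, 187, 202, 204, 210, 229,
  232, 238, 291, 292, 427, 428, 453, 455, 561, 562, 592, 619],
  [0, 89, 92, 99, 101, 141, 145, 146, 153, 154, 173, 186, 188, 226, 227, 240, 241, 260, 263, 269,
  287, 288, 294, 314, 316, 322, 511, 512, 537, 539, 564, 565],
  [0, 32, 38, 44, 47, 51, 58, 64, 71, 74, 79, 95, 98, 104, 119, 120, 128, 131, 132, 145, 148, 155,
  158, 160, 282, 284, 310, 311, 341, 344, 349, 368, 371, 375, 402, 403],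
  [201, 204, 210, 282, 285, 291, 343, 344, 424, 425, 534, 561],
  [176, 179, 185, 284, 287, 293, 311, 314, 320, 396, 397, 477, 478, 509, 536],
  [394, 397, 403, 452, 455, 458, 533, 536, 539, 565, 646, 701],
  [57, 63, 70, 73, 78, 89, 102, 104, 225, 232, 235, 240, 264, 266, 453, 455, 534, 536, 591, 645],
  [16, 19, 25, 43, 46, 52, 232, 235, 241, 453, 455, 534, 536, 592, 646],
  [0, 88, 91, 100, 101, 114, 117, 126, 127, 172, 187, 188, 198, 213, 214, 259, 263, 269, 286, 288,
  294, 313, 316, 322, 511, 512, 537, 539, 564, 565],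
  [0, 4, 7, 16, 17, 30, 34, 35, 42, 43, 88, 95, 98, 103, 115, 116, 129, 130, 203, 204, 210, 230,
  232, 238, 393, 394, 422, 427, 449, 453, 480, 481],
  [394, 397, 403, 449, 455, 478, 484, 536, 646],
  [5, 11, 24, 26, 141, 148, 151, 156, 173, 186, 188, 310, 313, 318, 375, 377, 456, 458, 591, 593],
  [3, 4, 5, 87, 102, 103, 114, 129, 130, 141, 148, 151, 156, 229, 232, 238, 366, 368, 421, 427, 449,
  481],
  [44, 47, 53, 71, 74, 80, 179, 182, 188, 480, 481, 561, 562, 593, 620],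
  [67, 73, 76, 79, 229, 235, 238, 241, 372, 374, 534, 536, 589, 592, 617, 646],
  [67, 70, 76, 148, 151, 157, 337, 340, 346, 368, 374, 449, 455, 481, 617],
  [0, 88, 89, 90, 99, 100, 115, 117, 119, 127, 128, 141, 142, 146, 153, 155, 173, 186, 188, 225,
  240, 241, 258, 263, 269, 285, 288, 294, 312, 316, 322, 511, 512, 537, 539, 564, 565],
  [44, 47, 53, 71, 74, 80, 98, 101, 107, 341, 344, 350, 368, 371, 377],
  [120, 123, 129, 201, 204, 210, 338, 340, 347, 393, 399, 421, 428, 453, 590],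
  [366, 369, 375, 424, 427, 430, 505, 508, 511, 537, 618, 673],
  [0, 32, 38, 42, 45, 53, 58, 64, 79, 80, 95, 101, 104, 107, 119, 120, 123, 126, 128, 131, 145, 148,
  155, 158, 160, 282, 284, 310, 311, 349, 350, 366, 369, 377, 393, 396, 403],
  [17, 20, 26, 179, 182, 188, 480, 481, 561, 562, 593, 620],
  [0, 32, 38, 44, 47, 51, 58, 61, 70, 71, 95, 98, 104, 119, 120, 128, 131, 132, 142, 148, 151, 158,
  201, 203, 310, 311, 340, 341, 368, 371, 375, 394, 398, 402],
  [0, 4, 10, 25, 26, 30, 36, 42, 45, 52, 91, 95, 100, 103, 107, 117, 120, 123, 126, 127, 130, 148,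
  154, 157, 160, 256, 257, 282, 283, 349, 350, 366, 369, 377, 393, 396, 403],
  [6, 7, 8, 33, 34, 35, 60, 61, 62],
  [17, 20, 26, 44, 47, 53, 71, 74, 80],
  [4, 7, 16, 17, 31, 34, 43, 44, 58, 61, 70, 71],
  [42, 45, 51, 204, 207, 213, 427, 428, 508, 509, 618, 645],
  [15, 18, 24, 69, 72, 78, 285, 288, 294, 366, 369, 375, 393, 396, 402, 430, 431, 511, 512, 673,
  674],
  [0, 32, 35, 42, 44, 57, 59, 60, 62, 70, 71, 89, 95, 98, 102, 120, 123, 129, 141, 148, 151, 156,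
  174, 176, 228, 229, 340, 341, 366, 368, 393, 394],
  [31, 37, 52, 53, 115, 130, 131, 199, 214, 215, 292, 293, 619, 620, 646, 647],
  [5, 11, 24, 26, 32, 38, 51, 53, 59, 65, 78, 80],
  [0, 32, 35, 42, 47, 53, 95, 101, 104, 107, 145, 148, 155, 158, 160, 226, 229, 230, 241, 242, 284,
  285, 293, 366, 371, 377, 393, 398, 403, 430, 431, 646, 647],
  [0, 6, 7, 9, 10, 18, 20, 60, 63, 70, 72, 79, 172, 175, 182, 185, 187, 198, 202, 207, 210, 214,
  229, 232, 238, 265, 266, 291, 292, 453, 455, 508, 509, 561, 562, 592, 646],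
  [0, 5, 8, 15, 17, 39, 42, 48, 57, 60, 69, 70, 89, 95, 98, 102, 141, 148, 151, 156, 174, 176, 228,
  229, 337, 338, 340, 341, 368, 372, 394, 399],
  [0, 32, 38, 51, 53, 58, 64, 79, 80, 98, 101, 107, 119, 120, 128, 131, 132, 145, 148, 155, 158,
  160, 282, 287, 293, 310, 314, 320, 349, 350, 375, 377, 483, 484, 645, 646],
  [0, 4, 7, 16, 17, 30, 33, 42, 43, 88, 95, 98, 103, 114, 120, 123, 130, 148, 151, 157, 175, 176,
  201, 202, 340, 341, 366, 368, 393, 394],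
  [0, 4, 7, 16, 17, 31, 32, 33, 42, 43, 114, 115, 129, 131, 142, 157, 158, 175, 179, 185, 202, 204,
  210, 229, 232, 238, 427, 428, 453, 455, 480, 481],
  [0, 3, 5, 7, 14, 16, 23, 30, 33, 39, 43, 48, 67, 70, 76, 87, 88, 102, 104, 141, 156, 157, 175,
  176, 201, 202, 346, 347, 372, 374, 399, 400],
  [0, 5, 8, 15, 17, 60, 63, 69, 73, 78, 141, 156, 157, 174, 179, 185, 201, 204, 210, 225, 228, 235,
  238, 240, 264, 266, 427, 428, 480, 481, 534, 536, 591, 645],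
  [0, 4, 7, 16, 17, 33, 36, 43, 45, 52, 114, 129, 130, 175, 179, 185, 198, 202, 207, 210, 214, 229,
  232, 238, 265, 266, 453, 455, 480, 481, 508, 509, 619, 646],
  [30, 31, 32, 87, 89, 103, 104, 114, 116, 130, 131, 141, 143, 157, 158],
  [0, 7, 10, 16, 20, 25, 33, 36, 43, 45, 52, 172, 175, 182, 185, 187, 198, 202, 207, 210, 214, 229,
  232, 238, 265, 266, 291, 292, 453, 455, 508, 509, 561, 562, 592, 646],
  [0, 32, 35, 42, 44, 58, 61, 70, 71, 116, 129, 131, 142, 157, 158, 176, 179, 185, 203, 204, 210,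
  230, 232, 238, 427, 428, 453, 455, 480, 481],
  [0, 14, 17, 23, 32, 33, 34, 39, 44, 48, 58, 60, 62, 67, 71, 76, 114, 115, 129, 131, 141, 143, 157,
  158, 174, 175, 202, 203, 228, 230, 346, 347, 372, 374, 399, 400],
  [32, 38, 51, 53, 141, 143, 157, 158, 173, 186, 188, 227, 240, 242, 319, 320, 618, 620, 645, 647],
  [0, 98, 101, 107, 116, 119, 123, 128, 132, 142, 145, 151, 155, 160, 200, 213, 215, 226, 241, 242,
  285, 287, 313, 314, 430, 431, 456, 458, 483, 484],
  [0, 7, 10, 19, 20, 33, 36, 45, 46, 172, 175, 182, 185, 187, 198, 202, 207, 210, 214, 265, 266,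
  291, 292, 310, 316, 319, 322, 369, 371, 505, 509, 511, 533, 534, 536, 561, 565],
  [57, 63, 78, 79, 87, 88, 102, 104, 171, 186, 187, 198, 213, 214, 264, 266, 591, 592, 645, 646],
  [0, 32, 35, 42, 44, 58, 60, 62, 70, 71, 116, 120, 123, 131, 141, 143, 148, 151, 158, 174, 179,
  185, 228, 229, 340, 341, 366, 368, 422, 428, 449, 455],
  [0, 88, 91, 95, 100, 104, 107, 114, 117, 123, 127, 132, 151, 154, 160, 172, 187, 188, 198, 213,
  214, 257, 259, 266, 285, 286, 402, 403, 430, 431, 456, 458, 645, 646],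
  [30, 36, 51, 52, 88, 103, 104, 198, 213, 214, 265, 266, 618, 619, 645, 646],
  [0, 89, 92, 99, 101, 142, 143, 145, 146, 153, 154, 179, 182, 188, 200, 204, 207, 215, 226, 232,
  235, 242, 285, 287, 313, 314, 424, 425, 450, 452, 477, 478],
  [0, 30, 31, 38, 51, 53, 58, 64, 79, 80, 91, 95, 100, 103, 107, 118, 119, 120, 127, 130, 132, 282,
  284, 311, 316, 319, 322, 349, 350, 402, 403, 537, 539, 618, 620, 673, 701],
  [0, 4, 6, 8, 16, 17, 30, 33, 42, 43, 87, 89, 103, 104, 114, 129, 130, 174, 179, 185, 201, 204,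
  210, 228, 232, 238, 427, 428, 453, 455, 480, 481],
  [62, 65, 72, 74, 143, 146, 153, 155, 228, 230, 309, 311, 342, 344, 396, 398],
  [60, 61, 62, 120, 123, 129, 141, 142, 143, 174, 176, 203, 204, 210, 228, 230, 340, 341, 421, 422,
  453, 480],
  [0, 116, 119, 126, 128, 142, 145, 154, 155, 179, 182, 188, 200, 204, 207, 215, 226, 229, 235, 238,
  242, 285, 287, 310, 314, 319, 369, 371, 424, 425, 477, 478, 508, 562],
  [35, 38, 45, 47, 116, 119, 126, 128, 229, 230, 310, 311, 369, 371, 396, 398],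
  [35, 38, 45, 47, 89, 92, 99, 101, 143, 146, 153, 155, 229, 230, 310, 311, 369, 371, 396, 398],
  [0, 4, 7, 16, 17, 30, 33, 42, 43, 88, 103, 104, 114, 129, 130, 148, 151, 157, 175, 179, 185, 202,
  204, 210, 366, 368, 421, 428, 449, 453, 455, 480],
  [0, 4, 7, 14, 16, 23, 31, 32, 36, 43, 46, 51, 115, 117, 120, 127, 131, 132, 142, 148, 151, 158,
  201, 202, 256, 257, 338, 340, 347, 365, 370, 374, 375, 394, 397, 402],
  [32, 38, 51, 53, 60, 61, 62, 141, 143, 157, 158, 174, 176, 200, 201, 203, 213, 215, 228, 230, 319,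
  320, 618, 620, 645, 647],
  [0, 32, 35, 42, 44, 61, 64, 71, 73, 80, 142, 157, 158, 176, 179, 185, 203, 204, 210, 226, 230,
  235, 238, 242, 291, 293, 427, 428, 480, 481, 534, 536, 593, 647],
  [0, 30, 31, 33, 34, 42, 44, 58, 61, 67, 71, 76, 88, 103, 104, 114, 129, 130, 175, 179, 185, 202,
  204, 210, 372, 374, 427, 428, 480, 481, 589, 617],
  [0, 14, 20, 23, 26, 32, 38, 51, 53, 58, 61, 67, 74, 76, 80, 119, 120, 128, 131, 132, 142, 157,
  158, 201, 203, 310, 311, 337, 338, 346, 347, 371, 374, 375, 398, 400, 402],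
  [0, 4, 7, 14, 19, 23, 25, 30, 36, 51, 52, 67, 73, 76, 79, 88, 103, 104, 117, 120, 127, 130, 132,
  201, 202, 256, 257, 337, 338, 346, 347, 370, 374, 375, 397, 400, 402],
  [35, 38, 42, 47, 51, 116, 119, 123, 128, 132, 229, 230, 310, 311, 366, 371, 375, 393, 398, 402],
  [0, 5, 8, 15, 17, 57, 60, 69, 70, 89, 102, 104, 120, 123, 129, 141, 156, 157, 174, 179, 185, 228,
  232, 238, 340, 341, 421, 422, 427, 428, 455, 481],
  [0, 5, 8, 14, 15, 23, 59, 61, 62, 64, 69, 73, 80, 142, 157, 158, 203, 204, 210, 226, 230, 235,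
  238, 242, 291, 293, 399, 400, 427, 428, 534, 536, 590, 593, 617, 647],
  [0, 3, 4, 8, 15, 17, 30, 31, 32, 58, 59, 60, 69, 70, 89, 95, 98, 102, 120, 123, 129, 141, 148,
  151, 156, 174, 176, 228, 229, 340, 341, 366, 368, 393, 394],
  [0, 89, 92, 99, 101, 141, 144, 153, 154, 173, 179, 182, 186, 204, 207, 213, 225, 232, 235, 240,
  258, 260, 312, 313, 424, 425, 450, 452, 477, 478],
  [15, 18, 24, 69, 72, 78, 123, 126, 132, 421, 422, 427, 428, 450, 456, 477, 483, 508, 509, 618,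
  645],
  [0, 35, 38, 44, 45, 53, 61, 64, 71, 73, 80, 176, 179, 185, 200, 203, 207, 210, 215, 226, 230, 235,
  238, 242, 291, 293, 319, 320, 480, 481, 508, 509, 534, 536, 593, 620],
  [0, 89, 92, 99, 101, 123, 126, 132, 141, 144, 151, 153, 160, 173, 186, 188, 225, 240, 241, 258,
  263, 269, 312, 313, 430, 431, 456, 458, 564, 565, 674, 701],
  [0, 5, 8, 14, 15, 23, 39, 42, 48, 57, 60, 67, 69, 76, 89, 95, 98, 102, 141, 156, 157, 174, 179,
  185, 228, 229, 338, 341, 346, 365, 368, 372, 480, 481, 590, 617],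
  [0, 5, 8, 17, 18, 24, 57, 60, 70, 72, 78, 89, 95, 98, 102, 120, 126, 129, 132, 141, 148, 151, 156,
  174, 176, 228, 229, 340, 341, 368, 369, 375, 394, 396, 402],
  [58, 64, 79, 80, 116, 129, 131, 226, 241, 242, 291, 293, 592, 593, 646, 647],
  [15, 18, 24, 69, 72, 78, 201, 204, 210, 282, 288, 291, 294, 343, 344, 427, 428, 505, 506, 508,
  509, 534, 537, 561, 564, 618, 645],
  [120, 123, 129, 201, 204, 210, 337, 341, 346, 366, 372, 422, 427, 480, 589],
  [0, 89, 92, 99, 101, 114, 115, 116, 141, 144, 153, 154, 171, 186, 187, 198, 200, 214, 215, 227,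
  240, 242, 258, 263, 269, 285, 288, 294, 312, 316, 322, 511, 512, 537, 539, 564, 565],
  [0, 5, 8, 15, 20, 26, 57, 60, 69, 70, 89, 102, 104, 141, 156, 157, 174, 182, 185, 188, 201, 204,
  210, 228, 232, 238, 427, 428, 453, 455, 561, 562, 593, 620],
  [0, 32, 38, 51, 53, 89, 92, 95, 99, 104, 107, 143, 145, 146, 148, 153, 158, 160, 226, 241, 242,
  284, 288, 293, 294, 310, 311, 375, 377, 402, 403, 511, 512, 646, 647, 673, 674],
  [95, 101, 104, 107, 257, 263, 266, 269, 402, 403, 564, 565, 645, 646, 674, 701],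
  [44, 47, 53, 71, 74, 80, 95, 98, 104, 257, 263, 266, 269, 341, 344, 350, 368, 371, 377, 402, 403,
  564, 565, 645, 646, 674, 701],
  [95, 98, 104, 176, 179, 185, 365, 368, 374, 393, 400, 422, 428, 481, 617],
  [0, 32, 35, 44, 45, 51, 58, 61, 70, 71, 116, 129, 131, 142, 157, 158, 176, 179, 185, 203, 207,
  210, 213, 230, 232, 238, 453, 455, 480, 481, 508, 509, 618, 645],
  [0, 114, 115, 119, 126, 128, 141, 143, 144, 146, 154, 155, 171, 186, 187, 198, 200, 214, 215, 227,
  240, 242, 258, 263, 269, 285, 288, 294, 312, 316, 322, 511, 512, 537, 539, 564, 565],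
  [16, 19, 25, 43, 46, 52, 151, 154, 160, 394, 397, 403, 421, 424, 430, 453, 534, 592],
  [16, 19, 25, 43, 46, 52, 232, 235, 241, 340, 343, 349, 421, 424, 430, 455, 536, 646],
  [0, 30, 33, 42, 46, 52, 91, 95, 100, 103, 107, 172, 175, 176, 187, 188, 229, 235, 238, 241, 283,
  285, 292, 370, 371, 393, 394, 424, 427, 431, 452, 455, 458, 536, 562, 619, 646],
  [449, 452, 458, 478, 484, 533, 539, 565, 701],
  [61, 64, 73, 74, 142, 145, 154, 155, 201, 203, 282, 284, 343, 344, 397, 398],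
  [57, 63, 78, 79, 89, 95, 101, 102, 107, 225, 240, 241, 257, 263, 264, 269, 402, 403, 564, 565,
  591, 592, 674, 701],
  [95, 101, 104, 107, 148, 151, 157, 176, 182, 185, 188, 229, 232, 238, 366, 371, 377, 393, 394,
  421, 425, 427, 428, 431, 455, 562, 620],
  [32, 38, 51, 53, 142, 148, 154, 158, 160, 200, 213, 215, 310, 316, 320, 322, 375, 377, 537, 539,
  645, 647, 673, 701],
  [0, 16, 19, 25, 30, 33, 42, 43, 91, 100, 101, 103, 104, 172, 175, 182, 185, 187, 256, 259, 265,
  285, 286, 369, 370, 424, 425, 427, 428, 450, 452, 453, 455, 508, 534, 592, 619],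
  [44, 47, 53, 71, 74, 80, 98, 101, 107, 368, 371, 377, 422, 425, 431, 480, 561, 593],
  [0, 5, 8, 14, 15, 23, 58, 59, 60, 69, 70, 116, 120, 123, 131, 141, 143, 148, 151, 158, 174, 176,
  228, 229, 338, 340, 347, 365, 366, 374, 393, 394],
  [0, 114, 115, 117, 118, 123, 128, 132, 142, 145, 151, 155, 160, 172, 187, 188, 198, 213, 214, 259,
  263, 269, 285, 286, 430, 431, 456, 458, 564, 565, 674, 701],
  [148, 151, 157, 310, 313, 319, 368, 371, 375, 449, 452, 456, 481, 562, 618],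
  [34, 37, 46, 47, 115, 118, 127, 128, 202, 203, 283, 284, 368, 370, 377, 397, 398, 478, 481, 484,
  533, 539, 562, 565, 620, 701],
  [368, 371, 377, 478, 481, 484, 533, 539, 562, 565, 620, 701],
  [0, 88, 91, 98, 100, 107, 114, 118, 119, 123, 127, 132, 172, 187, 188, 199, 200, 213, 214, 285,
  287, 314, 316, 322, 430, 431, 483, 484, 537, 539, 673, 701],
  [16, 19, 25, 43, 46, 52, 313, 316, 322, 394, 397, 403, 450, 453, 458, 505, 511, 534, 539, 592,
  701],
  [5, 11, 24, 26, 141, 148, 151, 156, 173, 186, 188, 310, 313, 318, 366, 369, 377, 421, 427, 450,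
  458, 508, 591, 593, 618],
  [0, 58, 64, 79, 80, 88, 91, 95, 100, 104, 107, 115, 118, 119, 120, 127, 131, 132, 200, 213, 215,
  282, 284, 311, 316, 320, 322, 349, 350, 402, 403, 537, 539, 645, 647, 673, 701],
  [57, 58, 59, 89, 95, 98, 102, 116, 129, 131, 143, 156, 158, 176, 179, 185, 393, 394, 422, 428,
  449, 455],
  [0, 14, 17, 23, 32, 35, 39, 44, 48, 61, 64, 71, 73, 80, 142, 157, 158, 201, 203, 226, 230, 235,
  238, 242, 291, 293, 346, 347, 399, 400, 534, 536, 589, 593, 617, 647],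
  [340, 343, 349, 450, 453, 456, 505, 511, 534, 537, 592, 673],
  [39, 42, 48, 120, 123, 129, 337, 341, 347, 366, 372, 422, 428, 480, 590],
  [120, 126, 129, 132, 282, 288, 291, 294, 341, 344, 349, 477, 480, 483, 506, 511, 561, 564, 592,
  673],
  [0, 4, 7, 16, 17, 30, 33, 39, 43, 48, 88, 95, 98, 103, 114, 129, 130, 148, 151, 157, 175, 176,
  201, 202, 337, 338, 340, 341, 368, 372, 394, 399],
  [0, 5, 8, 17, 18, 24, 39, 45, 48, 51, 57, 60, 70, 72, 78, 89, 95, 98, 102, 141, 148, 151, 156,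
  174, 176, 228, 229, 337, 338, 340, 341, 368, 372, 394, 399],
  [120, 126, 129, 132, 282, 288, 291, 294, 349, 350, 511, 512, 592, 593, 673, 674],
  [120, 123, 129, 255, 258, 264, 309, 312, 318, 341, 344, 349, 422, 425, 430, 480, 561, 592],
  [120, 123, 129, 255, 258, 264, 309, 312, 318, 349, 350, 430, 431, 592, 593],
  [341, 344, 350, 477, 480, 483, 506, 512, 561, 564, 593, 674],
  [201, 204, 210, 282, 285, 291, 340, 341, 349, 350, 421, 422, 430, 431, 453, 480, 592, 593],
  [39, 42, 48, 201, 204, 210, 337, 338, 340, 341, 366, 372, 393, 399, 421, 422, 453, 480],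
  [120, 126, 129, 132, 201, 207, 210, 213, 340, 344, 350, 450, 453, 456, 506, 512, 561, 564, 593,
  674],
  [0, 5, 8, 15, 17, 57, 60, 69, 70, 89, 102, 104, 120, 123, 129, 141, 148, 151, 156, 174, 179, 185,
  228, 229, 340, 341, 366, 368, 422, 428, 449, 455],
  [0, 32, 35, 39, 44, 48, 57, 59, 61, 70, 71, 89, 95, 98, 102, 142, 143, 148, 151, 156, 201, 203,
  229, 230, 337, 338, 340, 341, 368, 372, 394, 399],
  [15, 18, 24, 69, 72, 78, 123, 126, 132, 366, 369, 375, 422, 428, 477, 483, 509, 645],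
  [148, 151, 157, 310, 313, 319, 366, 369, 377, 421, 427, 450, 458, 508, 620],
  [148, 151, 157, 229, 232, 238, 337, 340, 346, 368, 372, 449, 453, 481, 589],
  [67, 70, 76, 148, 151, 157, 365, 366, 372, 394, 400, 421, 427, 453, 589],
  [30, 31, 32, 67, 70, 76, 88, 103, 104, 115, 130, 131, 142, 148, 151, 158, 365, 366, 372, 394, 400,
  421, 427, 453, 589],
  [15, 18, 24, 69, 72, 78, 123, 126, 132, 366, 369, 375, 393, 396, 402],
  [0, 88, 89, 91, 92, 99, 100, 115, 118, 127, 128, 143, 146, 153, 155, 200, 213, 215, 226, 241, 242,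
  260, 263, 269, 287, 288, 294, 314, 316, 322, 511, 512, 537, 539, 564, 565],
  [114, 115, 116, 172, 187, 188, 199, 214, 215, 226, 241, 242],
  [179, 182, 188, 260, 263, 269, 477, 478, 506, 512, 533, 539],
  [176, 179, 185, 257, 260, 266, 396, 397, 477, 478, 509, 536],
  [57, 59, 64, 79, 80, 89, 102, 104, 143, 156, 158, 226, 241, 242, 291, 293, 592, 593, 646, 647],
  [232, 235, 241, 313, 316, 322, 450, 452, 505, 511, 533, 565],
  [148, 154, 157, 160, 229, 235, 238, 241, 366, 368, 424, 427, 430, 478, 481, 484],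
  [70, 73, 79, 151, 154, 160, 340, 343, 349, 449, 455, 478, 484, 536, 646],
  [70, 73, 79, 313, 316, 322, 340, 343, 349, 394, 397, 403, 456, 458, 537, 539, 673, 701],
  [4, 7, 17, 19, 25, 31, 34, 44, 46, 52, 58, 61, 70, 71, 232, 235, 241, 453, 455, 534, 536, 592,
  646],
  [4, 10, 25, 26, 31, 37, 52, 53, 58, 64, 79, 80],
  [60, 63, 70, 72, 79, 141, 144, 151, 153, 160, 174, 176, 255, 257, 340, 342, 349, 394, 396, 403],
  [61, 64, 70, 74, 79, 142, 145, 154, 155, 201, 203, 232, 235, 241, 282, 284, 343, 344, 394, 398,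
  403, 449, 453, 478, 484, 534, 592],
  [67, 70, 76, 310, 313, 319, 369, 371, 372, 374, 450, 452, 453, 455, 508, 562, 589, 617],
  [0, 89, 90, 91, 98, 99, 107, 123, 126, 132, 141, 144, 151, 153, 160, 171, 172, 186, 188, 225, 240,
  241, 259, 260, 285, 286, 430, 431, 456, 458, 483, 484],
  [0, 44, 47, 53, 58, 61, 70, 71, 95, 98, 104, 119, 120, 128, 131, 132, 200, 201, 203, 213, 215,
  311, 313, 320, 340, 341, 368, 371, 377, 394, 398, 402, 456, 458, 645, 647],
  [60, 61, 62, 173, 174, 176, 186, 188, 200, 201, 203, 213, 215, 227, 228, 230, 240, 242],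
  [60, 63, 72, 73, 87, 90, 99, 100, 114, 117, 126, 127, 174, 176, 255, 257, 342, 343, 396, 397],
  [0, 4, 7, 16, 17, 30, 34, 35, 42, 43, 88, 95, 98, 103, 115, 116, 120, 123, 130, 148, 151, 157,
  201, 203, 229, 230, 340, 341, 366, 368, 393, 394],
  [0, 15, 18, 24, 57, 60, 69, 70, 92, 95, 99, 102, 107, 120, 123, 129, 173, 174, 176, 186, 188, 309,
  313, 318, 340, 342, 350, 366, 369, 375, 393, 394, 456, 458, 591, 593],
  [0, 16, 19, 25, 30, 33, 42, 43, 91, 100, 101, 103, 104, 172, 175, 182, 185, 187, 229, 232, 238,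
  283, 285, 292, 370, 371, 424, 425, 427, 428, 453, 455, 534, 562, 592, 619],
  [17, 20, 26, 260, 263, 269, 341, 344, 350, 368, 371, 377, 483, 484, 564, 565, 674, 701],
  [5, 8, 15, 17, 32, 35, 42, 47, 53, 59, 62, 69, 74, 80, 179, 182, 188, 480, 481, 561, 562, 593,
  620],
  [0, 32, 33, 34, 42, 44, 58, 61, 70, 71, 95, 98, 104, 114, 115, 120, 123, 131, 142, 148, 151, 158,
  175, 176, 201, 202, 340, 341, 366, 368, 393, 394],
  [8, 11, 18, 20, 116, 119, 126, 128, 143, 146, 153, 155, 228, 229, 309, 310, 342, 344, 369, 371],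
  [0, 30, 31, 36, 37, 51, 53, 58, 64, 70, 73, 80, 91, 95, 100, 103, 107, 117, 120, 127, 130, 132,
  148, 151, 157, 256, 257, 282, 283, 340, 343, 350, 375, 377, 394, 397, 402],
  [0, 4, 6, 8, 16, 17, 30, 33, 42, 43, 87, 89, 95, 98, 103, 114, 120, 123, 130, 148, 151, 157, 174,
  176, 228, 229, 340, 341, 366, 368, 393, 394],
  [0, 4, 6, 8, 16, 17, 30, 33, 42, 43, 88, 95, 98, 103, 115, 116, 120, 123, 130, 141, 142, 143, 148,
  151, 157, 174, 176, 228, 229, 340, 341, 366, 368, 393, 394],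
  [0, 5, 8, 15, 17, 30, 31, 32, 58, 59, 60, 69, 70, 87, 89, 95, 98, 103, 114, 120, 123, 130, 148,
  151, 157, 174, 176, 228, 229, 340, 341, 366, 368, 393, 394],
  [0, 4, 7, 17, 19, 25, 30, 36, 51, 52, 70, 73, 79, 88, 95, 98, 103, 117, 120, 127, 130, 132, 148,
  151, 157, 201, 202, 256, 257, 340, 341, 368, 370, 375, 394, 397, 402],
  [0, 3, 4, 8, 15, 17, 57, 60, 69, 70, 87, 89, 95, 98, 103, 114, 120, 123, 130, 174, 176, 228, 232,
  238, 340, 341, 393, 394, 421, 427, 449, 481],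
  [0, 3, 4, 8, 15, 17, 57, 60, 67, 69, 76, 88, 95, 98, 103, 115, 116, 120, 123, 130, 141, 142, 143,
  174, 176, 228, 229, 337, 341, 346, 365, 366, 368, 393, 400],
  [30, 31, 32, 57, 58, 59, 90, 99, 100, 102, 103, 117, 126, 127, 129, 130, 144, 153, 154, 156, 157],
  [57, 58, 59, 92, 99, 101, 102, 104, 119, 126, 128, 129, 131, 146, 153, 155, 156, 158],
  [0, 4, 7, 16, 17, 30, 36, 43, 46, 51, 67, 70, 76, 88, 95, 98, 103, 117, 120, 127, 130, 132, 201,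
  202, 256, 257, 337, 341, 346, 365, 368, 370, 375, 397, 400, 402],
  [57, 63, 78, 79, 89, 95, 98, 102, 225, 240, 241, 257, 260, 264, 402, 403, 483, 484, 591, 592],
  [0, 30, 33, 42, 46, 52, 70, 73, 79, 91, 95, 100, 103, 107, 148, 151, 157, 172, 175, 176, 187, 188,
  283, 285, 292, 340, 343, 349, 366, 370, 377, 393, 394, 430, 431, 619, 620],
  [0, 8, 11, 17, 18, 26, 61, 62, 64, 65, 72, 73, 176, 179, 185, 200, 203, 207, 210, 215, 226, 230,
  235, 238, 242, 291, 293, 319, 320, 480, 481, 508, 509, 534, 536, 593, 620],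
  [0, 88, 91, 98, 100, 107, 115, 116, 118, 119, 123, 127, 132, 200, 213, 215, 226, 232, 235, 242,
  285, 287, 313, 314, 421, 424, 431, 449, 456, 458, 478, 483],
  [3, 9, 24, 25, 57, 63, 78, 79, 88, 103, 104, 198, 213, 214, 265, 266, 618, 619, 645, 646],
  [0, 89, 92, 98, 99, 107, 142, 143, 145, 146, 153, 154, 200, 204, 207, 215, 226, 232, 235, 242,
  285, 287, 313, 314, 422, 424, 431, 449, 450, 458, 477, 478],
  [0, 5, 8, 15, 17, 58, 59, 62, 64, 69, 74, 79, 95, 98, 104, 116, 120, 123, 131, 145, 148, 155, 158,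
  160, 229, 230, 282, 284, 341, 344, 349, 366, 368, 393, 398, 403],
  [31, 33, 34, 35, 37, 52, 53, 114, 116, 130, 131, 175, 176, 199, 202, 203, 214, 215, 229, 230, 292,
  293, 619, 620, 646, 647],
  [0, 4, 10, 14, 20, 23, 25, 31, 32, 37, 38, 51, 52, 119, 120, 128, 131, 132, 145, 148, 155, 158,
  160, 282, 284, 310, 311, 338, 344, 347, 349, 365, 371, 374, 375, 402, 403],
  [57, 58, 65, 78, 80, 89, 102, 104, 116, 129, 131, 227, 240, 242, 318, 320, 591, 593, 645, 647],
  [0, 87, 88, 90, 91, 99, 101, 141, 144, 151, 153, 160, 172, 179, 182, 187, 198, 204, 207, 214, 259,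
  260, 285, 286, 421, 425, 430, 449, 450, 452, 477, 484],
  [3, 4, 5, 90, 99, 100, 102, 103, 117, 126, 127, 129, 130, 144, 153, 154, 156, 157],
  [0, 17, 20, 26, 58, 61, 70, 74, 80, 95, 98, 104, 119, 120, 128, 131, 132, 200, 201, 203, 213, 215,
  311, 313, 320, 340, 341, 368, 371, 377, 394, 398, 402, 456, 458, 645, 647],
  [0, 5, 8, 15, 17, 57, 60, 69, 70, 89, 95, 98, 102, 141, 148, 151, 156, 174, 176, 201, 204, 210,
  228, 229, 366, 368, 393, 394, 421, 422, 453, 480],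
  [0, 5, 8, 15, 17, 57, 60, 69, 70, 89, 95, 98, 102, 141, 148, 151, 156, 174, 176, 228, 229, 282,
  285, 291, 340, 341, 349, 350, 366, 368, 393, 394, 430, 431, 592, 593],
  [0, 5, 8, 17, 18, 24, 57, 60, 70, 72, 78, 89, 102, 104, 141, 156, 157, 174, 179, 185, 201, 207,
  210, 213, 228, 232, 238, 453, 455, 480, 481, 508, 509, 618, 645]]

set_option maxRecDepth 100000 in
/-- A search tree excluding, by means of `checksThree`, sets of crossing pairs of small weight. -/
def refutationThree : Refutation :=
  .split 141 (.split 87 (.split 174 (.close [62, 3, 90, 35, 134]) (.close [6, 5, 47, 13, 63, 35,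
  64])) (.split 114 (.split 176 (.close [62, 36, 3, 135, 37]) (.close [6, 11, 91, 13, 18, 48, 64]))
  (.split 143 (.split 156 (.close [7, 3, 90, 92, 136]) (.split 102 (.close [7, 63, 65, 3, 137])
  (.split 129 (.close [7, 2, 18, 65, 48]) (.split 157 (.close [14, 7, 66, 38, 138]) (.split 103
  (.close [14, 7, 66, 63, 139]) (.split 130 (.close [140, 7, 66, 18, 48]) (.close [8, 8, 93, 93, 7,
  92, 141]))))))) (.split 142 (.split 157 (.close [7, 38, 3, 142, 143]) (.close [8, 8, 7, 24, 144,
  67, 37])) (.close [68, 6, 6, 62, 8, 8, 7, 37]))))) (.split 89 (.split 87 (.split 114 (.close [68,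
  18, 47, 91, 4, 94]) (.split 102 (.close [7, 3, 3, 145, 146]) (.close [8, 8, 7, 4, 147, 148, 19])))
  (.split 88 (.split 104 (.close [69, 15, 3, 3, 149]) (.close [49, 14, 4, 150, 25, 95, 19])) (.split
  143 (.split 228 (.close [28, 3, 3, 151, 152]) (.split 174 (.close [28, 47, 13, 3, 153]) (.close
  [5, 5, 28, 154, 155, 96, 70]))) (.split 116 (.split 229 (.close [28, 71, 3, 3, 156]) (.close [5,
  5, 28, 157, 158, 39, 70])) (.close [68, 69, 5, 5, 14, 14, 28, 70]))))) (.split 151 (.split 148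
  (.close [72, 26, 3, 159, 160, 97]) (.split 157 (.close [8, 72, 49, 9, 161, 37]) (.close [38, 1, 1,
  20, 50, 98, 162, 73]))) (.split 98 (.split 95 (.close [29, 26, 3, 51, 163, 73]) (.split 104
  (.close [14, 29, 49, 4, 74, 19]) (.close [15, 0, 0, 12, 50, 75, 99, 97]))) (.split 123 (.split 120
  (.split 132 (.close [26, 26, 40, 164, 165]) (.close [52, 76, 166, 167, 77, 168])) (.split 129
  (.split 102 (.close [52, 4, 18, 39]) (.split 156 (.close [52, 9, 65, 78]) (.close [8, 14, 52, 26,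
  169, 170]))) (.split 204 (.close [2, 2, 30, 79, 80, 171, 100]) (.split 421 (.close [41, 42, 53, 3,
  50, 101, 172]) (.split 422 (.split 431 (.close [31, 10, 173, 3, 174, 73]) (.split 425 (.close [31,
  10, 30, 79, 3, 175]) (.split 593 (.close [54, 10, 10, 21, 176]) (.split 350 (.split 477 (.close
  [32, 10, 10, 21]) (.split 483 (.close [32, 10, 10, 21]) (.close [54, 31, 31, 21, 3]))) (.close
  [55, 55, 54, 30, 21, 2, 2]))))) (.split 210 (.close [32, 2, 2, 30, 79, 177]) (.split 201 (.close
  [32, 102, 2, 2, 6, 5]) (.split 453 (.close [41, 42, 32, 178, 81, 179]) (.close [16, 16, 32, 2, 2,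
  30, 180, 181]))))))))) (.split 95 (.split 104 (.close [14, 49, 4, 74, 19]) (.split 185 (.close
  [15, 0, 0, 103, 182]) (.split 176 (.close [15, 0, 0, 6, 11]) (.split 179 (.close [15, 36, 36, 21,
  103, 183]) (.split 455 (.close [184, 15, 27, 104, 105]) (.close [12, 15, 0, 0, 56, 185, 186]))))))
  (.split 394 (.split 455 (.close [1, 1, 106, 187, 107]) (.split 449 (.split 452 (.split 232 (.close
  [43, 43, 82, 188]) (.close [83, 71, 1, 1, 108])) (.split 458 (.close [72, 1, 1, 108, 189]) (.close
  [84, 84, 190, 21, 1, 1]))) (.split 397 (.close [27, 27, 12, 56, 191]) (.split 403 (.close [27, 27,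
  12, 15, 192]) (.close [109, 27, 27, 12, 104, 85, 193]))))) (.split 148 (.close [1, 1, 110, 111,
  194, 35, 195]) (.split 368 (.split 481 (.close [0, 0, 112, 196, 51]) (.split 449 (.close [109, 12,
  0, 29, 197, 198]) (.split 374 (.close [20, 29, 199, 113, 200]) (.close [84, 114, 114, 0, 0, 201,
  111])))) (.split 340 (.split 453 (.close [1, 1, 82, 106, 202]) (.split 421 (.split 450 (.split 157
  (.close [38, 85, 8]) (.close [1, 1, 20, 82, 203])) (.close [53, 1, 1, 83, 204, 205])) (.close [41,
  42, 42, 16, 85, 44, 115]))) (.split 341 (.split 480 (.close [0, 0, 116, 112, 51]) (.split 422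
  (.close [54, 0, 0, 116, 206, 96]) (.close [55, 10, 10, 16, 29, 44, 115]))) (.split 120 (.split 129
  (.close [8, 14, 40, 99, 207]) (.split 453 (.close [42, 30, 208, 209, 105]) (.split 421 (.close
  [41, 53, 20, 210, 211, 212]) (.split 210 (.close [33, 33, 86, 213, 214]) (.split 201 (.close [33,
  33, 86, 6, 5]) (.split 204 (.close [102, 33, 33, 44, 215, 100]) (.split 480 (.close [117, 117,
  216, 217, 48]) (.split 422 (.close [31, 218, 86, 219, 220, 221]) (.close [16]))))))))) (.split 366
  (.split 427 (.close [2, 2, 80, 222, 50]) (.split 421 (.close [41, 16, 2, 45, 77, 87]) (.split 372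
  (.close [223, 224, 118, 113, 76]) (.close [20, 2, 2, 225, 53, 118, 226])))) (.split 393 (.split
  428 (.close [2, 2, 227, 80, 87]) (.split 422 (.close [55, 16, 2, 45, 77, 87]) (.close [10, 10, 31,
  12, 45, 56, 228]))) (.split 176 (.split 185 (.close [6, 11, 13, 88, 119]) (.split 179 (.split 188
  (.close [6, 229, 13, 9, 88]) (.split 182 (.close [6, 11, 13, 88, 119]) (.close [21, 120, 120, 230,
  6, 11]))) (.close [12, 36, 36, 231, 6, 56, 11]))) (.split 229 (.split 238 (.close [5, 11, 25, 121,
  122]) (.split 232 (.split 241 (.close [5, 11, 4, 25, 232]) (.split 235 (.close [5, 11, 25, 121,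
  122]) (.close [83, 233, 81, 81, 5, 11]))) (.close [20, 71, 43, 43, 5, 11, 234]))) (.split 70
  (.split 67 (.close [235, 17, 17, 236, 237]) (.split 76 (.split 79 (.close [17, 17, 238]) (.close
  [57, 57, 239, 240, 107])) (.close [1, 1, 57, 57, 43, 241, 242]))) (.split 174 (.split 201 (.close
  [16, 44, 13, 47, 67]) (.close [6, 5, 13, 98, 75, 243, 35])) (.split 228 (.split 201 (.close [16,
  44, 25, 67, 95]) (.close [6, 5, 25, 244, 75, 101, 35])) (.split 60 (.close [6, 123, 17, 13, 245,
  246, 64]) (.split 17 (.split 14 (.close [124, 124, 247, 51, 248]) (.close [0, 0, 29, 125, 125,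
  249, 250])) (.split 8 (.close [5, 123, 46, 25, 251, 252, 253]) (.split 15 (.split 42 (.close [2,
  2, 45, 126, 127]) (.close [58, 58, 128, 128, 254, 255, 40])) (.split 69 (.split 42 (.close [2, 2,
  45, 126, 127]) (.close [58, 58, 17, 17, 46, 46, 40])) (.split 57 (.split 30 (.split 158 (.close
  [4, 24, 59]) (.split 131 (.close [4, 129, 39]) (.split 104 (.close [0, 0, 12]) (.close [22, 60, 4,
  89, 19])))) (.close [17, 17, 22, 256, 4, 257, 19])) (.split 5 (.split 32 (.split 103 (.close [9,
  24, 59]) (.split 130 (.close [9, 24, 78]) (.close [258, 259, 9, 260, 94]))) (.split 59 (.close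
  [22, 34, 9, 261, 262]) (.close [23, 23, 46, 46, 130, 130, 40]))) (.split 102 (.split 103 (.split
  158 (.close [4, 24, 59]) (.split 131 (.close [4, 129, 39]) (.split 104 (.close [0, 0, 12]) (.close
  [22, 60, 4, 89, 19])))) (.split 130 (.close [22, 60, 263, 264, 265]) (.split 157 (.close [1, 1,
  20, 22, 38]) (.split 4 (.close [23, 23, 4, 18, 266]) (.split 3 (.close [23, 23, 4, 267, 268])
  (.split 114 (.split 116 (.close [69, 18, 4, 76, 39]) (.close [61, 7, 18, 4, 269, 270])) (.split 87
  (.close [61, 7, 4, 74, 19, 271]) (.close [34])))))))) (.split 156 (.split 158 (.split 103 (.close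
  [9, 24, 59]) (.split 130 (.close [9, 24, 78]) (.split 157 (.close [1, 1, 20]) (.close [34, 61, 9,
  89, 37])))) (.split 131 (.close [34, 61, 110, 131, 132]) (.split 104 (.close [0, 0, 12, 34, 15])
  (.split 58 (.close [23, 23, 9, 272, 273]) (.close [22, 60, 9, 274, 275, 131, 132]))))) (.close
  [26, 26, 133, 133, 22, 34, 276, 277, 278]))))))))))))))))))))))))))))

set_option maxRecDepth 100000 in
/-- Sets of pairs of template edges, for cycles on four vertices, whose crossing parities add up to
zero whatever the drawing; the code `0` stands for the constant one. -/
def checksFour : List (List ℕ) := [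
  [0, 79, 83, 92, 95, 114, 118, 130, 131, 163, 167, 175, 199, 203, 211, 227, 232, 236, 247, 262,
  270, 274, 283, 376, 379, 414, 415, 598, 599, 668, 671, 704, 706],
  [0, 42, 46, 58, 59, 77, 81, 93, 94, 190, 210, 211, 225, 245, 246, 306, 310, 318, 342, 347, 355,
  378, 381, 389, 414, 418, 426, 786, 787, 821, 823, 857, 858],
  [0, 79, 83, 92, 95, 114, 118, 130, 131, 227, 244, 247, 262, 282, 283, 307, 311, 319, 343, 347,
  355, 379, 380, 388, 415, 418, 426, 750, 751, 820, 823, 856, 858],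
  [40, 41, 42, 43, 153, 173, 174, 189, 209, 210, 225, 245, 246, 261, 281, 282],
  [0, 155, 159, 168, 171, 260, 264, 276, 277, 303, 311, 315, 320, 344, 348, 356, 380, 384, 392, 408,
  417, 421, 428, 452, 455, 560, 561, 745, 747, 780, 783, 852, 853],
  [0, 7, 11, 19, 20, 31, 52, 56, 64, 88, 92, 100, 112, 116, 125, 128, 137, 155, 172, 175, 260, 280,
  281, 304, 307, 412, 413, 605, 607, 640, 643, 712, 713],
  [44, 48, 60, 61, 188, 192, 204, 205, 305, 306, 449, 450, 636, 637, 672, 673],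
  [8, 9, 10, 11, 152, 153, 154, 155, 304, 305, 340, 341, 376, 377, 412, 413],
  [80, 81, 82, 83, 224, 225, 226, 227, 306, 307, 342, 343, 378, 379, 414, 415],
  [44, 45, 46, 47, 188, 189, 190, 191, 305, 306, 341, 342, 377, 378, 413, 414],
  [0, 5, 9, 18, 21, 30, 40, 44, 52, 57, 64, 89, 93, 101, 125, 129, 137, 153, 173, 174, 188, 208,
  209, 305, 306, 340, 341, 605, 606, 640, 642, 676, 677],
  [40, 48, 68, 69, 153, 173, 174, 336, 356, 357, 461, 462, 1076, 1077, 1112, 1113],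
  [0, 7, 11, 20, 23, 112, 116, 128, 129, 155, 163, 167, 172, 196, 200, 208, 232, 236, 244, 260, 269,
  273, 280, 304, 307, 412, 413, 597, 599, 632, 635, 704, 705],
  [116, 117, 118, 119, 260, 261, 262, 263, 304, 307, 340, 343, 376, 379, 412, 415],
  [152, 153, 154, 155, 188, 189, 190, 191, 224, 225, 226, 227, 260, 261, 262, 263],
  [4, 5, 6, 7, 152, 172, 173, 188, 208, 209, 224, 244, 245, 260, 280, 281],
  [0, 166, 170, 178, 190, 194, 203, 206, 215, 225, 229, 237, 242, 249, 274, 278, 286, 338, 358, 359,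
  373, 393, 394, 490, 491, 525, 526, 790, 791, 825, 827, 861, 862],
  [0, 190, 194, 206, 207, 225, 229, 241, 242, 310, 314, 322, 338, 347, 351, 358, 373, 381, 385, 394,
  418, 422, 430, 490, 491, 525, 526, 782, 783, 817, 819, 853, 854],
  [9, 13, 25, 26, 153, 157, 169, 170, 340, 341, 484, 485, 601, 602, 637, 638],
  [0, 42, 46, 58, 59, 77, 81, 93, 94, 162, 166, 174, 190, 199, 203, 210, 225, 233, 237, 246, 270,
  274, 282, 342, 343, 377, 378, 634, 635, 669, 671, 705, 706],
  [0, 153, 157, 169, 170, 188, 192, 204, 205, 301, 321, 322, 336, 356, 357, 453, 458, 466, 489, 492,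
  500, 525, 529, 537, 561, 565, 573, 897, 898, 932, 934, 968, 969],
  [0, 5, 9, 21, 22, 40, 44, 56, 57, 153, 173, 174, 188, 208, 209, 305, 310, 318, 341, 344, 352, 377,
  381, 389, 413, 417, 425, 749, 750, 784, 786, 820, 821],
  [79, 87, 104, 107, 262, 282, 283, 375, 392, 395, 570, 571, 1112, 1115, 1148, 1151],
  [11, 15, 24, 27, 155, 159, 168, 171, 412, 413, 556, 557, 600, 603, 636, 639],
  [0, 155, 159, 167, 168, 179, 200, 204, 212, 236, 240, 248, 260, 264, 273, 276, 285, 303, 320, 323,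
  408, 428, 429, 452, 455, 560, 561, 753, 755, 788, 791, 860, 861],
  [81, 85, 97, 98, 225, 229, 241, 242, 342, 343, 486, 487, 673, 674, 709, 710],
  [42, 50, 70, 71, 225, 245, 246, 338, 358, 359, 533, 534, 1078, 1079, 1114, 1115],
  [0, 19, 23, 31, 55, 59, 67, 79, 83, 88, 95, 100, 114, 118, 126, 131, 138, 227, 244, 247, 262, 282,
  283, 376, 379, 414, 415, 606, 607, 676, 679, 712, 714],
  [5, 13, 33, 34, 188, 208, 209, 301, 321, 322, 496, 497, 1041, 1042, 1077, 1078],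
  [0, 7, 11, 20, 23, 112, 116, 128, 129, 155, 172, 175, 260, 280, 281, 304, 311, 319, 340, 344, 352,
  376, 380, 388, 412, 417, 425, 749, 751, 784, 787, 856, 857],
  [162, 166, 174, 306, 310, 318, 668, 669, 742, 750, 778, 786],
  [112, 113, 114, 115, 155, 172, 175, 191, 208, 211, 227, 244, 247, 263, 280, 283],
  [116, 120, 132, 133, 260, 264, 276, 277, 304, 307, 448, 451, 600, 601, 708, 709],
  [7, 15, 32, 35, 260, 280, 281, 303, 320, 323, 568, 569, 1040, 1043, 1076, 1079],
  [118, 122, 134, 135, 262, 266, 278, 279, 376, 379, 520, 523, 602, 603, 710, 711],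
  [46, 50, 62, 63, 190, 194, 206, 207, 377, 378, 521, 522, 638, 639, 674, 675],
  [112, 120, 140, 141, 155, 172, 175, 408, 428, 429, 460, 463, 1040, 1041, 1148, 1149],
  [196, 200, 208, 340, 344, 352, 597, 598, 741, 742, 784, 820],
  [18, 22, 30, 162, 166, 174, 594, 598, 606, 630, 634, 642],
  [0, 227, 231, 240, 243, 262, 266, 278, 279, 311, 315, 323, 347, 351, 359, 375, 380, 384, 395, 410,
  418, 422, 431, 524, 527, 562, 563, 746, 747, 816, 819, 852, 854],
  [114, 122, 142, 143, 227, 244, 247, 410, 430, 431, 532, 535, 1042, 1043, 1150, 1151],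
  [77, 85, 105, 106, 190, 210, 211, 373, 393, 394, 498, 499, 1113, 1114, 1149, 1150],
  [0, 18, 22, 30, 42, 46, 55, 58, 67, 77, 81, 89, 94, 101, 126, 130, 138, 190, 210, 211, 225, 245,
  246, 342, 343, 377, 378, 642, 643, 677, 679, 713, 714],
  [0, 5, 9, 21, 22, 40, 44, 56, 57, 153, 162, 166, 173, 188, 196, 200, 209, 233, 237, 245, 269, 273,
  281, 305, 306, 340, 341, 597, 598, 632, 634, 668, 669],
  [0, 153, 157, 166, 169, 178, 188, 192, 200, 205, 212, 237, 241, 249, 273, 277, 285, 301, 321, 322,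
  336, 356, 357, 453, 454, 488, 489, 753, 754, 788, 790, 824, 825],
  [4, 8, 20, 21, 40, 44, 56, 57, 76, 80, 92, 93, 112, 116, 128, 129],
  [0, 227, 231, 240, 243, 262, 266, 278, 279, 375, 392, 395, 410, 430, 431, 455, 459, 467, 491, 495,
  503, 527, 528, 536, 563, 566, 574, 898, 899, 968, 971, 1004, 1006],
  [0, 155, 159, 168, 171, 260, 264, 276, 277, 303, 320, 323, 408, 428, 429, 452, 459, 467, 488, 492,
  500, 524, 528, 536, 560, 565, 573, 897, 899, 932, 935, 1004, 1005],
  [76, 77, 78, 79, 154, 174, 175, 190, 210, 211, 226, 246, 247, 262, 282, 283],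
  [188, 189, 190, 191, 301, 321, 322, 337, 357, 358, 373, 393, 394, 409, 429, 430],
  [187, 191, 200, 203, 261, 273, 274, 335, 344, 347, 417, 418, 741, 742, 779, 815],
  [594, 598, 606, 668, 676, 742, 750, 820, 1038],
  [0, 167, 171, 179, 203, 207, 215, 227, 231, 236, 243, 248, 262, 266, 274, 279, 286, 375, 392, 395,
  410, 430, 431, 524, 527, 562, 563, 754, 755, 824, 827, 860, 862],
  [0, 42, 50, 58, 62, 71, 77, 85, 94, 98, 105, 194, 199, 206, 210, 215, 229, 233, 242, 246, 249,
  487, 490, 498, 521, 526, 534, 634, 638, 647, 706, 710, 717, 825, 827, 1113, 1115],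
  [0, 79, 87, 95, 99, 104, 114, 122, 131, 135, 142, 231, 232, 243, 247, 248, 266, 270, 279, 283,
  286, 520, 527, 535, 558, 563, 571, 599, 603, 610, 671, 675, 680, 860, 862, 1148, 1150],
  [125, 129, 137, 269, 273, 281, 593, 597, 605, 631, 705, 713],
  [18, 22, 30, 306, 310, 318, 676, 677, 820, 821, 1038, 1074],
  [0, 153, 157, 169, 170, 188, 192, 204, 205, 301, 310, 314, 321, 336, 344, 348, 357, 381, 385, 393,
  417, 421, 429, 453, 454, 488, 489, 745, 746, 780, 782, 816, 817],
  [52, 56, 64, 196, 200, 208, 593, 594, 632, 640, 668, 676],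
  [83, 87, 96, 99, 227, 231, 240, 243, 414, 415, 558, 559, 672, 675, 708, 711],
  [0, 190, 194, 206, 207, 225, 229, 241, 242, 338, 358, 359, 373, 393, 394, 454, 458, 466, 490, 495,
  503, 526, 529, 537, 562, 566, 574, 934, 935, 969, 971, 1005, 1006],
  [0, 7, 11, 20, 23, 112, 116, 128, 129, 155, 172, 175, 260, 269, 273, 280, 304, 311, 319, 340, 344,
  352, 376, 380, 388, 412, 413, 632, 635, 741, 751, 779, 784, 787, 856],
  [233, 237, 245, 377, 381, 389, 634, 635, 778, 779, 821, 857],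
  [22, 26, 34, 310, 314, 322, 820, 821, 964, 965, 1042, 1078],
  [56, 60, 68, 344, 348, 356, 749, 750, 893, 894, 1076, 1112],
  [76, 80, 92, 93, 154, 174, 175, 298, 318, 319, 380, 381, 750, 751, 786, 787],
  [113, 117, 129, 130, 187, 196, 199, 261, 273, 274, 340, 343, 597, 598, 705, 706],
  [150, 154, 166, 167, 224, 236, 237, 298, 310, 311, 380, 381, 742, 743, 778, 779],
  [0, 118, 122, 134, 135, 227, 231, 240, 243, 375, 379, 384, 388, 395, 410, 418, 422, 431, 451, 459,
  463, 467, 487, 495, 499, 503, 532, 535, 559, 562, 571, 710, 711, 816, 819, 891, 899, 963, 964,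
  971, 1000],
  [8, 9, 10, 11, 44, 45, 46, 47, 80, 81, 82, 83, 116, 117, 118, 119],
  [4, 12, 32, 33, 152, 172, 173, 300, 320, 321, 460, 461, 1040, 1041, 1076, 1077],
  [7, 15, 32, 35, 43, 51, 68, 71, 79, 87, 104, 107, 115, 123, 140, 143],
  [21, 25, 33, 57, 61, 69, 93, 97, 105, 129, 133, 141],
  [89, 93, 101, 233, 237, 245, 630, 631, 669, 677, 705, 713],
  [0, 7, 15, 20, 24, 35, 112, 120, 128, 132, 141, 159, 163, 168, 172, 179, 264, 269, 276, 280, 285,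
  451, 452, 460, 557, 560, 568, 632, 636, 647, 704, 708, 717, 753, 755, 1041, 1043],
  [0, 79, 83, 92, 95, 131, 135, 143, 266, 278, 279, 282, 283, 410, 415, 422, 426, 431, 524, 527,
  559, 563, 571, 708, 711, 746, 747, 750, 751, 852, 854, 856, 858, 895, 1000, 1043, 1151],
  [0, 5, 9, 21, 22, 40, 44, 56, 57, 153, 162, 166, 173, 188, 208, 209, 305, 306, 341, 344, 352, 377,
  381, 389, 413, 417, 425, 668, 669, 742, 749, 778, 784, 820, 821],
  [0, 46, 50, 58, 63, 70, 81, 85, 94, 97, 106, 338, 342, 351, 355, 358, 373, 378, 385, 389, 394,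
  486, 490, 499, 522, 526, 533, 673, 675, 817, 819, 821, 823, 931, 1001, 1078, 1150],
  [0, 5, 9, 18, 21, 30, 40, 44, 56, 57, 153, 173, 174, 188, 208, 209, 305, 306, 341, 344, 352, 377,
  381, 389, 413, 417, 425, 676, 677, 749, 750, 784, 786, 1038, 1074],
  [0, 5, 13, 21, 25, 34, 40, 48, 57, 61, 68, 157, 162, 169, 173, 178, 192, 196, 205, 209, 212, 450,
  453, 461, 484, 489, 497, 597, 601, 610, 669, 673, 680, 788, 790, 1076, 1078],
  [43, 47, 56, 59, 261, 281, 282, 335, 344, 347, 425, 426, 749, 750, 857, 858],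
  [76, 80, 92, 93, 150, 162, 163, 224, 236, 237, 306, 307, 668, 669, 704, 705],
  [0, 4, 5, 8, 9, 20, 22, 112, 116, 125, 128, 137, 150, 153, 163, 166, 173, 188, 196, 200, 209, 224,
  233, 236, 245, 305, 307, 340, 341, 593, 598, 605, 631, 632, 634, 704, 713],
  [598, 602, 610, 742, 746, 754, 820, 964, 1042],
  [0, 42, 46, 58, 59, 77, 81, 93, 94, 190, 199, 203, 210, 225, 245, 246, 306, 310, 318, 342, 343,
  378, 381, 389, 414, 418, 426, 705, 706, 779, 786, 815, 821, 857, 858],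
  [4, 12, 32, 33, 40, 48, 68, 69, 76, 84, 104, 105, 112, 120, 140, 141],
  [0, 7, 11, 20, 23, 112, 116, 128, 129, 155, 163, 167, 172, 196, 200, 208, 232, 236, 244, 260, 280,
  281, 304, 307, 412, 417, 425, 597, 599, 704, 705, 741, 749, 779, 857],
  [5, 9, 21, 22, 41, 45, 57, 58, 77, 81, 93, 94, 113, 117, 129, 130],
  [0, 5, 9, 18, 21, 30, 40, 44, 52, 57, 64, 89, 93, 101, 125, 129, 137, 153, 173, 174, 188, 208,
  209, 305, 306, 340, 341, 594, 598, 605, 640, 642, 668, 677, 742, 750, 820, 1038],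
  [0, 20, 24, 32, 112, 116, 128, 129, 159, 163, 168, 172, 179, 303, 304, 307, 320, 323, 448, 452,
  460, 560, 561, 597, 600, 609, 632, 636, 644, 704, 705, 753, 755, 788, 791, 1040, 1041],
  [0, 79, 83, 92, 95, 114, 118, 126, 131, 138, 227, 244, 247, 262, 282, 283, 307, 311, 319, 343,
  347, 355, 379, 380, 388, 414, 415, 676, 679, 750, 751, 856, 858, 1038, 1111],
  [0, 42, 46, 58, 59, 77, 81, 93, 94, 190, 210, 211, 225, 233, 237, 246, 306, 310, 318, 342, 347,
  355, 377, 378, 414, 418, 426, 634, 635, 778, 779, 786, 787, 823, 858],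
  [0, 40, 41, 43, 46, 58, 59, 77, 81, 93, 94, 153, 162, 166, 173, 189, 190, 209, 211, 261, 270, 274,
  281, 342, 347, 355, 378, 381, 389, 669, 671, 778, 787, 815, 821, 823, 857],
  [0, 11, 15, 20, 27, 32, 116, 120, 128, 133, 140, 303, 304, 315, 319, 320, 408, 412, 421, 425, 428,
  448, 452, 463, 556, 560, 569, 601, 603, 745, 747, 749, 751, 931, 1001, 1076, 1148],
  [155, 159, 168, 171, 191, 195, 204, 207, 227, 231, 240, 243, 263, 267, 276, 279],
  [0, 190, 194, 206, 207, 225, 229, 241, 242, 338, 347, 351, 358, 373, 381, 385, 394, 454, 458, 466,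
  490, 491, 525, 526, 562, 566, 574, 782, 783, 853, 854, 926, 934, 963, 1006],
  [152, 156, 168, 169, 188, 192, 204, 205, 224, 228, 240, 241, 260, 264, 276, 277],
  [83, 87, 92, 99, 104, 227, 231, 236, 243, 248, 414, 415, 558, 559, 668, 675, 680, 704, 711, 716],
  [0, 5, 9, 21, 22, 40, 44, 52, 57, 64, 89, 93, 101, 125, 129, 137, 153, 173, 174, 188, 208, 209,
  305, 310, 318, 340, 341, 605, 606, 640, 642, 820, 821, 1038, 1074],
  [112, 120, 129, 133, 140, 155, 172, 175, 408, 417, 421, 428, 460, 463, 784, 787, 928, 931, 1040,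
  1148],
  [414, 418, 426, 558, 562, 570, 672, 675, 816, 819, 894, 1002],
  [0, 227, 231, 240, 243, 262, 266, 278, 279, 375, 392, 395, 410, 430, 431, 455, 459, 467, 491, 495,
  503, 527, 528, 536, 563, 566, 574, 742, 746, 754, 816, 824, 890, 899, 971, 1004, 1006, 1186],
  [81, 85, 97, 98, 225, 229, 241, 242, 342, 347, 355, 486, 491, 499, 673, 674, 853, 854, 931, 967],
  [46, 50, 59, 62, 71, 190, 194, 203, 206, 215, 377, 378, 521, 522, 635, 638, 647, 671, 674, 683],
  [93, 97, 105, 381, 385, 393, 786, 787, 930, 931, 1113, 1149],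
  [377, 381, 389, 521, 525, 533, 638, 639, 782, 783, 965, 1001],
  [340, 344, 352, 484, 488, 496, 601, 602, 745, 746, 928, 964],
  [270, 274, 282, 414, 418, 426, 668, 671, 742, 750, 815, 858],
  [113, 117, 129, 130, 191, 208, 211, 335, 352, 355, 417, 418, 784, 787, 820, 823],
  [0, 5, 9, 18, 21, 30, 41, 42, 45, 46, 57, 59, 187, 190, 196, 203, 210, 225, 233, 237, 246, 261,
  270, 273, 282, 340, 342, 377, 378, 594, 597, 606, 630, 635, 642, 669, 671],
  [0, 95, 99, 107, 114, 118, 130, 131, 231, 232, 243, 247, 248, 375, 376, 379, 392, 395, 523, 527,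
  535, 562, 563, 598, 599, 710, 711, 819, 823, 824, 854, 858, 860, 967, 1002, 1115, 1151],
  [343, 347, 355, 487, 491, 499, 709, 710, 853, 854, 931, 967],
  [55, 59, 67, 343, 347, 355, 713, 714, 857, 858, 1075, 1111],
  [125, 129, 137, 413, 417, 425, 640, 643, 784, 787, 1037, 1075],
  [0, 155, 159, 168, 171, 260, 264, 276, 277, 303, 320, 323, 408, 428, 429, 448, 459, 460, 467, 484,
  492, 496, 500, 520, 528, 532, 536, 556, 565, 568, 573, 897, 899, 932, 935, 1004, 1005],
  [232, 236, 244, 376, 380, 388, 598, 599, 742, 743, 820, 856],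
  [0, 5, 9, 21, 22, 40, 44, 56, 57, 153, 162, 166, 173, 188, 196, 200, 209, 305, 306, 340, 341, 377,
  381, 389, 413, 417, 425, 597, 598, 668, 669, 741, 749, 778, 821],
  [6, 10, 22, 23, 224, 244, 245, 298, 310, 311, 388, 389, 820, 821, 856, 857],
  [233, 237, 245, 521, 525, 533, 646, 647, 790, 791, 1078, 1079],
  [269, 273, 281, 413, 417, 425, 632, 635, 741, 749, 779, 857],
  [56, 60, 68, 200, 204, 212, 632, 636, 644, 668, 672, 680],
  [0, 7, 11, 20, 23, 112, 116, 125, 128, 137, 155, 172, 175, 260, 280, 281, 304, 311, 319, 340, 344,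
  352, 376, 380, 388, 412, 413, 640, 643, 749, 751, 856, 857, 1037, 1075],
  [0, 42, 46, 55, 58, 67, 77, 81, 93, 94, 190, 210, 211, 225, 233, 237, 246, 306, 310, 318, 342,
  343, 377, 378, 414, 418, 426, 631, 634, 643, 705, 714, 778, 786, 823, 1111],
  [668, 672, 680, 742, 750, 816, 824, 894, 1112],
  [631, 635, 643, 705, 713, 779, 787, 857, 1075],
  [232, 236, 244, 376, 380, 388, 595, 598, 607, 704, 712, 742, 751, 820, 1039],
  [92, 96, 104, 236, 240, 248, 668, 672, 680, 704, 708, 716],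
  [0, 42, 46, 58, 59, 77, 81, 93, 94, 162, 166, 174, 190, 210, 211, 225, 233, 237, 246, 342, 347,
  355, 377, 378, 414, 418, 426, 634, 635, 668, 669, 742, 750, 779, 787, 823, 858],
  [0, 5, 9, 18, 21, 30, 40, 44, 52, 57, 64, 153, 162, 166, 173, 188, 196, 200, 209, 233, 237, 245,
  269, 273, 281, 305, 310, 318, 341, 344, 352, 593, 594, 634, 640, 669, 677, 741, 742, 784, 821,
  1038, 1074],
  [126, 130, 138, 270, 274, 282, 594, 598, 606, 667, 706, 714],
  [130, 134, 142, 274, 278, 286, 598, 602, 610, 706, 710, 718],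
  [55, 59, 67, 199, 203, 211, 631, 635, 643, 667, 671, 679],
  [0, 79, 83, 92, 95, 114, 118, 130, 131, 227, 232, 236, 247, 262, 282, 283, 307, 311, 319, 343,
  347, 355, 376, 379, 415, 418, 426, 598, 599, 742, 743, 750, 751, 823, 858],
  [0, 42, 46, 58, 59, 77, 81, 93, 94, 190, 199, 203, 210, 225, 245, 246, 270, 274, 282, 306, 310,
  318, 342, 343, 378, 381, 389, 668, 671, 705, 706, 742, 750, 779, 786, 821, 857],
  [12, 13, 14, 15, 300, 301, 302, 303, 460, 461, 496, 497, 532, 533, 568, 569],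
  [0, 79, 83, 92, 95, 114, 118, 130, 131, 227, 244, 247, 262, 270, 274, 283, 307, 311, 319, 343,
  347, 355, 379, 380, 388, 414, 415, 668, 671, 742, 751, 815, 820, 823, 856],
  [0, 155, 159, 167, 168, 179, 187, 195, 200, 204, 215, 262, 263, 264, 274, 276, 285, 375, 380, 384,
  395, 408, 411, 429, 431, 452, 455, 560, 562, 742, 743, 753, 755, 816, 827, 852, 861],
  [0, 5, 9, 21, 22, 41, 42, 45, 46, 57, 59, 162, 166, 174, 190, 191, 208, 210, 225, 233, 237, 246,
  335, 342, 347, 352, 377, 378, 414, 417, 426, 634, 635, 668, 669, 742, 750, 779, 784, 820, 858],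
  [0, 7, 11, 20, 23, 112, 116, 128, 129, 155, 163, 167, 172, 232, 236, 244, 260, 280, 281, 304, 307,
  340, 344, 352, 412, 417, 425, 598, 599, 704, 705, 742, 749, 779, 784, 820, 857],
  [5, 13, 33, 34, 41, 49, 69, 70, 77, 85, 105, 106, 113, 121, 141, 142],
  [0, 79, 83, 92, 95, 114, 118, 130, 131, 163, 167, 175, 199, 203, 211, 227, 232, 236, 247, 262,
  282, 283, 376, 379, 415, 418, 426, 598, 599, 704, 706, 742, 750, 815, 858],
  [0, 79, 87, 95, 99, 104, 114, 122, 131, 135, 142, 163, 167, 175, 199, 203, 211, 231, 232, 243,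
  247, 248, 266, 270, 279, 283, 286, 520, 523, 558, 559, 599, 603, 610, 671, 675, 680, 716, 718],
  [0, 190, 194, 203, 206, 215, 225, 229, 237, 242, 249, 310, 314, 322, 338, 358, 359, 373, 393, 394,
  418, 422, 430, 490, 491, 525, 526, 778, 782, 791, 815, 825, 827, 854, 861],
  [0, 40, 41, 44, 45, 56, 58, 77, 81, 89, 94, 101, 153, 173, 174, 187, 188, 199, 200, 209, 261, 269,
  274, 281, 305, 310, 318, 341, 343, 631, 632, 642, 706, 713, 742, 750, 821, 1074],
  [0, 40, 41, 44, 45, 56, 58, 77, 81, 89, 94, 101, 153, 162, 166, 173, 188, 191, 209, 211, 305, 306,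
  335, 341, 344, 355, 413, 418, 425, 630, 634, 643, 668, 677, 742, 749, 823, 1075],
  [0, 4, 5, 8, 9, 20, 22, 112, 116, 125, 128, 137, 153, 154, 173, 175, 188, 208, 209, 298, 305, 310,
  319, 341, 344, 352, 377, 380, 389, 640, 643, 749, 751, 820, 821, 1037, 1075],
  [196, 200, 208, 340, 344, 352, 593, 598, 605, 632, 640, 742, 749, 820, 1037],
  [0, 5, 9, 21, 22, 40, 44, 56, 57, 89, 93, 101, 125, 129, 137, 153, 162, 166, 173, 188, 196, 200,
  209, 305, 306, 340, 341, 593, 598, 605, 630, 632, 634, 668, 677],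
  [21, 25, 33, 57, 61, 69, 237, 241, 249, 273, 277, 285, 597, 601, 609, 669, 673, 681],
  [21, 25, 33, 57, 61, 69, 381, 385, 393, 417, 421, 429, 784, 786, 928, 930, 1041, 1113],
  [669, 673, 681, 782, 786, 790, 926, 930, 934, 969, 1113, 1222],
  [150, 154, 162, 167, 174, 224, 236, 237, 298, 306, 311, 318, 380, 381, 668, 669, 743, 750, 779,
  786],
  [0, 42, 46, 58, 59, 77, 81, 93, 94, 162, 166, 174, 190, 210, 211, 225, 245, 246, 342, 347, 355,
  378, 381, 389, 414, 418, 426, 668, 669, 742, 750, 778, 787, 821, 823, 857, 858],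
  [269, 273, 281, 413, 417, 425, 593, 597, 605, 635, 640, 779, 784, 857, 1037],
  [118, 122, 134, 135, 262, 266, 278, 279, 379, 380, 388, 523, 524, 532, 710, 711, 746, 747, 964,
  1000],
  [0, 58, 62, 70, 77, 81, 93, 94, 194, 206, 207, 210, 211, 338, 342, 351, 355, 358, 486, 490, 498,
  525, 526, 673, 674, 782, 783, 786, 787, 817, 819, 821, 823, 930, 965, 1078, 1114],
  [0, 21, 25, 33, 40, 44, 56, 57, 157, 162, 169, 173, 178, 301, 305, 306, 321, 322, 449, 453, 461,
  488, 489, 636, 637, 668, 669, 745, 749, 754, 780, 784, 790, 893, 928, 1041, 1077],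
  [0, 7, 15, 20, 24, 35, 112, 120, 128, 132, 141, 159, 163, 168, 172, 179, 196, 200, 208, 232, 236,
  244, 264, 269, 276, 280, 285, 448, 451, 556, 557, 609, 611, 632, 636, 647, 704, 708, 717],
  [0, 42, 46, 59, 62, 70, 229, 233, 242, 246, 249, 373, 377, 378, 393, 394, 450, 458, 462, 466, 486,
  491, 498, 558, 566, 570, 574, 635, 638, 646, 674, 675, 854, 858, 861, 963, 969, 1002, 1006, 1114,
  1222],
  [0, 42, 46, 58, 59, 94, 98, 106, 229, 241, 242, 245, 246, 373, 378, 385, 389, 394, 490, 491, 522,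
  526, 534, 671, 674, 683, 706, 710, 718, 817, 821, 827, 853, 857, 862, 1114, 1115],
  [0, 7, 11, 20, 23, 128, 132, 140, 196, 200, 208, 232, 236, 244, 264, 269, 276, 280, 285, 408, 412,
  413, 428, 429, 448, 455, 460, 599, 600, 609, 632, 635, 704, 708, 716, 860, 861, 1040, 1041],
  [0, 18, 26, 30, 34, 77, 81, 93, 98, 106, 126, 134, 138, 142, 194, 206, 207, 210, 211, 338, 342,
  351, 355, 358, 522, 525, 534, 630, 638, 642, 646, 669, 674, 675, 679, 783, 787, 790, 1002, 1111,
  1114],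
  [0, 7, 11, 19, 20, 31, 52, 56, 64, 88, 92, 100, 128, 132, 140, 264, 276, 277, 280, 281, 408, 412,
  421, 425, 428, 448, 451, 460, 463, 600, 601, 605, 607, 708, 709, 712, 713, 928, 931, 1037, 1040,
  1075, 1148],
  [112, 120, 140, 141, 155, 163, 167, 172, 408, 428, 429, 451, 455, 460, 716, 717, 860, 861, 1040,
  1041],
  [9, 13, 25, 26, 153, 157, 169, 170, 341, 344, 352, 485, 488, 496, 637, 638, 745, 746, 928, 964],
  [0, 18, 22, 30, 42, 46, 58, 59, 77, 81, 93, 94, 126, 130, 138, 190, 199, 203, 210, 225, 233, 237,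
  246, 342, 343, 377, 378, 630, 635, 642, 667, 669, 671, 705, 714],
  [0, 225, 226, 229, 230, 241, 243, 262, 266, 274, 279, 286, 338, 358, 359, 372, 373, 392, 394, 446,
  454, 459, 466, 490, 495, 503, 526, 529, 536, 824, 827, 934, 935, 1004, 1006, 1186, 1259],
  [0, 83, 87, 95, 96, 107, 118, 122, 131, 134, 143, 375, 379, 384, 388, 395, 410, 415, 422, 426,
  431, 523, 527, 532, 559, 563, 570, 708, 710, 852, 854, 856, 858, 894, 964, 1043, 1115],
  [154, 158, 170, 171, 190, 194, 206, 207, 226, 230, 242, 243, 262, 266, 278, 279],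
  [9, 13, 22, 25, 34, 153, 157, 166, 169, 178, 340, 341, 484, 485, 598, 601, 610, 634, 637, 646],
  [0, 7, 11, 19, 24, 31, 32, 52, 60, 64, 68, 88, 96, 100, 104, 112, 116, 125, 132, 137, 140, 155,
  172, 175, 260, 280, 281, 304, 307, 412, 413, 605, 607, 640, 643, 712, 713],
  [0, 11, 15, 20, 27, 32, 116, 120, 128, 133, 140, 303, 304, 315, 319, 320, 408, 412, 421, 425, 428,
  460, 463, 484, 488, 496, 520, 524, 532, 568, 569, 601, 603, 745, 747, 749, 751, 931, 1001, 1076,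
  1148],
  [0, 7, 11, 19, 20, 31, 39, 43, 55, 56, 64, 112, 118, 119, 125, 128, 138, 155, 172, 175, 262, 263,
  280, 282, 379, 380, 388, 413, 415, 640, 643, 712, 714, 750, 751, 1038, 1039],
  [0, 7, 11, 19, 20, 31, 112, 116, 125, 128, 137, 155, 172, 175, 260, 280, 281, 304, 307, 340, 344,
  352, 376, 380, 388, 412, 413, 640, 643, 712, 713, 749, 751, 1037, 1039],
  [0, 7, 11, 20, 23, 52, 56, 64, 88, 92, 100, 112, 116, 128, 129, 155, 172, 175, 260, 280, 281, 304,
  311, 319, 412, 417, 425, 605, 607, 784, 787, 856, 857, 1037, 1039],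
  [0, 18, 22, 30, 42, 46, 55, 58, 67, 81, 85, 94, 97, 106, 126, 130, 138, 225, 245, 246, 342, 343,
  373, 378, 385, 389, 394, 498, 499, 677, 679, 713, 714, 930, 931, 1074, 1075, 1114, 1150],
  [0, 95, 99, 107, 114, 118, 130, 131, 163, 167, 175, 199, 203, 211, 231, 232, 243, 247, 248, 375,
  376, 379, 392, 395, 559, 562, 571, 598, 599, 706, 711, 716, 815, 819, 824, 858, 1002, 1115, 1148,
  1151],
  [0, 7, 8, 9, 10, 20, 23, 112, 116, 128, 129, 152, 153, 154, 172, 175, 260, 269, 273, 280, 305,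
  311, 319, 341, 344, 352, 377, 380, 388, 632, 635, 741, 751, 779, 784, 787, 856],
  [0, 42, 50, 70, 71, 77, 85, 105, 106, 162, 170, 174, 178, 194, 199, 206, 210, 215, 229, 233, 242,
  246, 249, 270, 278, 282, 286, 486, 487, 521, 522, 646, 647, 681, 683, 717, 718],
  [0, 11, 15, 24, 27, 116, 120, 132, 133, 303, 304, 315, 319, 320, 340, 348, 352, 356, 376, 384,
  388, 392, 408, 412, 421, 425, 428, 460, 463, 568, 569, 893, 895, 928, 931, 1000, 1001],
  [0, 42, 46, 58, 59, 94, 98, 106, 229, 233, 242, 246, 249, 373, 377, 378, 393, 394, 490, 491, 522,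
  526, 534, 634, 635, 671, 674, 683, 706, 710, 718, 825, 827, 861, 862, 1114, 1115],
  [0, 42, 50, 58, 62, 71, 77, 81, 93, 94, 162, 166, 174, 194, 199, 206, 210, 215, 225, 233, 237,
  246, 270, 274, 282, 342, 343, 521, 522, 634, 638, 647, 669, 674, 683, 705, 706],
  [0, 4, 7, 9, 10, 21, 23, 40, 44, 56, 57, 152, 153, 172, 174, 260, 269, 273, 280, 298, 305, 311,
  318, 341, 344, 352, 377, 381, 388, 632, 635, 741, 750, 779, 784, 786, 856],
  [44, 48, 56, 61, 68, 188, 192, 200, 205, 212, 305, 306, 449, 450, 632, 637, 644, 668, 673, 680],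
  [0, 19, 23, 31, 55, 59, 67, 79, 83, 92, 95, 114, 118, 131, 134, 142, 227, 244, 247, 262, 282, 283,
  379, 380, 388, 415, 422, 426, 430, 712, 714, 750, 751, 964, 967, 1039, 1042, 1111, 1150],
  [0, 58, 62, 70, 77, 81, 93, 94, 194, 199, 206, 210, 215, 338, 342, 343, 358, 359, 486, 490, 498,
  525, 526, 634, 638, 646, 669, 674, 681, 705, 706, 790, 791, 825, 827, 1113, 1114],
  [0, 42, 46, 55, 62, 67, 70, 162, 170, 174, 178, 229, 233, 242, 246, 249, 270, 278, 282, 286, 373,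
  377, 378, 393, 394, 486, 487, 498, 499, 631, 638, 643, 646, 667, 674, 679, 681, 717, 718, 1113,
  1114, 1149, 1150],
  [5, 13, 33, 34, 188, 196, 200, 209, 301, 321, 322, 484, 488, 497, 609, 610, 753, 754, 1077, 1078],
  [0, 7, 11, 19, 20, 31, 112, 116, 128, 129, 155, 172, 175, 260, 280, 281, 304, 307, 340, 344, 352,
  376, 380, 388, 412, 417, 425, 712, 713, 749, 751, 784, 787, 1039, 1075],
  [0, 18, 22, 30, 42, 46, 55, 58, 67, 77, 81, 89, 94, 101, 190, 210, 211, 225, 245, 246, 342, 343,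
  377, 378, 414, 418, 426, 642, 643, 676, 677, 713, 714, 820, 823, 1038, 1111],
  [0, 4, 7, 8, 11, 21, 23, 40, 44, 52, 57, 64, 76, 80, 88, 93, 100, 125, 129, 137, 155, 172, 175,
  260, 280, 281, 304, 311, 319, 412, 413, 605, 607, 640, 643, 856, 857, 1039, 1075],
  [0, 20, 24, 32, 128, 132, 140, 155, 159, 168, 171, 260, 264, 276, 277, 303, 320, 323, 408, 428,
  429, 452, 459, 467, 560, 565, 573, 704, 708, 716, 745, 749, 755, 889, 893, 897, 935, 1004, 1005,
  1076, 1187],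
  [7, 15, 32, 35, 260, 269, 273, 280, 303, 320, 323, 557, 561, 568, 644, 647, 788, 791, 1040, 1043],
  [81, 85, 93, 98, 105, 225, 229, 237, 242, 249, 342, 343, 486, 487, 669, 674, 681, 705, 710, 717],
  [0, 18, 22, 30, 39, 40, 41, 46, 52, 58, 67, 77, 81, 89, 94, 101, 117, 126, 130, 137, 153, 173,
  174, 189, 190, 209, 211, 340, 342, 377, 378, 605, 606, 642, 643, 677, 679],
  [0, 83, 87, 95, 96, 107, 114, 118, 130, 131, 163, 167, 175, 199, 203, 211, 227, 244, 247, 375,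
  379, 384, 388, 395, 415, 418, 426, 570, 571, 704, 706, 743, 751, 815, 820, 856, 858, 894, 895,
  1115, 1151],
  [0, 9, 13, 21, 26, 33, 44, 48, 57, 60, 69, 89, 93, 101, 125, 129, 137, 301, 305, 314, 318, 321,
  336, 341, 348, 352, 357, 461, 462, 496, 497, 640, 642, 893, 894, 964, 965, 1037, 1041, 1074, 1113],
  [0, 83, 87, 95, 96, 107, 114, 118, 130, 131, 227, 244, 247, 307, 311, 319, 343, 347, 355, 375,
  379, 384, 388, 395, 415, 418, 426, 570, 571, 820, 823, 856, 858, 894, 895, 1115, 1151],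
  [0, 190, 194, 206, 207, 225, 229, 237, 242, 249, 338, 358, 359, 373, 393, 394, 454, 458, 466, 490,
  495, 503, 525, 526, 562, 566, 574, 790, 791, 969, 971, 1005, 1006, 1222, 1223],
  [0, 9, 13, 21, 26, 33, 44, 48, 57, 60, 69, 301, 305, 314, 318, 321, 336, 341, 348, 352, 357, 449,
  453, 462, 485, 489, 496, 636, 638, 780, 782, 784, 786, 894, 964, 1041, 1113],
  [116, 120, 129, 132, 141, 260, 264, 273, 276, 285, 304, 307, 448, 451, 597, 600, 609, 705, 708,
  717],
  [0, 227, 231, 236, 243, 248, 262, 266, 274, 279, 286, 375, 392, 395, 410, 430, 431, 455, 459, 467,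
  491, 495, 503, 524, 527, 562, 563, 754, 755, 824, 827, 1004, 1006, 1187, 1259],
  [0, 114, 118, 130, 135, 143, 231, 240, 243, 244, 247, 307, 315, 319, 323, 343, 351, 355, 359, 375,
  379, 384, 388, 395, 559, 562, 571, 708, 711, 816, 819, 820, 823, 895, 1000, 1043, 1151],
  [0, 79, 83, 92, 95, 131, 135, 143, 266, 270, 279, 283, 286, 410, 414, 415, 430, 431, 524, 527,
  559, 563, 571, 668, 671, 708, 711, 747, 751, 754, 852, 856, 862, 895, 1000, 1043, 1151],
  [118, 122, 130, 135, 142, 262, 266, 274, 279, 286, 376, 379, 520, 523, 598, 603, 610, 706, 711,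
  718],
  [0, 77, 78, 81, 82, 93, 95, 114, 118, 126, 131, 138, 190, 199, 203, 210, 224, 225, 244, 246, 298,
  306, 311, 318, 342, 343, 378, 381, 388, 667, 671, 676, 705, 714, 779, 786, 856, 1038],
  [274, 278, 286, 418, 422, 430, 742, 746, 754, 815, 854, 862],
  [126, 130, 138, 414, 418, 426, 676, 679, 820, 823, 1038, 1111],
  [0, 19, 23, 31, 55, 59, 67, 79, 83, 92, 95, 114, 118, 130, 131, 227, 244, 247, 262, 282, 283, 379,
  380, 388, 415, 418, 426, 712, 714, 750, 751, 820, 823, 1039, 1111],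
  [0, 18, 26, 30, 34, 46, 50, 62, 63, 81, 85, 97, 98, 126, 134, 138, 142, 338, 342, 351, 355, 358,
  373, 378, 385, 389, 394, 498, 499, 533, 534, 677, 679, 930, 931, 1001, 1002, 1074, 1078, 1111,
  1150],
  [0, 155, 159, 168, 171, 260, 264, 273, 276, 285, 303, 320, 323, 408, 428, 429, 452, 459, 467, 488,
  492, 500, 524, 528, 536, 560, 561, 788, 791, 897, 899, 1004, 1005, 1185, 1223],
  [0, 7, 11, 20, 23, 52, 56, 64, 112, 116, 125, 128, 137, 155, 172, 175, 260, 280, 281, 304, 311,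
  319, 376, 380, 388, 412, 413, 605, 606, 640, 643, 750, 751, 856, 857, 1038, 1075],
  [0, 21, 25, 33, 44, 48, 57, 60, 69, 153, 157, 169, 170, 301, 305, 314, 318, 321, 336, 340, 348,
  352, 357, 449, 453, 462, 484, 489, 496, 601, 602, 636, 637, 780, 782, 784, 786, 894, 964, 1041,
  1113],
  [0, 5, 9, 21, 22, 41, 44, 50, 51, 57, 60, 70, 188, 189, 208, 210, 305, 310, 318, 338, 339, 341,
  348, 352, 358, 521, 525, 534, 557, 561, 570, 636, 638, 780, 782, 784, 786, 820, 821, 894, 965,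
  1078, 1114],
  [0, 7, 11, 19, 20, 31, 112, 116, 128, 129, 155, 172, 175, 196, 200, 208, 232, 236, 244, 260, 269,
  273, 280, 304, 307, 412, 413, 595, 597, 607, 631, 632, 643, 704, 705],
  [0, 153, 157, 169, 170, 188, 192, 204, 205, 301, 321, 322, 336, 344, 348, 357, 453, 458, 466, 488,
  489, 525, 529, 537, 561, 565, 573, 745, 746, 889, 890, 897, 898, 934, 969],
  [0, 7, 15, 20, 24, 35, 128, 132, 140, 155, 159, 167, 168, 179, 264, 269, 276, 280, 285, 408, 428,
  429, 452, 455, 557, 560, 568, 632, 636, 647, 704, 708, 716, 753, 755, 860, 861, 1040, 1043],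
  [273, 277, 285, 417, 421, 429, 741, 745, 753, 779, 853, 861],
  [0, 42, 46, 58, 59, 77, 81, 94, 97, 105, 162, 166, 174, 190, 199, 203, 210, 225, 233, 241, 246,
  249, 270, 274, 282, 342, 343, 377, 378, 634, 635, 671, 673, 681, 706, 709, 717],
  [0, 79, 83, 88, 95, 100, 115, 119, 131, 132, 140, 264, 265, 270, 276, 280, 286, 408, 409, 412,
  414, 428, 430, 448, 455, 460, 484, 491, 496, 594, 595, 599, 600, 610, 671, 676, 708, 712, 716,
  860, 862, 1040, 1042],
  [0, 5, 9, 21, 22, 40, 44, 56, 57, 153, 173, 174, 188, 208, 209, 269, 273, 281, 305, 310, 318, 341,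
  344, 352, 377, 381, 389, 632, 635, 741, 750, 779, 784, 786, 820, 821, 857],
  [0, 7, 11, 19, 20, 31, 112, 116, 125, 128, 137, 155, 172, 175, 196, 200, 208, 232, 236, 244, 260,
  280, 281, 304, 307, 412, 413, 593, 595, 605, 607, 632, 643, 704, 713],
  [0, 7, 11, 19, 20, 31, 52, 56, 64, 88, 92, 100, 112, 116, 128, 129, 155, 172, 175, 260, 269, 273,
  280, 304, 307, 412, 413, 593, 597, 607, 631, 640, 643, 705, 712],
  [0, 42, 46, 55, 58, 67, 77, 81, 93, 94, 126, 130, 138, 190, 210, 211, 225, 245, 246, 306, 310,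
  318, 342, 343, 378, 381, 389, 667, 671, 676, 706, 713, 786, 787, 815, 820, 821, 823, 858, 1038,
  1075, 1111],
  [0, 5, 9, 18, 21, 30, 40, 44, 56, 57, 89, 93, 101, 125, 129, 137, 153, 173, 174, 188, 208, 209,
  305, 306, 341, 344, 352, 640, 642, 676, 677, 749, 750, 1037, 1038],
  [0, 227, 231, 240, 243, 262, 266, 278, 279, 375, 392, 395, 410, 418, 422, 431, 455, 459, 467, 491,
  495, 503, 527, 528, 536, 562, 563, 816, 819, 890, 899, 963, 968, 971, 1004],
  [0, 153, 157, 169, 170, 188, 192, 204, 205, 301, 306, 314, 318, 321, 336, 344, 348, 357, 450, 453,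
  462, 488, 489, 525, 529, 537, 561, 565, 573, 672, 673, 745, 746, 889, 894, 897, 926, 930, 969],
  [0, 7, 11, 19, 24, 31, 32, 52, 60, 64, 68, 88, 96, 100, 104, 112, 116, 129, 132, 140, 155, 172,
  175, 260, 269, 273, 280, 304, 307, 412, 413, 593, 597, 607, 631, 640, 643, 705, 712],
  [0, 5, 9, 18, 21, 30, 40, 44, 52, 57, 64, 153, 173, 174, 188, 208, 209, 305, 306, 340, 341, 377,
  381, 389, 413, 417, 425, 605, 606, 676, 677, 784, 786, 1037, 1074],
  [0, 19, 23, 31, 55, 59, 67, 79, 83, 88, 95, 100, 114, 118, 130, 131, 227, 244, 247, 262, 270, 274,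
  283, 376, 379, 414, 415, 594, 598, 607, 667, 676, 679, 706, 712],
  [0, 4, 7, 8, 11, 21, 23, 40, 44, 52, 57, 64, 76, 80, 88, 93, 100, 155, 163, 167, 172, 260, 269,
  273, 280, 304, 307, 412, 413, 593, 595, 597, 599, 635, 640, 705, 712],
  [0, 4, 5, 8, 9, 18, 20, 30, 76, 80, 89, 92, 101, 112, 116, 125, 128, 137, 153, 173, 174, 188, 196,
  200, 209, 305, 306, 340, 341, 593, 594, 605, 606, 632, 642, 668, 677],
  [130, 134, 142, 418, 422, 430, 820, 823, 964, 967, 1042, 1150],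
  [0, 79, 80, 81, 82, 88, 95, 100, 114, 118, 126, 131, 138, 224, 225, 226, 244, 247, 262, 282, 283,
  306, 311, 319, 342, 347, 355, 376, 378, 606, 607, 676, 679, 856, 858, 1039, 1111],
  [0, 6, 10, 18, 23, 30, 77, 78, 81, 82, 93, 95, 114, 118, 126, 131, 138, 190, 199, 203, 210, 225,
  233, 237, 246, 342, 343, 377, 378, 630, 635, 642, 667, 669, 671, 705, 714],
  [0, 21, 25, 33, 40, 44, 56, 57, 157, 169, 170, 173, 174, 301, 305, 314, 318, 321, 449, 453, 461,
  488, 489, 636, 637, 745, 746, 749, 750, 780, 782, 784, 786, 893, 928, 1041, 1077],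
  [0, 190, 194, 206, 207, 225, 229, 241, 242, 338, 358, 359, 373, 393, 394, 450, 458, 462, 466, 486,
  495, 498, 503, 522, 529, 534, 537, 558, 566, 570, 574, 934, 935, 969, 971, 1005, 1006],
  [224, 228, 240, 241, 298, 310, 311, 372, 384, 385, 454, 455, 816, 817, 852, 853],
  [0, 42, 46, 59, 62, 70, 162, 170, 174, 178, 229, 233, 242, 246, 249, 270, 278, 282, 286, 373, 377,
  378, 393, 394, 486, 491, 498, 635, 638, 646, 671, 674, 681, 861, 862, 1113, 1114],
  [0, 77, 81, 93, 98, 106, 194, 199, 206, 210, 215, 338, 342, 343, 358, 359, 450, 458, 462, 466,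
  522, 525, 534, 558, 566, 570, 574, 673, 674, 705, 710, 718, 782, 786, 791, 926, 930, 934, 971,
  1114, 1259],
  [59, 63, 71, 203, 207, 215, 635, 639, 647, 671, 675, 683],
  [199, 203, 211, 451, 455, 463, 523, 527, 535, 559, 563, 571, 717, 718, 861, 862, 1149, 1150],
  [95, 99, 107, 131, 135, 143, 311, 315, 323, 347, 351, 359, 856, 858, 1000, 1002, 1043, 1115],
  [23, 27, 35, 55, 63, 67, 71, 95, 99, 107, 131, 135, 143, 199, 203, 211, 631, 635, 643, 667, 671,
  679],
  [203, 207, 215, 347, 351, 359, 779, 783, 791, 815, 819, 827],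
  [0, 42, 46, 55, 58, 67, 77, 80, 82, 83, 93, 94, 190, 210, 211, 224, 226, 227, 233, 237, 246, 307,
  310, 318, 377, 379, 415, 418, 426, 631, 634, 643, 705, 714, 778, 786, 823, 1111],
  [0, 79, 83, 88, 95, 100, 114, 118, 130, 131, 227, 244, 247, 262, 282, 283, 307, 311, 319, 343,
  347, 355, 376, 379, 415, 418, 426, 606, 607, 820, 823, 856, 858, 1038, 1039],
  [0, 42, 44, 45, 47, 58, 59, 77, 81, 89, 94, 101, 188, 189, 191, 210, 211, 225, 245, 246, 305, 310,
  318, 341, 347, 355, 413, 418, 426, 642, 643, 821, 823, 857, 858, 1074, 1075],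
  [0, 225, 226, 229, 230, 241, 243, 262, 266, 278, 279, 338, 358, 359, 372, 373, 392, 394, 446, 454,
  459, 466, 490, 495, 503, 526, 529, 536, 562, 566, 574, 934, 935, 968, 971, 1004, 1006],
  [0, 40, 41, 44, 45, 52, 58, 64, 77, 81, 89, 94, 101, 113, 117, 125, 130, 137, 153, 162, 166, 173,
  188, 208, 209, 305, 306, 340, 341, 594, 598, 605, 630, 634, 640, 676, 677],
  [0, 19, 23, 31, 55, 59, 67, 83, 87, 95, 96, 107, 114, 118, 126, 131, 138, 227, 244, 247, 375, 379,
  384, 388, 395, 414, 415, 570, 571, 676, 679, 712, 714, 894, 895, 1038, 1039, 1115, 1151],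
  [417, 421, 429, 561, 565, 573, 780, 783, 889, 897, 927, 1005],
  [0, 42, 46, 58, 59, 77, 81, 94, 97, 105, 190, 210, 211, 225, 245, 246, 306, 310, 318, 342, 347,
  355, 378, 385, 389, 393, 414, 418, 426, 821, 823, 857, 858, 930, 931, 1113, 1149],
  [0, 18, 22, 30, 42, 46, 58, 63, 71, 77, 81, 93, 94, 126, 130, 138, 190, 199, 207, 210, 215, 225,
  233, 237, 246, 342, 343, 377, 378, 630, 639, 642, 647, 667, 669, 675, 683, 705, 714],
  [0, 21, 25, 33, 40, 44, 56, 57, 157, 169, 170, 173, 174, 301, 305, 314, 318, 321, 449, 453, 461,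
  488, 489, 597, 601, 609, 632, 637, 644, 746, 750, 753, 782, 786, 788, 1076, 1077],
  [0, 5, 9, 22, 25, 33, 192, 196, 205, 209, 212, 233, 241, 245, 249, 269, 277, 281, 285, 336, 340,
  341, 356, 357, 449, 454, 461, 598, 601, 609, 634, 637, 644, 824, 825, 1076, 1077],
  [0, 5, 8, 10, 11, 21, 22, 40, 44, 52, 57, 64, 152, 154, 155, 173, 174, 188, 208, 209, 304, 310,
  318, 376, 381, 389, 412, 417, 425, 605, 606, 784, 786, 820, 821, 1037, 1038],
  [0, 4, 7, 8, 11, 19, 21, 31, 40, 44, 52, 57, 64, 76, 80, 88, 93, 100, 125, 129, 137, 155, 172,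
  175, 260, 280, 281, 304, 307, 412, 413, 605, 607, 640, 643, 712, 713],
  [92, 96, 104, 380, 384, 392, 750, 751, 894, 895, 1112, 1148],
  [376, 380, 388, 520, 524, 532, 602, 603, 746, 747, 964, 1000],
  [0, 79, 83, 88, 95, 100, 114, 116, 117, 119, 130, 131, 227, 244, 247, 260, 261, 263, 282, 283,
  304, 311, 319, 340, 347, 355, 412, 418, 426, 606, 607, 820, 823, 856, 858, 1038, 1039],
  [0, 43, 47, 52, 59, 64, 79, 83, 88, 95, 100, 112, 115, 116, 119, 129, 131, 155, 163, 167, 172,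
  260, 269, 273, 280, 304, 307, 412, 413, 593, 595, 597, 599, 635, 640, 705, 712],
  [167, 171, 179, 311, 315, 323, 743, 747, 755, 779, 783, 791],
  [307, 311, 319, 451, 455, 463, 708, 709, 852, 853, 895, 931],
  [19, 23, 31, 307, 311, 319, 712, 713, 856, 857, 1039, 1075],
  [0, 7, 11, 19, 20, 31, 112, 117, 118, 119, 128, 129, 155, 172, 175, 261, 262, 263, 280, 281, 343,
  344, 352, 379, 380, 388, 415, 417, 425, 712, 713, 749, 751, 784, 787, 1039, 1075],
  [0, 227, 231, 240, 243, 262, 266, 278, 279, 375, 392, 395, 410, 430, 431, 451, 459, 463, 467, 487,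
  495, 499, 503, 523, 528, 535, 536, 559, 566, 571, 574, 898, 899, 968, 971, 1004, 1006],
  [0, 79, 83, 92, 95, 114, 118, 130, 131, 227, 232, 236, 247, 262, 282, 283, 376, 379, 415, 418,
  426, 523, 527, 535, 559, 563, 571, 598, 599, 704, 710, 716, 742, 750, 823, 854, 858, 860, 967,
  1148],
  [93, 97, 105, 237, 241, 249, 669, 673, 681, 705, 709, 717],
  [0, 190, 194, 206, 207, 226, 227, 228, 229, 240, 242, 373, 374, 393, 395, 410, 418, 422, 431, 446,
  454, 458, 467, 490, 495, 503, 526, 528, 537, 816, 819, 890, 899, 963, 969, 971, 1005],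
  [0, 5, 9, 18, 25, 30, 33, 40, 44, 52, 61, 64, 69, 89, 97, 101, 105, 125, 133, 137, 141, 153, 173,
  174, 188, 208, 209, 305, 306, 340, 341, 605, 606, 640, 642, 676, 677],
  [166, 170, 178, 454, 458, 466, 824, 825, 968, 969, 1186, 1222],
  [6, 10, 22, 23, 150, 154, 166, 167, 232, 233, 376, 377, 598, 599, 634, 635],
  [0, 190, 194, 206, 207, 225, 229, 241, 242, 310, 314, 322, 338, 347, 351, 358, 373, 381, 385, 394,
  418, 422, 430, 490, 491, 525, 526, 779, 782, 791, 817, 819, 854, 861, 927, 935, 1005, 1223],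
  [269, 273, 281, 557, 561, 569, 644, 647, 788, 791, 1076, 1079],
  [129, 133, 141, 273, 277, 285, 597, 601, 609, 705, 709, 717],
  [0, 79, 83, 88, 95, 100, 114, 118, 126, 131, 138, 163, 167, 175, 199, 203, 211, 227, 244, 247,
  262, 282, 283, 376, 379, 414, 415, 595, 599, 606, 667, 671, 676, 712, 714],
  [196, 200, 208, 484, 488, 496, 609, 610, 753, 754, 1041, 1042],
  [0, 5, 9, 18, 21, 30, 41, 42, 45, 46, 57, 59, 113, 117, 126, 129, 138, 190, 210, 211, 225, 245,
  246, 342, 347, 355, 378, 381, 389, 677, 679, 786, 787, 857, 858, 1074, 1111],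
  [0, 7, 11, 19, 20, 31, 88, 92, 100, 112, 116, 128, 129, 155, 172, 175, 260, 280, 281, 304, 307,
  340, 344, 352, 412, 417, 425, 606, 607, 712, 713, 749, 750, 784, 787, 1038, 1075],
  [187, 191, 200, 207, 215, 261, 273, 274, 335, 344, 351, 359, 417, 418, 741, 742, 783, 791, 819,
  827],
  [0, 155, 159, 168, 171, 260, 264, 276, 277, 303, 311, 315, 320, 344, 348, 356, 380, 384, 392, 408,
  428, 429, 452, 455, 560, 565, 573, 745, 747, 852, 853, 889, 897, 927, 1005],
  [779, 783, 791, 853, 861, 927, 935, 1005, 1223],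
  [232, 236, 244, 376, 380, 388, 598, 603, 611, 742, 747, 755, 820, 1000, 1043],
  [23, 27, 35, 167, 171, 179, 599, 603, 611, 635, 639, 647],
  [163, 167, 175, 307, 311, 319, 595, 599, 607, 705, 712, 779, 787, 856, 1039],
  [163, 167, 175, 451, 455, 463, 716, 717, 860, 861, 1148, 1149],
  [0, 19, 23, 31, 55, 59, 67, 79, 83, 92, 95, 114, 118, 130, 131, 227, 244, 247, 262, 270, 274, 283,
  379, 380, 388, 414, 415, 667, 668, 679, 706, 712, 742, 751, 820, 1039],
  [0, 227, 231, 240, 243, 262, 266, 278, 279, 311, 315, 323, 347, 351, 359, 375, 392, 395, 410, 430,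
  431, 527, 528, 536, 563, 566, 574, 852, 854, 891, 898, 963, 968, 1004, 1006],
  [274, 278, 286, 562, 566, 574, 824, 827, 968, 971, 1186, 1259],
  [270, 274, 282, 558, 562, 570, 680, 683, 824, 827, 1112, 1115],
  [126, 130, 138, 270, 274, 282, 667, 668, 676, 706, 714, 742, 750, 820, 1038],
  [0, 7, 11, 20, 23, 112, 116, 128, 129, 155, 172, 175, 196, 200, 208, 232, 236, 244, 260, 269, 273,
  280, 304, 311, 319, 412, 413, 597, 599, 632, 635, 743, 751, 779, 787],
  [0, 7, 11, 20, 23, 112, 116, 128, 129, 155, 163, 167, 172, 260, 280, 281, 304, 307, 340, 344, 352,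
  376, 380, 388, 412, 417, 425, 595, 599, 607, 705, 712, 749, 751, 779, 784, 857, 1039],
  [0, 5, 9, 18, 21, 30, 40, 44, 56, 57, 153, 173, 174, 188, 196, 200, 209, 233, 237, 245, 269, 273,
  281, 305, 306, 340, 341, 594, 597, 606, 630, 632, 642, 668, 669],
  [0, 42, 46, 55, 58, 67, 77, 81, 89, 94, 101, 190, 210, 211, 225, 245, 246, 306, 310, 318, 342,
  343, 377, 378, 414, 418, 426, 642, 643, 713, 714, 821, 823, 1074, 1111],
  [203, 207, 215, 491, 495, 503, 861, 862, 1005, 1006, 1223, 1259],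
  [0, 7, 15, 20, 24, 35, 112, 116, 128, 129, 159, 163, 168, 172, 179, 196, 200, 208, 232, 236, 244,
  260, 269, 273, 280, 304, 307, 556, 557, 597, 600, 611, 632, 636, 647, 704, 705],
  [4, 5, 6, 7, 40, 41, 42, 43, 76, 77, 78, 79, 112, 113, 114, 115],
  [0, 42, 46, 58, 59, 77, 81, 93, 94, 190, 199, 203, 210, 225, 233, 237, 246, 306, 310, 318, 342,
  343, 377, 378, 414, 418, 426, 634, 635, 705, 706, 778, 786, 815, 858],
  [0, 155, 159, 167, 168, 179, 262, 263, 266, 267, 276, 278, 335, 339, 347, 348, 359, 375, 380, 384,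
  395, 410, 417, 422, 431, 524, 527, 561, 563, 743, 746, 755, 779, 780, 791, 852, 854],
  [0, 7, 11, 20, 23, 52, 56, 64, 88, 92, 100, 112, 116, 128, 129, 155, 172, 175, 260, 269, 273, 280,
  304, 311, 319, 412, 413, 593, 597, 607, 635, 640, 779, 787, 856, 1039],
  [0, 79, 83, 88, 95, 100, 114, 118, 130, 131, 163, 167, 175, 199, 203, 211, 227, 232, 236, 247,
  262, 270, 274, 283, 379, 380, 388, 414, 415, 594, 599, 607, 671, 676, 704, 706, 742, 751, 820,
  1039],
  [0, 166, 170, 178, 190, 194, 206, 207, 225, 229, 237, 242, 249, 274, 278, 286, 338, 347, 351, 358,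
  373, 393, 394, 490, 491, 525, 526, 779, 783, 790, 815, 819, 825, 861, 862],
  [0, 79, 83, 88, 95, 100, 112, 113, 115, 118, 130, 131, 155, 163, 167, 172, 191, 199, 203, 208,
  262, 263, 270, 274, 280, 376, 379, 414, 415, 594, 595, 598, 599, 671, 676, 706, 712],
  [0, 83, 87, 95, 96, 107, 114, 118, 130, 131, 227, 232, 236, 247, 307, 311, 319, 343, 347, 355,
  375, 376, 379, 380, 384, 395, 415, 418, 426, 570, 571, 598, 599, 742, 743, 823, 858, 894, 895,
  1115, 1151],
  [0, 79, 83, 92, 95, 117, 118, 121, 122, 131, 133, 143, 262, 282, 283, 307, 311, 319, 335, 343,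
  347, 352, 379, 380, 388, 409, 410, 415, 421, 426, 431, 496, 499, 532, 535, 750, 751, 856, 858,
  928, 931, 1043, 1151],
  [156, 157, 158, 159, 300, 301, 302, 303, 452, 453, 488, 489, 524, 525, 560, 561],
  [0, 227, 231, 240, 243, 262, 266, 278, 279, 311, 315, 323, 347, 351, 359, 375, 392, 395, 410, 418,
  422, 431, 527, 528, 536, 562, 563, 816, 819, 852, 854, 890, 891, 968, 1004],
  [0, 79, 83, 92, 95, 114, 118, 130, 131, 163, 167, 175, 227, 232, 236, 247, 262, 282, 283, 343,
  347, 355, 376, 379, 415, 418, 426, 598, 599, 704, 705, 742, 750, 779, 787, 823, 858],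
  [0, 79, 83, 88, 95, 100, 114, 118, 130, 131, 163, 167, 175, 199, 203, 211, 227, 244, 247, 262,
  270, 274, 283, 376, 379, 414, 415, 594, 595, 598, 599, 671, 676, 706, 712],
  [0, 5, 9, 18, 21, 30, 41, 42, 45, 46, 57, 59, 187, 190, 200, 203, 208, 210, 225, 245, 246, 261,
  270, 273, 282, 342, 344, 352, 378, 381, 389, 668, 671, 676, 677, 741, 750, 779, 784, 786, 857,
  1038, 1074],
  [0, 79, 83, 92, 95, 118, 122, 131, 134, 143, 262, 282, 283, 307, 311, 319, 343, 347, 355, 379,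
  380, 388, 410, 415, 422, 426, 431, 532, 535, 750, 751, 856, 858, 964, 967, 1043, 1151],
  [5, 13, 22, 26, 33, 188, 208, 209, 301, 310, 314, 321, 496, 497, 820, 821, 964, 965, 1041, 1077],
  [0, 79, 83, 92, 95, 114, 118, 131, 134, 142, 227, 244, 247, 262, 282, 283, 307, 311, 319, 343,
  347, 355, 379, 380, 388, 415, 422, 426, 430, 750, 751, 856, 858, 964, 967, 1042, 1150],
  [0, 79, 83, 92, 95, 114, 118, 130, 131, 163, 167, 175, 199, 203, 211, 227, 244, 247, 262, 270,
  274, 283, 379, 380, 388, 414, 415, 668, 671, 704, 706, 742, 743, 820, 856],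
  [0, 7, 11, 20, 23, 116, 120, 128, 133, 140, 260, 280, 281, 304, 311, 319, 340, 344, 352, 376, 380,
  388, 408, 412, 421, 425, 428, 460, 463, 749, 751, 856, 857, 928, 931, 1040, 1148],
  [0, 153, 157, 169, 170, 188, 192, 200, 205, 212, 237, 241, 249, 273, 277, 285, 301, 310, 314, 321,
  336, 356, 357, 453, 454, 488, 489, 742, 746, 753, 778, 782, 788, 824, 825],
  [0, 167, 171, 179, 203, 207, 215, 227, 231, 240, 243, 262, 266, 274, 279, 286, 375, 380, 384, 395,
  410, 430, 431, 524, 527, 562, 563, 742, 743, 754, 755, 816, 827, 852, 862],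
  [0, 42, 46, 58, 59, 77, 81, 93, 94, 162, 166, 174, 190, 199, 203, 210, 225, 233, 237, 246, 270,
  274, 282, 342, 343, 377, 378, 631, 634, 643, 669, 671, 706, 713, 779, 787, 857, 1075],
  [0, 167, 171, 179, 203, 207, 215, 227, 231, 236, 243, 248, 262, 266, 274, 279, 286, 375, 392, 395,
  410, 418, 422, 431, 524, 527, 563, 566, 574, 742, 746, 755, 815, 854, 860, 968, 971, 1186, 1259],
  [0, 6, 10, 22, 23, 79, 83, 92, 95, 114, 118, 130, 131, 150, 154, 166, 167, 227, 233, 236, 247,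
  262, 282, 283, 307, 311, 319, 343, 347, 355, 377, 379, 415, 418, 426, 634, 635, 742, 743, 750,
  751, 823, 858],
  [0, 150, 154, 166, 167, 203, 207, 215, 227, 228, 231, 236, 243, 249, 262, 266, 274, 279, 286, 372,
  375, 393, 395, 410, 430, 431, 454, 459, 467, 524, 527, 562, 563, 754, 755, 825, 827, 860, 862,
  1004, 1005, 1187, 1223],
  [0, 150, 154, 166, 167, 227, 228, 231, 236, 243, 249, 262, 266, 274, 279, 286, 372, 375, 393, 395,
  410, 430, 431, 454, 459, 467, 491, 495, 503, 524, 527, 562, 563, 754, 755, 825, 827, 860, 861,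
  1004, 1006, 1187, 1259],
  [10, 14, 26, 27, 46, 50, 62, 63, 82, 86, 98, 99, 118, 122, 134, 135],
  [6, 10, 22, 23, 42, 46, 58, 59, 78, 82, 94, 95, 114, 118, 130, 131],
  [0, 79, 83, 88, 95, 100, 114, 122, 131, 135, 142, 163, 167, 175, 199, 203, 211, 227, 244, 247,
  266, 270, 279, 283, 286, 414, 415, 520, 523, 594, 595, 599, 603, 610, 671, 676, 711, 712, 718],
  [44, 48, 60, 61, 188, 192, 204, 205, 305, 310, 318, 449, 454, 462, 636, 637, 816, 817, 894, 930],
  [0, 18, 22, 30, 42, 46, 58, 59, 77, 81, 89, 94, 101, 126, 130, 138, 190, 210, 211, 225, 233, 237,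
  246, 342, 347, 355, 378, 381, 389, 630, 635, 643, 669, 679, 779, 786, 858, 1074, 1075, 1111],
  [0, 7, 11, 19, 20, 31, 115, 119, 128, 135, 143, 265, 266, 269, 279, 283, 285, 409, 410, 413, 415,
  429, 431, 487, 488, 499, 523, 524, 535, 595, 603, 607, 611, 631, 632, 643, 704, 711, 717, 753,
  755, 1149, 1151],
  [0, 152, 153, 156, 157, 168, 170, 260, 264, 273, 276, 285, 298, 301, 311, 314, 321, 336, 344, 348,
  357, 372, 381, 384, 393, 453, 455, 488, 489, 741, 746, 753, 779, 780, 782, 852, 861],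
  [116, 120, 132, 133, 260, 264, 276, 277, 304, 311, 319, 448, 455, 463, 600, 601, 852, 853, 895,
  931],
  [0, 227, 231, 236, 243, 248, 262, 266, 278, 279, 311, 315, 323, 347, 351, 359, 375, 392, 395, 410,
  418, 422, 431, 524, 527, 562, 563, 742, 743, 746, 747, 819, 824, 854, 860],
  [0, 79, 83, 92, 95, 114, 122, 131, 135, 142, 163, 167, 175, 199, 203, 211, 227, 232, 236, 247,
  266, 270, 279, 283, 286, 414, 415, 520, 523, 599, 603, 610, 668, 671, 704, 711, 718],
  [0, 42, 46, 58, 59, 77, 81, 93, 94, 162, 166, 174, 190, 210, 211, 225, 245, 246, 270, 274, 282,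
  342, 347, 355, 378, 381, 389, 669, 671, 778, 787, 815, 821, 823, 857],
  [8, 12, 24, 25, 152, 156, 168, 169, 304, 305, 448, 449, 600, 601, 636, 637],
  [0, 7, 15, 32, 35, 113, 114, 115, 120, 140, 141, 163, 171, 175, 179, 195, 196, 207, 211, 212, 231,
  232, 243, 247, 248, 264, 267, 269, 279, 283, 285, 448, 451, 556, 557, 609, 611, 644, 647, 716,
  717],
  [11, 15, 24, 27, 47, 51, 60, 63, 83, 87, 96, 99, 119, 123, 132, 135],
  [0, 42, 46, 58, 59, 77, 81, 93, 94, 162, 166, 174, 190, 210, 211, 225, 233, 237, 246, 270, 274,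
  282, 342, 347, 355, 377, 378, 634, 635, 669, 671, 779, 787, 815, 823],
  [0, 227, 231, 236, 243, 248, 260, 263, 264, 267, 277, 279, 303, 311, 315, 320, 335, 339, 344, 351,
  356, 408, 418, 421, 428, 452, 455, 560, 562, 742, 743, 745, 747, 819, 824, 853, 860],
  [0, 42, 46, 55, 58, 67, 77, 81, 93, 94, 162, 166, 174, 190, 210, 211, 225, 245, 246, 270, 274,
  282, 342, 343, 378, 381, 389, 667, 669, 679, 706, 713, 778, 787, 821, 1075],
  [0, 79, 83, 92, 95, 113, 114, 121, 122, 131, 135, 141, 163, 167, 175, 187, 196, 203, 211, 227,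
  232, 236, 247, 265, 266, 270, 279, 283, 285, 414, 415, 484, 487, 520, 523, 599, 603, 609, 668,
  671, 704, 711, 717],
  [0, 5, 13, 22, 26, 33, 41, 42, 43, 48, 68, 69, 162, 166, 174, 192, 193, 196, 206, 210, 212, 229,
  233, 242, 246, 249, 265, 269, 278, 282, 285, 449, 450, 484, 485, 598, 602, 609, 634, 638, 644,
  680, 681],
  [7, 11, 20, 23, 43, 47, 56, 59, 79, 83, 92, 95, 115, 119, 128, 131],
  [0, 42, 46, 58, 59, 77, 81, 93, 94, 162, 166, 174, 190, 199, 203, 210, 225, 245, 246, 270, 274,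
  282, 342, 343, 378, 381, 389, 669, 671, 705, 706, 778, 779, 821, 857],
  [0, 190, 194, 203, 206, 215, 225, 229, 241, 242, 310, 314, 322, 338, 358, 359, 373, 381, 385, 394,
  418, 422, 430, 490, 491, 525, 526, 779, 782, 791, 815, 817, 827, 853, 854],
  [0, 227, 231, 236, 243, 248, 260, 263, 264, 267, 277, 279, 303, 320, 323, 335, 339, 344, 351, 356,
  408, 418, 421, 428, 452, 459, 467, 560, 562, 742, 743, 745, 747, 819, 824, 852, 860, 891, 899,
  927, 935],
  [0, 7, 11, 20, 23, 112, 116, 125, 128, 137, 155, 172, 175, 196, 200, 208, 260, 269, 273, 280, 304,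
  311, 319, 376, 380, 388, 412, 417, 425, 597, 598, 632, 635, 640, 643, 742, 751, 779, 784, 820,
  856, 1037, 1075],
  [0, 79, 87, 104, 107, 227, 231, 236, 243, 248, 266, 270, 279, 283, 286, 410, 430, 431, 451, 459,
  463, 467, 487, 495, 499, 503, 523, 524, 535, 558, 559, 680, 683, 754, 755, 1004, 1006, 1148, 1151,
  1187, 1259],
  [9, 13, 25, 26, 45, 49, 61, 62, 81, 85, 97, 98, 117, 121, 133, 134],
  [0, 7, 11, 20, 23, 112, 116, 128, 129, 155, 172, 175, 196, 200, 208, 232, 236, 244, 260, 280, 281,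
  304, 311, 319, 412, 417, 425, 597, 599, 741, 743, 749, 751, 787, 857],
  [113, 121, 141, 142, 187, 199, 200, 208, 265, 285, 286, 487, 488, 496, 717, 718, 753, 754, 1041,
  1042],
  [0, 4, 7, 8, 11, 21, 23, 40, 44, 52, 57, 64, 154, 155, 172, 174, 260, 269, 273, 280, 298, 304,
  311, 318, 376, 381, 388, 412, 413, 593, 597, 606, 635, 640, 779, 786, 856, 1038],
  [22, 26, 34, 58, 62, 70, 94, 98, 106, 130, 134, 142],
  [0, 4, 7, 9, 10, 19, 21, 31, 40, 44, 56, 57, 76, 80, 92, 93, 152, 153, 154, 172, 175, 260, 269,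
  273, 280, 305, 307, 341, 344, 352, 377, 380, 388, 631, 632, 643, 705, 712, 741, 751, 784, 1039],
  [2, 10, 18, 22, 31, 80, 100, 101, 298, 306, 310, 319, 388, 389, 676, 677, 820, 821, 1039, 1075],
  [0, 6, 7, 8, 9, 20, 22, 112, 116, 128, 129, 150, 152, 153, 166, 167, 172, 175, 196, 200, 208, 233,
  236, 244, 260, 269, 273, 280, 305, 311, 319, 340, 341, 597, 598, 632, 634, 743, 751, 779, 787],
  [20, 24, 32, 56, 60, 68, 92, 96, 104, 128, 132, 140],
  [0, 5, 9, 21, 22, 40, 43, 44, 47, 57, 59, 153, 162, 166, 173, 187, 188, 191, 200, 203, 208, 209,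
  233, 237, 245, 270, 273, 281, 305, 306, 341, 344, 352, 413, 414, 634, 635, 669, 671, 741, 742,
  784, 820],
  [0, 42, 46, 55, 58, 67, 77, 81, 93, 94, 190, 210, 211, 225, 245, 246, 306, 310, 318, 342, 343,
  378, 381, 389, 414, 418, 426, 713, 714, 786, 787, 821, 823, 1075, 1111],
  [2, 6, 19, 22, 30, 76, 88, 89, 150, 163, 166, 174, 232, 233, 595, 598, 606, 631, 634, 642],
  [52, 56, 64, 340, 344, 352, 605, 606, 749, 750, 1037, 1038],
  [39, 47, 52, 56, 67, 117, 137, 138, 335, 340, 344, 355, 425, 426, 605, 606, 749, 750, 1075, 1111],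
  [6, 10, 22, 23, 150, 154, 166, 167, 232, 237, 245, 376, 381, 389, 598, 599, 778, 779, 821, 857],
  [6, 10, 22, 23, 224, 232, 236, 245, 298, 310, 311, 376, 380, 389, 598, 599, 742, 743, 821, 857],
  [0, 5, 9, 21, 26, 34, 40, 44, 56, 57, 153, 173, 174, 188, 208, 209, 305, 314, 318, 322, 341, 344,
  352, 413, 417, 425, 521, 525, 533, 638, 639, 749, 750, 782, 783, 784, 786, 964, 1001, 1042, 1078],
  [43, 47, 56, 59, 187, 191, 200, 203, 270, 273, 281, 414, 417, 425, 668, 671, 741, 749, 779, 857],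
  [43, 47, 56, 59, 261, 270, 274, 281, 335, 344, 347, 414, 418, 425, 668, 671, 742, 749, 815, 857],
  [0, 5, 9, 21, 22, 40, 44, 56, 57, 113, 117, 129, 130, 153, 162, 166, 173, 187, 188, 199, 200, 209,
  233, 237, 245, 261, 269, 274, 281, 305, 306, 341, 343, 632, 634, 668, 669, 705, 706],
  [0, 5, 9, 21, 22, 40, 44, 56, 57, 113, 117, 129, 130, 153, 162, 166, 173, 188, 191, 209, 211, 305,
  306, 335, 341, 344, 355, 377, 381, 389, 413, 418, 425, 668, 669, 742, 749, 778, 787, 821, 823],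
  [162, 166, 174, 306, 310, 318, 630, 634, 642, 668, 677, 742, 750, 821, 1074],
  [270, 274, 282, 414, 418, 426, 668, 675, 683, 742, 750, 819, 827, 1002, 1115],
  [0, 5, 9, 21, 22, 40, 44, 56, 57, 76, 80, 92, 93, 150, 153, 163, 166, 173, 188, 196, 200, 209,
  224, 233, 236, 245, 269, 273, 281, 305, 307, 340, 341, 597, 598, 632, 634, 704, 705],
  [0, 5, 9, 21, 22, 40, 44, 56, 57, 76, 80, 92, 93, 153, 154, 173, 175, 188, 208, 209, 298, 305,
  310, 319, 341, 344, 352, 377, 380, 389, 413, 417, 425, 749, 751, 784, 787, 820, 821],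
  [43, 51, 68, 71, 187, 195, 212, 215, 270, 273, 281, 558, 561, 569, 680, 683, 788, 791, 1076, 1079],
  [0, 4, 7, 8, 11, 21, 23, 40, 44, 56, 57, 154, 155, 172, 174, 260, 280, 281, 298, 304, 311, 318,
  340, 344, 352, 376, 381, 388, 412, 417, 425, 749, 750, 784, 786, 856, 857],
  [0, 4, 5, 8, 9, 20, 22, 112, 116, 128, 129, 153, 154, 173, 175, 188, 208, 209, 298, 305, 310, 319,
  341, 344, 352, 377, 380, 389, 413, 417, 425, 749, 751, 784, 787, 820, 821],
  [669, 673, 681, 778, 786, 817, 825, 930, 1113],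
  [237, 241, 249, 381, 385, 393, 669, 673, 681, 779, 786, 853, 861, 930, 1113],
  [0, 40, 41, 44, 45, 56, 58, 77, 81, 93, 94, 153, 162, 166, 173, 188, 191, 209, 211, 233, 237, 245,
  305, 306, 335, 341, 344, 355, 413, 418, 425, 634, 635, 668, 669, 742, 749, 779, 787, 823, 857],
  [0, 19, 23, 31, 55, 59, 67, 79, 83, 92, 95, 114, 118, 130, 131, 227, 232, 236, 247, 262, 270, 274,
  283, 376, 379, 414, 415, 595, 598, 607, 667, 668, 679, 704, 706],
  [187, 191, 196, 203, 208, 261, 273, 274, 335, 340, 347, 352, 417, 418, 597, 598, 779, 784, 815,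
  820],
  [597, 601, 609, 780, 784, 788, 889, 897, 928, 932, 1041, 1185],
  [273, 277, 285, 417, 421, 429, 597, 601, 609, 779, 784, 853, 861, 928, 1041],
  [52, 56, 64, 196, 200, 208, 593, 598, 606, 632, 640, 742, 750, 820, 1038],
  [196, 200, 208, 484, 488, 496, 598, 602, 609, 742, 746, 753, 820, 964, 1041],
  [0, 5, 9, 21, 22, 40, 44, 52, 57, 64, 153, 173, 174, 188, 208, 209, 305, 310, 318, 340, 341, 377,
  381, 389, 413, 417, 425, 605, 606, 784, 786, 820, 821, 1037, 1038],
  [196, 204, 208, 212, 484, 492, 496, 500, 609, 610, 897, 898, 1041, 1042, 1185, 1186],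
  [0, 5, 9, 21, 22, 40, 44, 56, 57, 113, 117, 129, 130, 153, 162, 166, 173, 188, 191, 209, 211, 233,
  237, 245, 305, 306, 335, 341, 344, 355, 413, 418, 425, 634, 635, 668, 669, 742, 749, 779, 787,
  823, 857],
  [162, 166, 174, 450, 454, 462, 668, 672, 681, 742, 750, 816, 825, 894, 1113],
  [162, 170, 174, 178, 450, 458, 462, 466, 680, 681, 968, 969, 1112, 1113, 1186, 1222],
  [0, 190, 194, 203, 206, 215, 225, 229, 241, 242, 310, 314, 322, 338, 347, 351, 358, 373, 381, 385,
  394, 418, 422, 430, 490, 495, 503, 525, 526, 779, 782, 791, 815, 817, 827, 927, 935, 963, 971],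
  [0, 5, 6, 9, 10, 21, 23, 40, 43, 45, 46, 57, 59, 150, 153, 154, 162, 167, 173, 187, 189, 190, 196,
  203, 209, 232, 237, 245, 270, 273, 281, 340, 342, 376, 378, 597, 599, 669, 671],
  [0, 5, 9, 21, 26, 34, 40, 44, 57, 60, 68, 153, 162, 170, 173, 178, 188, 196, 204, 209, 212, 305,
  306, 340, 341, 521, 525, 533, 557, 561, 569, 597, 602, 610, 636, 638, 669, 672, 680, 788, 790,
  1076, 1078],
  [0, 5, 6, 9, 10, 21, 23, 41, 42, 45, 46, 57, 59, 190, 191, 208, 210, 224, 225, 244, 246, 298, 306,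
  311, 318, 335, 342, 347, 352, 378, 381, 388, 414, 417, 426, 784, 786, 856, 858]]

set_option maxRecDepth 100000 in
/-- A search tree excluding, by means of `checksFour`, sets of crossing pairs of small weight. -/
def refutationFour : Refutation :=
  .split 153 (.split 262 (.close [13, 7, 22, 11, 154, 1, 155, 156, 157, 158]) (.split 227 (.close
  [8, 40, 11, 59, 18, 7, 159, 89, 160, 161]) (.split 225 (.close [8, 25, 11, 18, 7, 26, 0, 46, 89,
  162]) (.split 155 (.close [3, 23, 11, 163, 31, 164, 165, 90, 166, 167]) (.split 190 (.close [3,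
  168, 11, 41, 169, 0, 2, 170, 74, 171]) (.split 260 (.close [3, 7, 11, 32, 18, 33, 1, 0, 60, 172])
  (.close [14, 11, 18, 24, 60, 173, 42, 27, 91, 174, 75]))))))) (.split 188 (.split 260 (.close [28,
  9, 13, 32, 33, 6, 75, 53, 175, 176]) (.split 227 (.close [8, 59, 31, 40, 28, 6, 177, 92, 178,
  179]) (.split 262 (.close [15, 9, 6, 22, 28, 34, 13, 47, 180, 181]) (.split 190 (.close [28, 15,
  48, 35, 41, 6, 27, 46, 29, 93]) (.split 225 (.close [8, 3, 25, 28, 6, 26, 0, 46, 5, 182]) (.split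
  155 (.close [94, 7, 28, 36, 183, 1, 0, 184, 185, 186]) (.close [14, 187, 6, 19, 27, 95, 188, 189,
  54, 190, 191]))))))) (.split 260 (.split 225 (.close [13, 96, 192, 26, 193, 76, 194, 54, 195,
  196]) (.split 190 (.close [48, 41, 9, 32, 33, 35, 15, 20, 10, 197]) (.split 262 (.close [15, 48,
  34, 22, 33, 32, 20, 1, 10, 77]) (.split 227 (.close [13, 96, 40, 33, 97, 42, 10, 1, 198, 199])
  (.close [33, 14, 200, 2, 42, 20, 98, 27, 201, 78, 77]))))) (.split 155 (.split 190 (.close [49, 7,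
  35, 23, 99, 10, 0, 75, 79, 202]) (.split 225 (.close [3, 7, 8, 25, 36, 26, 23, 20, 10, 203])
  (.split 227 (.close [8, 7, 40, 59, 36, 23, 20, 19, 10, 53]) (.split 262 (.close [31, 7, 23, 36,
  22, 204, 60, 42, 43, 205]) (.split 418 (.close [14, 206, 100, 207, 36, 23, 20, 10, 42, 21])
  (.close [14, 36, 23, 1, 20, 0, 10, 208, 101, 53, 209])))))) (.split 227 (.split 225 (.close [26,
  3, 97, 102, 31, 40, 21, 210, 211, 212]) (.split 190 (.close [8, 94, 40, 41, 103, 44, 5, 10, 29,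
  213]) (.close [14, 59, 40, 12, 47, 5, 19, 95, 10, 42, 79]))) (.split 262 (.split 190 (.close [9,
  22, 34, 13, 41, 35, 10, 214, 215, 216]) (.split 225 (.close [8, 3, 25, 22, 26, 34, 20, 5, 10, 61])
  (.split 273 (.close [14, 55, 55, 217, 22, 34, 20, 1, 218, 219]) (.split 381 (.close [14, 62, 104,
  105, 22, 34, 24, 5, 5, 53]) (.split 310 (.close [14, 30, 56, 63, 22, 34, 24, 5, 5, 60]) (.close
  [14, 22, 34, 17, 19, 220, 221, 222, 47, 223, 79])))))) (.split 225 (.split 344 (.close [14, 64,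
  106, 37, 25, 26, 5, 0, 27, 46]) (.close [14, 26, 25, 21, 224, 225, 0, 27, 226, 227, 74])) (.split
  190 (.close [14, 41, 103, 20, 228, 229, 2, 230, 231, 93, 101]) (.split 418 (.close [107, 100, 232,
  108, 24, 10, 5, 233, 234, 235, 236]) (.split 310 (.close [30, 56, 63, 237, 5, 5, 47, 109, 110,
  238, 239]) (.split 347 (.split 203 (.close [240, 111, 112, 241, 242, 243, 57, 5, 10, 43]) (.close
  [244, 111, 112, 80, 0, 20, 5, 10, 245, 74, 54])) (.split 381 (.close [62, 104, 105, 65, 5, 24,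
  246, 247, 248, 249, 250]) (.split 417 (.close [251, 113, 113, 50, 2, 27, 46, 252, 253, 254, 255])
  (.split 344 (.close [64, 106, 37, 80, 1, 17, 0, 256, 114, 257, 54]) (.split 380 (.close [258, 259,
  115, 65, 1, 17, 42, 116, 260, 114, 261]) (.split 311 (.close [262, 263, 264, 117, 57, 21, 19, 265,
  266, 267, 53]) (.split 237 (.close [62, 118, 268, 81, 4, 29, 2, 21, 27, 269, 270]) (.split 166
  (.close [30, 38, 271, 272, 4, 1, 2, 29, 5, 273, 109]) (.split 273 (.close [119, 274, 275, 66, 1,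
  57, 2, 76, 46, 276, 82]) (.split 200 (.close [120, 50, 58, 277, 39, 121, 122, 27, 2, 278, 279])
  (.split 742 (.close [83, 123, 51, 67, 280, 1, 1, 281, 5, 5, 54]) (.split 779 (.close [124, 124,
  67, 282, 50, 44, 2, 2, 43, 43, 39]) (.split 236 (.close [67, 283, 125, 126, 17, 127, 78, 1, 5, 47,
  128]) (.split 167 (.close [67, 284, 285, 286, 2, 57, 84, 78, 287, 288, 128]) (.split 274 (.split
  304 (.close [50, 289, 129, 129, 7, 32, 1, 1, 57]) (.close [50, 290, 291, 130, 24, 292, 21, 17,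
  293, 294, 295])) (.split 203 (.close [50, 296, 131, 131, 39, 76, 44, 132, 29, 43, 297]) (.split 40
  (.split 112 (.close [3, 31, 11, 36, 1, 2, 16, 68]) (.split 116 (.close [3, 298, 11, 32, 85, 69,
  69, 16]) (.close [85, 85, 3, 86, 2, 44, 299, 300, 301, 302]))) (.split 173 (.split 172 (.close [3,
  11, 31, 36, 1, 2, 16, 68]) (.split 280 (.close [3, 31, 11, 70, 1, 2, 16, 68]) (.split 7 (.close
  [33, 71, 11, 3, 303, 133, 304, 305]) (.close [15, 3, 11, 12, 61, 0, 24, 17, 122, 306])))) (.split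
  209 (.split 301 (.split 7 (.close [307, 49, 71, 71, 84, 133, 308]) (.close [3, 15, 134, 17, 61,
  309, 135, 136, 137])) (.split 321 (.split 172 (.close [49, 99, 84, 132, 39, 310, 311]) (.split 280
  (.close [3, 31, 70, 1, 2, 16, 68]) (.split 7 (.close [3, 70, 71, 17, 91, 135, 136]) (.close [15,
  49, 12, 1, 121, 4, 19, 0, 312])))) (.close [3, 313, 28, 16, 4, 61, 127, 138, 0, 314]))) (.split 5
  (.split 77 (.split 301 (.close [15, 49, 48, 134, 0, 12, 39]) (.split 321 (.close [70, 49, 48, 39,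
  12, 315, 316]) (.close [28, 15, 48, 41, 317, 2, 29, 318]))) (.close [15, 139, 139, 44, 12, 1, 0,
  319, 320, 321])) (.split 44 (.split 342 (.close [8, 25, 45, 6, 4, 0, 12, 322]) (.split 378 (.close
  [8, 45, 6, 35, 4, 0, 12, 323]) (.split 46 (.close [35, 45, 45, 6, 324, 325, 4, 326]) (.split 81
  (.close [9, 8, 25, 45, 87, 327, 4, 140]) (.close [9, 69, 45, 6, 19, 4, 0, 16, 328, 329])))))
  (.split 305 (.split 304 (.split 342 (.close [8, 6, 13, 102, 52, 330]) (.split 378 (.close [8, 6,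
  13, 35, 331, 332]) (.split 46 (.close [6, 35, 13, 69, 4, 333]) (.close [9, 6, 13, 32, 19, 334, 16,
  110])))) (.split 412 (.close [9, 13, 6, 335, 0, 19, 16, 336]) (.split 11 (.close [9, 6, 337, 23,
  0, 16, 338, 339]) (.close [7, 9, 6, 29, 86, 4, 2, 16, 340, 341])))) (.split 341 (.split 304
  (.close [9, 13, 32, 18, 1, 52, 140, 342]) (.split 412 (.close [9, 13, 18, 23, 1, 2, 17, 141])
  (.split 11 (.close [9, 18, 343, 23, 344, 345, 0, 346]) (.close [7, 9, 18, 86, 4, 1, 2, 142, 347,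
  141])))) (.split 9 (.split 81 (.close [7, 8, 18, 25, 4, 0, 12, 348]) (.close [18, 349, 7, 87, 92,
  0, 17, 350, 47, 90])) (.split 21 (.close [72, 72, 143, 144, 82, 145, 44, 0, 2, 39]) (.split 57
  (.close [72, 72, 143, 144, 82, 145, 44, 0, 2, 39]) (.split 208 (.close [37, 58, 15, 28, 108, 351,
  4, 1, 19, 352]) (.split 22 (.close [38, 38, 63, 353, 87, 117, 12, 4, 16, 354]) (.split 306 (.close
  [30, 56, 9, 6, 8, 355, 12, 4, 356, 16]) (.split 56 (.close [58, 58, 64, 357, 45, 80, 358, 24, 17,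
  359]) (.split 174 (.close [30, 38, 3, 11, 65, 360, 12, 24, 29, 17]) (.split 340 (.close [37, 361,
  7, 18, 66, 362, 1, 19, 4, 142]) (.split 598 (.close [37, 83, 38, 38, 130, 66, 363, 364, 365, 24])
  (.split 668 (.close [30, 51, 58, 120, 126, 81, 366, 367, 98, 4]) (.split 820 (.close [37, 51, 51,
  83, 115, 146, 63, 125, 368, 369]) (.split 750 (.close [51, 51, 30, 123, 107, 370, 64, 371, 372,
  373]) (.split 281 (.close [119, 3, 15, 55, 21, 147, 33, 374, 137, 0]) (.split 245 (.close [3, 62,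
  15, 21, 118, 147, 26, 88, 375, 0]) (.split 669 (.split 786 (.close [73, 73, 148, 149, 376, 0, 2,
  52]) (.split 318 (.close [56, 56, 377, 65, 150, 81, 138, 29]) (.close [30, 151, 21, 21, 73, 73,
  150, 378, 0, 0]))) (.split 597 (.split 784 (.close [55, 55, 148, 149, 379, 152, 52, 380]) (.close
  [37, 381, 153, 153, 382, 383, 0, 0, 52, 77])) (.split 196 (.close [37, 146, 384, 385, 66, 386,
  387, 388, 152, 4]) (.split 162 (.close [30, 38, 38, 151, 389, 390, 12, 12, 4, 391]) (.close [43,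
  43, 116, 21, 88, 88, 392, 0, 393, 2, 394, 52]))))))))))))))))))))))))))))))))))))))))))))))))))))

theorem firstRows_injOn : (Set.Iio 4).InjOn firstRows := by
  have : ∀ i < 4, ∀ j < 4, firstRows i = firstRows j → i = j := by decide
  exact fun i hi j hj => this i hi j hj

theorem lastRows_injOn : (Set.Iio 4).InjOn lastRows := by
  have : ∀ i < 4, ∀ j < 4, lastRows i = lastRows j → i = j := by decide
  exact fun i hi j hj => this i hi j hj

theorem le_ncard_crossings_three (D : Drawing (G6_98 □ cycleGraph 3)) (hD : D.crossings.Finite) :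
    9 ≤ D.crossings.ncard := by
  have inj₁ : ∀ i < 9 * 3, ∀ j < 9 * 3,
      placeEdge firstRows 3 i = placeEdge firstRows 3 j → i = j := by decide +kernel
  have inj₂ : ∀ i < 9 * 3, ∀ j < 9 * 3,
      placeEdge lastRows 3 i = placeEdge lastRows 3 j → i = j := by decide +kernel
  exact le_ncard_crossings (pool := checksThree) (T := refutationThree) D hD
    (by decide +kernel) (by decide +kernel)
    firstRows_injOn lastRows_injOn (by decide +kernel) (by decide +kernel)
    (fun i hi j hj => inj₁ i hi j hj) (fun i hi j hj => inj₂ i hi j hj)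
    (by decide +kernel) (by decide +kernel)

theorem le_ncard_crossings_four (D : Drawing (G6_98 □ cycleGraph 4)) (hD : D.crossings.Finite) :
    12 ≤ D.crossings.ncard := by
  have inj₁ : ∀ i < 9 * 4, ∀ j < 9 * 4,
      placeEdge firstRows 4 i = placeEdge firstRows 4 j → i = j := by decide +kernel
  have inj₂ : ∀ i < 9 * 4, ∀ j < 9 * 4,
      placeEdge lastRows 4 i = placeEdge lastRows 4 j → i = j := by decide +kernel
  exact le_ncard_crossings (pool := checksFour) (T := refutationFour) D hD
    (by decide +kernel) (by decide +kernel)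
    firstRows_injOn lastRows_injOn (by decide +kernel) (by decide +kernel)
    (fun i hi j hj => inj₁ i hi j hj) (fun i hi j hj => inj₂ i hi j hj)
    (by decide +kernel) (by decide +kernel)

theorem crossingNumber_eq {V : Type*} {G : SimpleGraph V} {n : ℕ}
    (hle : ∃ D : Drawing G, D.crossings.Finite ∧ D.crossings.ncard ≤ n)
    (hge : ∀ D : Drawing G, D.crossings.Finite → n ≤ D.crossings.ncard) : crossingNumber G = n := by
  obtain ⟨D, hD, hn⟩ := hle
  have hmem : n ∈ {k : ℕ | ∃ D : Drawing G, D.crossings.Finite ∧ D.crossings.ncard = k} :=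
    ⟨D, hD, hn.antisymm (hge D hD)⟩
  refine (Nat.sInf_le hmem).antisymm ?_
  obtain ⟨D', hD', h⟩ := Nat.sInf_mem ⟨n, hmem⟩
  exact (hge D' hD').trans_eq h

/-- The crossing numbers of `G⁶₉₈ □ C₃` and `G⁶₉₈ □ C₄` are `9` and `12`
respectively. -/
theorem crossingNumber_G6_98_boxProd_smallCycles :
    crossingNumber (G6_98 □ SimpleGraph.cycleGraph 3) = 9 ∧
    crossingNumber (G6_98 □ SimpleGraph.cycleGraph 4) = 12 :=
  ⟨crossingNumber_eq exists_drawing_three le_ncard_crossings_three,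
    crossingNumber_eq exists_drawing_four le_ncard_crossings_four⟩
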